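/- Fix $r \in \mathbb{N}$ and $\varepsilon > 0$. If $\alpha \binom{k}{r} \le \ell \le (1-\alpha)\binom{k}{r}$ for some $\alpha \in (0, 1/2]$, and $\alpha k$ is sufficiently large in terms of $r$ and $\varepsilon$, then $\mathrm{ind}_r(k, \ell) \le (\alpha k)^{-(1/2 - \varepsilon)}$. -/

import Mathlib

open Finset
open scoped Classical

/-- `Nmax r k ℓ n` is the maximum, over all `r`-uniform hypergraphs `G` on `n` vertices,
of the number of `k`-vertex subsets of `G` inducing exactly `ℓ` edges. -/
noncomputable def Nmax (r k ℓ n : ℕ) : ℕ :=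
  sSup {c : ℕ | ∃ E : Finset (Finset (Fin n)), (∀ e ∈ E, e.card = r) ∧
    c = (((Finset.univ : Finset (Fin n)).powersetCard k).filter
        (fun U => (E.filter (fun e => e ⊆ U)).card = ℓ)).card}

namespace EdgeStat
set_option linter.all false

/-- Expectation with respect to the uniform measure on a finite type. -/
noncomputable def Ex {Ω : Type} [Fintype Ω] (f : Ω → ℝ) : ℝ := (∑ ω, f ω) / (Fintype.card Ω : ℝ)

/-- Indicator of a proposition. -/
noncomputable def ind (p : Prop) : ℝ := if p then 1 else 0

lemma ind_nonneg (p : Prop) : 0 ≤ ind p := by unfold ind; split_ifs <;> norm_num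
lemma ind_le_one (p : Prop) : ind p ≤ 1 := by unfold ind; split_ifs <;> norm_num
lemma ind_true {p : Prop} (h : p) : ind p = 1 := by simp [ind, h]
lemma ind_false {p : Prop} (h : ¬ p) : ind p = 0 := by simp [ind, h]
lemma ind_mono {p q : Prop} (h : p → q) : ind p ≤ ind q := by
  by_cases hp : p
  · rw [ind_true hp, ind_true (h hp)]
  · rw [ind_false hp]; exact ind_nonneg q
lemma ind_le_of {p : Prop} {x : ℝ} (hx : 0 ≤ x) (h : p → 1 ≤ x) : ind p ≤ x := by
  by_cases hp : p
  · rw [ind_true hp]; exact h hp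
  · rw [ind_false hp]; exact hx
lemma ind_not (p : Prop) : ind (¬ p) = 1 - ind p := by
  by_cases hp : p <;> simp [ind, hp]
lemma ind_and (p q : Prop) : ind (p ∧ q) = ind p * ind q := by
  by_cases hp : p <;> by_cases hq : q <;> simp [ind, hp, hq]

section
variable {Ω Ω' : Type} [Fintype Ω] [Fintype Ω']

lemma Ex_add (f g : Ω → ℝ) : Ex (fun ω => f ω + g ω) = Ex f + Ex g := by
  simp [Ex, sum_add_distrib, add_div]
lemma Ex_sub (f g : Ω → ℝ) : Ex (fun ω => f ω - g ω) = Ex f - Ex g := by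
  simp [Ex, sum_sub_distrib, sub_div]
lemma Ex_mul_left (c : ℝ) (f : Ω → ℝ) : Ex (fun ω => c * f ω) = c * Ex f := by
  simp [Ex, ← mul_sum, mul_div_assoc]
lemma Ex_mul_right (c : ℝ) (f : Ω → ℝ) : Ex (fun ω => f ω * c) = Ex f * c := by
  simp [Ex, ← sum_mul, div_mul_eq_mul_div]
lemma Ex_div (c : ℝ) (f : Ω → ℝ) : Ex (fun ω => f ω / c) = Ex f / c := by
  simp only [div_eq_mul_inv]; exact Ex_mul_right _ _
lemma Ex_neg (f : Ω → ℝ) : Ex (fun ω => - f ω) = - Ex f := by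
  simp [Ex, neg_div]
lemma Ex_sum {ι : Type} (s : Finset ι) (f : ι → Ω → ℝ) :
    Ex (fun ω => ∑ i ∈ s, f i ω) = ∑ i ∈ s, Ex (f i) := by
  simp only [Ex]; rw [sum_comm, sum_div]
lemma Ex_const [Nonempty Ω] (c : ℝ) : Ex (fun _ : Ω => c) = c := by
  simp [Ex]
lemma Ex_zero : Ex (fun _ : Ω => (0:ℝ)) = 0 := by
  simp [Ex]
lemma Ex_mono {f g : Ω → ℝ} (h : ∀ ω, f ω ≤ g ω) : Ex f ≤ Ex g := by
  unfold Ex; gcongr; exact h _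
lemma Ex_nonneg {f : Ω → ℝ} (h : ∀ ω, 0 ≤ f ω) : 0 ≤ Ex f := by
  unfold Ex; exact div_nonneg (sum_nonneg fun i _ => h i) (by positivity)
lemma Ex_le_const [Nonempty Ω] {f : Ω → ℝ} {c : ℝ} (h : ∀ ω, f ω ≤ c) : Ex f ≤ c := by
  rw [← Ex_const (Ω := Ω) c]; exact Ex_mono h
lemma Ex_congr {f g : Ω → ℝ} (h : ∀ ω, f ω = g ω) : Ex f = Ex g := by
  congr 1; ext; exact h _
lemma Ex_equiv (e : Ω ≃ Ω') (f : Ω' → ℝ) : Ex (fun ω => f (e ω)) = Ex f := by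
  unfold Ex; rw [e.sum_comp, Fintype.card_congr e]
lemma Ex_comm (f : Ω → Ω' → ℝ) : Ex (fun a => Ex (fun b => f a b)) = Ex (fun b => Ex (fun a => f a b)) := by
  simp only [Ex, ← sum_div]; rw [sum_comm]; rw [div_div, div_div, mul_comm]
lemma Ex_prod (f : Ω × Ω' → ℝ) : Ex f = Ex (fun a => Ex (fun b => f (a, b))) := by
  simp only [Ex, ← sum_div, Fintype.sum_prod_type, Fintype.card_prod]
  push_cast; rw [div_div, mul_comm]
lemma Ex_abs (f : Ω → ℝ) : |Ex f| ≤ Ex (fun ω => |f ω|) := by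
  unfold Ex; rw [abs_div, Nat.abs_cast]; gcongr; exact abs_sum_le_sum_abs _ _

lemma Ex_cs (f g : Ω → ℝ) : (Ex (fun ω => f ω * g ω)) ^ 2 ≤ Ex (fun ω => f ω ^ 2) * Ex (fun ω => g ω ^ 2) := by
  unfold Ex
  rw [div_pow, div_mul_div_comm, ← sq]
  gcongr
  exact sum_mul_sq_le_sq_mul_sq _ _ _

lemma Ex_sq_le [Nonempty Ω] (f : Ω → ℝ) : (Ex f) ^ 2 ≤ Ex (fun ω => f ω ^ 2) := by
  have := Ex_cs f (fun _ => 1)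
  simpa [Ex_const] using this

lemma Ex_pos_exists {f : Ω → ℝ} (h : 0 < Ex f) : ∃ ω, 0 < f ω := by
  by_contra! hc
  have : Ex f ≤ Ex (fun _ : Ω => (0:ℝ)) := Ex_mono hc
  rw [Ex_zero] at this; linarith

lemma Ex_eq_zero [Nonempty Ω] {f : Ω → ℝ} (h : ∀ ω, 0 ≤ f ω) (h0 : Ex f = 0) (ω : Ω) : f ω = 0 := by
  unfold Ex at h0
  have hc : (Fintype.card Ω : ℝ) ≠ 0 := by simp
  have : ∑ ω, f ω = 0 := by
    rcases div_eq_zero_iff.mp h0 with h | h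
    · exact h
    · exact absurd h hc
  exact (sum_eq_zero_iff_of_nonneg (fun i _ => h i)).mp this ω (mem_univ _)

lemma markov {f : Ω → ℝ} (h : ∀ ω, 0 ≤ f ω) {t : ℝ} (ht : 0 < t) :
    Ex (fun ω => ind (t ≤ f ω)) ≤ Ex f / t := by
  rw [← Ex_div]
  apply Ex_mono; intro ω
  apply ind_le_of (div_nonneg (h ω) ht.le)
  intro h1; rwa [le_div_iff₀ ht, one_mul]

/-- Paley and Zygmund. -/
lemma pz [Nonempty Ω] {f : Ω → ℝ} (h : ∀ ω, 0 ≤ f ω) {C : ℝ} (hC : 0 < C)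
    (h2 : Ex (fun ω => f ω ^ 2) ≤ C * (Ex f) ^ 2) (hpos : 0 < Ex f) :
    1 / (4 * C) ≤ Ex (fun ω => ind (Ex f / 2 ≤ f ω)) := by
  set μ := Ex f with hμ
  set p := Ex (fun ω => ind (μ / 2 ≤ f ω)) with hp
  have h1 : μ / 2 ≤ Ex (fun ω => f ω * ind (μ / 2 ≤ f ω)) := by
    have : Ex f ≤ Ex (fun ω => f ω * ind (μ / 2 ≤ f ω) + μ / 2) := by
      apply Ex_mono; intro ω
      by_cases hh : μ / 2 ≤ f ω
      · rw [ind_true hh]; linarith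
      · rw [ind_false hh]; linarith [not_le.mp hh]
    rw [Ex_add, Ex_const] at this
    linarith
  have h3 := Ex_cs f (fun ω => ind (μ / 2 ≤ f ω))
  have h4 : Ex (fun ω => ind (μ / 2 ≤ f ω) ^ 2) = p := by
    apply Ex_congr; intro ω; unfold ind; split_ifs <;> norm_num
  rw [h4] at h3
  have hp0 : 0 ≤ p := Ex_nonneg fun _ => ind_nonneg _
  have h5 : (μ / 2) ^ 2 ≤ C * μ ^ 2 * p := by
    calc (μ / 2) ^ 2 ≤ (Ex (fun ω => f ω * ind (μ / 2 ≤ f ω))) ^ 2 := by gcongr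
      _ ≤ _ := h3
      _ ≤ _ := by gcongr
  have hμ2 : 0 < μ ^ 2 := by positivity
  rw [div_le_iff₀ (by positivity)]
  nlinarith

/-- the probability of being nonzero from second and fourth moments -/
lemma pz_zero [Nonempty Ω] {f : Ω → ℝ} {C : ℝ} (hC : 0 < C)
    (h4 : Ex (fun ω => f ω ^ 4) ≤ C * (Ex (fun ω => f ω ^ 2)) ^ 2) (hpos : 0 < Ex (fun ω => f ω ^ 2)) :
    1 / C ≤ Ex (fun ω => ind (f ω ≠ 0)) := by
  have h3 := Ex_cs (fun ω => f ω ^ 2) (fun ω => ind (f ω ≠ 0))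
  have e1 : Ex (fun ω => f ω ^ 2 * ind (f ω ≠ 0)) = Ex (fun ω => f ω ^ 2) := by
    apply Ex_congr; intro ω; unfold ind; split_ifs with h
    · simp
    · simp at h; simp [h]
  have e2 : Ex (fun ω => ind (f ω ≠ 0) ^ 2) = Ex (fun ω => ind (f ω ≠ 0)) := by
    apply Ex_congr; intro ω; unfold ind; split_ifs <;> norm_num
  have e3 : Ex (fun ω => (f ω ^ 2) ^ 2) = Ex (fun ω => f ω ^ 4) := by
    apply Ex_congr; intro ω; ring
  rw [e1, e2, e3] at h3
  have hp0 : 0 ≤ Ex (fun ω => ind (f ω ≠ 0)) := Ex_nonneg fun _ => ind_nonneg _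
  have hμ2 : 0 < (Ex (fun ω => f ω ^ 2)) ^ 2 := by positivity
  rw [div_le_iff₀ hC]
  have : (Ex fun ω => f ω ^ 2) ^ 2 ≤ (C * (Ex fun ω => f ω ^ 2) ^ 2) * Ex (fun ω => ind (f ω ≠ 0)) :=
    h3.trans (by gcongr)
  nlinarith

end

section product
variable {V Ω : Type} [Fintype V] [DecidableEq V] [Fintype Ω]

/-- resampling a set of coordinates -/
lemma Ex_piecewise (B : Finset V) (f : (V → Ω) → ℝ) :
    Ex (fun p : V → Ω => Ex (fun q : V → Ω => f (B.piecewise q p))) = Ex f := by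
  cases isEmpty_or_nonempty (V → Ω) with
  | inl h => simp [Ex]
  | inr h =>
  rw [← Ex_prod (fun pq : (V → Ω) × (V → Ω) => f (B.piecewise pq.2 pq.1))]
  let e : (V → Ω) × (V → Ω) ≃ (V → Ω) × (V → Ω) :=
    { toFun := fun pq => (B.piecewise pq.2 pq.1, B.piecewise pq.1 pq.2)
      invFun := fun pq => (B.piecewise pq.2 pq.1, B.piecewise pq.1 pq.2)
      left_inv := by
        intro pq; ext i <;> by_cases hi : i ∈ B <;> simp [hi]
      right_inv := by
        intro pq; ext i <;> by_cases hi : i ∈ B <;> simp [hi] }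
  have := Ex_equiv e (fun pq : (V → Ω) × (V → Ω) => f pq.1)
  simp only [e, Equiv.coe_fn_mk] at this
  rw [this, Ex_prod]
  simp [Ex_const]

/-- resampling one coordinate -/
lemma Ex_update [Nonempty Ω] (i : V) (f : (V → Ω) → ℝ) :
    Ex (fun p : V → Ω => Ex (fun o : Ω => f (Function.update p i o))) = Ex f := by
  rw [← Ex_prod (fun pq : (V → Ω) × Ω => f (Function.update pq.1 i pq.2))]
  let e : (V → Ω) × Ω ≃ (V → Ω) × Ω :=
    { toFun := fun pq => (Function.update pq.1 i pq.2, pq.1 i)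
      invFun := fun pq => (Function.update pq.1 i pq.2, pq.1 i)
      left_inv := by
        intro pq; ext <;> simp
      right_inv := by
        intro pq; ext <;> simp }
  have := Ex_equiv e (fun pq : (V → Ω) × Ω => f pq.1)
  simp only [e, Equiv.coe_fn_mk] at this
  rw [this, Ex_prod]
  simp [Ex_const]

/-- independence of one coordinate -/
lemma Ex_indep [Nonempty Ω] (i : V) (g : Ω → ℝ) (f : (V → Ω) → ℝ)
    (hf : ∀ p o, f (Function.update p i o) = f p) :
    Ex (fun p : V → Ω => g (p i) * f p) = Ex g * Ex f := by
  rw [← Ex_update i]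
  simp only [Function.update_self, hf, Ex_mul_right, Ex_mul_left]

end product
end EdgeStat

namespace EdgeStat
set_option linter.all false

section poly
variable {V : Type} [Fintype V] [DecidableEq V]

/-- multilinear monomial -/
def mon (I : Finset V) (x : V → ℝ) : ℝ := ∏ i ∈ I, x i
/-- evaluation of a multilinear polynomial -/
def ev (a : Finset V → ℝ) (x : V → ℝ) : ℝ := ∑ I, a I * mon I x
/-- supported on subsets of `J` of size at most `d` -/
def Deg (a : Finset V → ℝ) (J : Finset V) (d : ℕ) : Prop := ∀ I, a I ≠ 0 → I ⊆ J ∧ I.card ≤ d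
/-- sum of squares of coefficients -/
def sq (a : Finset V → ℝ) : ℝ := ∑ I, a I ^ 2
/-- the part free of `i` -/
def Z (i : V) (a : Finset V → ℝ) : Finset V → ℝ := fun K => if i ∈ K then 0 else a K
/-- partial derivative in `i` -/
def D (i : V) (a : Finset V → ℝ) : Finset V → ℝ := fun K => if i ∈ K then 0 else a (insert i K)
/-- iterated derivative -/
def der (I : Finset V) (a : Finset V → ℝ) : Finset V → ℝ :=
  fun K => if Disjoint I K then a (I ∪ K) else 0

lemma sum_split (i : V) (f : Finset V → ℝ) :
    ∑ K, f K = ∑ K, if i ∈ K then 0 else (f K + f (insert i K)) := by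
  have h1 : ∑ K, (if i ∈ K then 0 else (f K + f (insert i K)))
      = ∑ K with i ∉ K, f K + ∑ K with i ∉ K, f (insert i K) := by
    rw [← sum_add_distrib, sum_filter]
    apply sum_congr rfl; intro K _; by_cases h : i ∈ K <;> simp [h]
  have h2 : ∑ K with i ∉ K, f (insert i K) = ∑ K with i ∈ K, f K := by
    apply sum_nbij' (fun K => insert i K) (fun K => K.erase i)
    · intro K hK; simp
    · intro K hK; simp
    · intro K hK; simp at hK; simp [hK]
    · intro K hK; simp at hK; simp [hK]
    · intro K hK; rfl
  rw [h1, h2, add_comm, sum_filter_add_sum_filter_not]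

lemma ev_split (i : V) (a : Finset V → ℝ) (x : V → ℝ) :
    ev a x = ev (Z i a) x + x i * ev (D i a) x := by
  unfold ev
  rw [sum_split i, mul_sum, ← sum_add_distrib]
  apply sum_congr rfl; intro K _
  by_cases h : i ∈ K
  · simp [h, Z, D]
  · simp only [h, if_false, Z, D, mon]
    rw [prod_insert h]; ring

lemma sq_split (i : V) (a : Finset V → ℝ) : sq a = sq (Z i a) + sq (D i a) := by
  unfold sq
  rw [sum_split i, ← sum_add_distrib]
  apply sum_congr rfl; intro K _
  by_cases h : i ∈ K <;> simp [h, Z, D]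

lemma sq_nonneg' (a : Finset V → ℝ) : 0 ≤ sq a := sum_nonneg fun _ _ => sq_nonneg _

lemma sq_eq_zero {a : Finset V → ℝ} (h : sq a = 0) : a = fun _ => 0 := by
  funext I
  have := (sum_eq_zero_iff_of_nonneg (fun I _ => sq_nonneg (a I))).mp h I (mem_univ _)
  simpa using this

lemma ev_congr {a : Finset V → ℝ} {x y : V → ℝ} (h : ∀ I, a I ≠ 0 → ∀ j ∈ I, x j = y j) :
    ev a x = ev a y := by
  unfold ev; apply sum_congr rfl; intro I _
  by_cases h0 : a I = 0
  · simp [h0]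
  · congr 1; exact prod_congr rfl (h I h0)

lemma ev_zero (x : V → ℝ) : ev (fun _ => 0) x = 0 := by simp [ev]

lemma ev_Z_update (i : V) (a : Finset V → ℝ) (x : V → ℝ) (t : ℝ) :
    ev (Z i a) (Function.update x i t) = ev (Z i a) x := by
  apply ev_congr; intro I hI j hj
  have : i ∉ I := by intro h; simp [Z, h] at hI
  rw [Function.update_of_ne]; rintro rfl; exact this hj

lemma ev_D_update (i : V) (a : Finset V → ℝ) (x : V → ℝ) (t : ℝ) :
    ev (D i a) (Function.update x i t) = ev (D i a) x := by
  apply ev_congr; intro I hI j hj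
  have : i ∉ I := by intro h; simp [D, h] at hI
  rw [Function.update_of_ne]; rintro rfl; exact this hj

lemma ev_update (i : V) (a : Finset V → ℝ) (x : V → ℝ) (t : ℝ) :
    ev a (Function.update x i t) = ev (Z i a) x + t * ev (D i a) x := by
  rw [ev_split i, ev_Z_update, ev_D_update, Function.update_self]

lemma ev_D_eq (i : V) (a : Finset V → ℝ) (x : V → ℝ) :
    ev (D i a) x = ev a (Function.update x i 1) - ev a (Function.update x i 0) := by
  rw [ev_update, ev_update]; ring

lemma Deg.mono {a : Finset V → ℝ} {J J' : Finset V} {d d' : ℕ} (h : Deg a J d) (hJ : J ⊆ J')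
    (hd : d ≤ d') : Deg a J' d' := fun I hI => ⟨(h I hI).1.trans hJ, (h I hI).2.trans hd⟩

lemma Deg.Z {a : Finset V → ℝ} {J : Finset V} {d : ℕ} (h : Deg a J d) (i : V) :
    Deg (Z i a) (J.erase i) d := by
  intro I hI
  by_cases hi : i ∈ I
  · simp [EdgeStat.Z, hi] at hI
  · simp only [EdgeStat.Z, hi, if_false] at hI
    exact ⟨subset_erase.mpr ⟨(h I hI).1, hi⟩, (h I hI).2⟩

lemma Deg.D {a : Finset V → ℝ} {J : Finset V} {d : ℕ} (h : Deg a J d) (i : V) :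
    Deg (D i a) (J.erase i) (d - 1) := by
  intro I hI
  by_cases hi : i ∈ I
  · simp [EdgeStat.D, hi] at hI
  · simp only [EdgeStat.D, hi, if_false] at hI
    have := h _ hI
    rw [card_insert_of_notMem hi] at this
    exact ⟨subset_erase.mpr ⟨(subset_insert _ _).trans this.1, hi⟩, by omega⟩

lemma Deg.D_zero {a : Finset V → ℝ} {J : Finset V} (h : Deg a J 0) (i : V) : EdgeStat.D i a = fun _ => 0 := by
  funext I
  by_contra hI
  by_cases hi : i ∈ I
  · simp [EdgeStat.D, hi] at hI
  · simp only [EdgeStat.D, hi, if_false] at hI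
    have := (h _ hI).2
    rw [card_insert_of_notMem hi] at this
    omega

lemma Deg.D_out {a : Finset V → ℝ} {J : Finset V} {d : ℕ} (h : Deg a J d) {i : V} (hi : i ∉ J) :
    EdgeStat.D i a = fun _ => 0 := by
  funext I
  by_contra hI
  by_cases hi' : i ∈ I
  · simp [EdgeStat.D, hi'] at hI
  · simp only [EdgeStat.D, hi', if_false] at hI
    exact hi ((h _ hI).1 (mem_insert_self _ _))

lemma Deg.der {a : Finset V → ℝ} {J : Finset V} {d : ℕ} (h : Deg a J d) (I : Finset V) :
    Deg (der I a) J (d - I.card) := by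
  intro K hK
  by_cases hi : Disjoint I K
  · simp only [EdgeStat.der, hi, if_true] at hK
    have := h _ hK
    rw [card_union_of_disjoint hi] at this
    exact ⟨subset_union_right.trans this.1, by omega⟩
  · simp [EdgeStat.der, hi] at hK

lemma Deg.der_zero {a : Finset V → ℝ} {J : Finset V} {d : ℕ} (h : Deg a J d) {I : Finset V}
    (hI : d < I.card) : EdgeStat.der I a = fun _ => 0 := by
  funext K
  by_contra hK
  by_cases hi : Disjoint I K
  · simp only [EdgeStat.der, hi, if_true] at hK
    have := (h _ hK).2
    rw [card_union_of_disjoint hi] at this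
    omega
  · simp [EdgeStat.der, hi] at hK

lemma der_empty (a : Finset V → ℝ) : der ∅ a = a := by
  funext K; simp [der]

lemma D_der {i : V} {I : Finset V} (hi : i ∉ I) (a : Finset V → ℝ) :
    D i (der I a) = der (insert i I) a := by
  funext K
  by_cases h : i ∈ K
  · simp [D, der, h]
  · have : I ∪ insert i K = insert i (I ∪ K) := by rw [union_insert]
    simp [D, der, h, hi, this]

lemma D_der_mem {i : V} {I : Finset V} (hi : i ∈ I) (a : Finset V → ℝ) :
    D i (der I a) = fun _ => 0 := by
  funext K
  by_cases h : i ∈ K <;> simp [D, der, h, hi]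

lemma der_D {i : V} {I : Finset V} (hi : i ∉ I) (a : Finset V → ℝ) :
    der I (D i a) = der (insert i I) a := by
  funext K
  by_cases h : i ∈ K
  · simp [D, der, h]
  · simp [D, der, h, hi]

lemma sq_D (i : V) (a : Finset V → ℝ) : sq (D i a) = ∑ I, if i ∈ I then a I ^ 2 else 0 := by
  rw [sum_split i]; unfold sq
  apply sum_congr rfl; intro K _
  by_cases h : i ∈ K <;> simp [D, h]

lemma sq_der (I : Finset V) (a : Finset V → ℝ) :
    sq (der I a) = ∑ K, if I ⊆ K then a K ^ 2 else 0 := by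
  induction I using Finset.induction_on generalizing a with
  | empty => simp [der_empty, sq]
  | insert i I hi ih =>
    rw [← der_D hi, ih, sum_split i (fun K => if insert i I ⊆ K then a K ^ 2 else 0)]
    apply sum_congr rfl; intro K _
    by_cases h : i ∈ K
    · simp [D, h]
    · have h1 : ¬ insert i I ⊆ K := fun hh => h (hh (mem_insert_self _ _))
      have h2 : insert i I ⊆ insert i K ↔ I ⊆ K := by
        constructor
        · intro hh j hj
          have := hh (mem_insert_of_mem hj)
          rcases mem_insert.mp this with rfl | h'
          · exact absurd hj hi
          · exact h'
        · exact insert_subset_insert i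
      simp [D, h, h1, h2]

lemma sum_sq_D_le {a : Finset V → ℝ} {J : Finset V} {d : ℕ} (h : Deg a J d) :
    ∑ i, sq (D i a) ≤ d * sq a := by
  simp only [sq_D]
  rw [sum_comm]; unfold sq; rw [mul_sum]
  apply sum_le_sum; intro I _
  by_cases h0 : a I = 0
  · simp [h0]
  · rw [← sum_filter, sum_const, nsmul_eq_mul]
    have : (univ.filter (fun i => i ∈ I)).card ≤ d := by
      simpa using (h I h0).2
    gcongr

/-- fixing the coordinates outside `B` to the values `z` -/
def rest (a : Finset V → ℝ) (B : Finset V) (z : V → ℝ) : Finset V → ℝ :=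
  fun K => ∑ I, if I ∩ B = K then a I * mon (I \ B) z else 0

lemma ev_rest (a : Finset V → ℝ) (B : Finset V) (z x : V → ℝ) :
    ev (rest a B z) x = ev a (B.piecewise x z) := by
  unfold ev rest
  simp only [sum_mul]
  rw [sum_comm]
  apply sum_congr rfl; intro I _
  simp only [ite_mul, zero_mul]
  rw [sum_ite_eq]
  simp only [mem_univ, if_true]
  rw [mul_assoc]; congr 1
  unfold mon
  rw [mul_comm, ← prod_inter_mul_prod_sdiff I B]
  congr 1
  · apply prod_congr rfl; intro i hi; rw [piecewise_eq_of_mem _ _ _ (mem_inter.mp hi).2]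
  · apply prod_congr rfl; intro i hi; rw [piecewise_eq_of_notMem _ _ _ (mem_sdiff.mp hi).2]

lemma Deg.rest {a : Finset V → ℝ} {J : Finset V} {d : ℕ} (h : Deg a J d) (B : Finset V) (z : V → ℝ) :
    Deg (rest a B z) (J ∩ B) d := by
  intro K hK
  obtain ⟨I, -, hI⟩ := exists_ne_zero_of_sum_ne_zero hK
  by_cases hIB : I ∩ B = K
  · have h0 : a I ≠ 0 := by
      rw [if_pos hIB] at hI; exact left_ne_zero_of_mul hI
    subst hIB
    exact ⟨inter_subset_inter_right (h I h0).1, (card_le_card inter_subset_left).trans (h I h0).2⟩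
  · rw [if_neg hIB] at hI; exact absurd rfl hI

lemma ev_D_rest {B : Finset V} {i : V} (hi : i ∈ B) (a : Finset V → ℝ) (z x : V → ℝ) :
    ev (D i (rest a B z)) x = ev (D i a) (B.piecewise x z) := by
  rw [ev_D_eq, ev_D_eq, ev_rest, ev_rest]
  have : ∀ t, B.piecewise (Function.update x i t) z = Function.update (B.piecewise x z) i t := by
    intro t; rw [Finset.update_piecewise_of_mem _ _ _ hi]
  rw [this, this]

lemma ev_D_rest_out {B : Finset V} {i : V} (hi : i ∉ B) (a : Finset V → ℝ) (z : V → ℝ) :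
    D i (rest a B z) = fun _ => 0 := by
  funext K
  by_cases h : i ∈ K
  · simp [D, h]
  · simp only [D, h, if_false, rest]
    apply sum_eq_zero; intro I _
    rw [if_neg]; intro hh
    have := mem_insert_self i K
    rw [← hh] at this; exact hi (mem_inter.mp this).2

end poly

section moments
variable {V Ω : Type} [Fintype V] [DecidableEq V] [Fintype Ω] [Nonempty Ω]

/-- Independent coordinates with controlled moments. -/
def Good (z : V → Ω → ℝ) : Prop := ∀ i, Ex (z i) = 0 ∧ Ex (fun o => z i o ^ 2) = 1 ∧
  Ex (fun o => z i o ^ 3) = 0 ∧ Ex (fun o => z i o ^ 4) ≤ 9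

/-- the random point -/
def X (z : V → Ω → ℝ) (ω : V → Ω) : V → ℝ := fun i => z i (ω i)

lemma X_update (z : V → Ω → ℝ) (ω : V → Ω) (i : V) (o : Ω) :
    X z (Function.update ω i o) = Function.update (X z ω) i (z i o) := by
  funext j; by_cases h : j = i
  · subst h; simp [X]
  · simp [X, h]

lemma ev_Z_X_update (z : V → Ω → ℝ) (a : Finset V → ℝ) (ω : V → Ω) (i : V) (o : Ω) :
    ev (Z i a) (X z (Function.update ω i o)) = ev (Z i a) (X z ω) := by
  rw [X_update, ev_Z_update]
lemma ev_D_X_update (z : V → Ω → ℝ) (a : Finset V → ℝ) (ω : V → Ω) (i : V) (o : Ω) :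
    ev (D i a) (X z (Function.update ω i o)) = ev (D i a) (X z ω) := by
  rw [X_update, ev_D_update]

lemma Deg_empty_eq {a : Finset V → ℝ} {d : ℕ} (h : Deg a ∅ d) : (∀ x, ev a x = a ∅) ∧ sq a = a ∅ ^ 2 := by
  have h0 : ∀ I, I ≠ ∅ → a I = 0 := by
    intro I hI; by_contra hc
    exact hI (subset_empty.mp (h I hc).1)
  constructor
  · intro x; unfold ev
    rw [sum_eq_single ∅]
    · simp [mon]
    · intro I _ hI; simp [h0 I hI]
    · simp
  · unfold sq; rw [sum_eq_single ∅]
    · intro I _ hI; simp [h0 I hI]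
    · simp

lemma Ex_lin2 {z : V → Ω → ℝ} (hz : Good z) (i : V) {A B : (V → Ω) → ℝ}
    (hA : ∀ p o, A (Function.update p i o) = A p) (hB : ∀ p o, B (Function.update p i o) = B p) :
    Ex (fun ω => (A ω + z i (ω i) * B ω) ^ 2) = Ex (fun ω => A ω ^ 2) + Ex (fun ω => B ω ^ 2) := by
  obtain ⟨h1, h2, h3, h4⟩ := hz i
  have e : ∀ ω : V → Ω, (A ω + z i (ω i) * B ω) ^ 2
      = A ω ^ 2 + z i (ω i) * (2 * A ω * B ω) + (fun o => z i o ^ 2) (ω i) * (B ω) ^ 2 := by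
    intro ω; ring
  simp only [e]
  rw [Ex_add, Ex_add, Ex_indep i (z i), Ex_indep i (fun o => z i o ^ 2), h1, h2]
  · ring
  · intro p o; rw [hB]
  · intro p o; rw [hA, hB]

lemma Ex_lin4 {z : V → Ω → ℝ} (hz : Good z) (i : V) {A B : (V → Ω) → ℝ}
    (hA : ∀ p o, A (Function.update p i o) = A p) (hB : ∀ p o, B (Function.update p i o) = B p) :
    Ex (fun ω => (A ω + z i (ω i) * B ω) ^ 4) ≤ Ex (fun ω => A ω ^ 4)
      + 6 * Ex (fun ω => A ω ^ 2 * B ω ^ 2) + 9 * Ex (fun ω => B ω ^ 4) := by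
  obtain ⟨h1, h2, h3, h4⟩ := hz i
  have e : ∀ ω : V → Ω, (A ω + z i (ω i) * B ω) ^ 4
      = A ω ^ 4 + z i (ω i) * (4 * A ω ^ 3 * B ω) + (fun o => z i o ^ 2) (ω i) * (6 * (A ω ^ 2 * B ω ^ 2))
        + (fun o => z i o ^ 3) (ω i) * (4 * A ω * B ω ^ 3) + (fun o => z i o ^ 4) (ω i) * (B ω) ^ 4 := by
    intro ω; ring
  simp only [e]
  rw [Ex_add, Ex_add, Ex_add, Ex_add, Ex_indep i (z i), Ex_indep i (fun o => z i o ^ 2),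
    Ex_indep i (fun o => z i o ^ 3), Ex_indep i (fun o => z i o ^ 4), h1, h2, h3, Ex_mul_left]
  · have : 0 ≤ Ex (fun ω => B ω ^ 4) := Ex_nonneg fun ω => by positivity
    nlinarith
  · intro p o; rw [hB]
  · intro p o; rw [hA, hB]
  · intro p o; rw [hA, hB]
  · intro p o; rw [hA, hB]

lemma moments {z : V → Ω → ℝ} (hz : Good z) (J : Finset V) : ∀ (a : Finset V → ℝ) (d : ℕ), Deg a J d →
    Ex (fun ω => ev a (X z ω) ^ 2) = sq a ∧ Ex (fun ω => ev a (X z ω) ^ 4) ≤ 9 ^ d * sq a ^ 2 := by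
  induction J using Finset.induction_on with
  | empty =>
    intro a d h
    obtain ⟨h1, h2⟩ := Deg_empty_eq h
    simp only [h1, h2, Ex_const, true_and]
    have : (1:ℝ) ≤ 9 ^ d := one_le_pow₀ (by norm_num)
    have h4 : 0 ≤ (a ∅) ^ 4 := by positivity
    nlinarith
  | insert i J hi ih =>
    intro a d h
    have hJ : (insert i J).erase i = J := erase_insert hi
    have hZ := h.Z i
    have hD := h.D i
    rw [hJ] at hZ hD
    obtain ⟨z2, z4⟩ := ih _ _ hZ
    obtain ⟨d2, d4⟩ := ih _ _ hD
    have e : ∀ ω : V → Ω, ev a (X z ω) = ev (Z i a) (X z ω) + z i (ω i) * ev (D i a) (X z ω) := by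
      intro ω; exact ev_split i a _
    have l2 := Ex_lin2 hz i (A := fun ω => ev (Z i a) (X z ω)) (B := fun ω => ev (D i a) (X z ω)) (fun p o => ev_Z_X_update z a p i o) (fun p o => ev_D_X_update z a p i o)
    have l4 := Ex_lin4 hz i (A := fun ω => ev (Z i a) (X z ω)) (B := fun ω => ev (D i a) (X z ω)) (fun p o => ev_Z_X_update z a p i o) (fun p o => ev_D_X_update z a p i o)
    simp only [e]
    constructor
    · rw [l2, z2, d2, ← sq_split]
    · refine l4.trans ?_
      rw [sq_split i a]
      set A := Ex (fun ω => ev (Z i a) (X z ω) ^ 4)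
      set B := Ex (fun ω => ev (D i a) (X z ω) ^ 4)
      set M := Ex (fun ω => ev (Z i a) (X z ω) ^ 2 * ev (D i a) (X z ω) ^ 2)
      have hM0 : 0 ≤ M := Ex_nonneg fun ω => by positivity
      have hM : M ^ 2 ≤ A * B := by
        have := Ex_cs (fun ω => ev (Z i a) (X z ω) ^ 2) (fun ω => ev (D i a) (X z ω) ^ 2)
        simpa only [← pow_mul] using this
      set s := sq (Z i a)
      set t := sq (D i a) with ht
      have hs0 : 0 ≤ s := sq_nonneg' _
      have ht0 : 0 ≤ t := sq_nonneg' _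
      have hA0 : 0 ≤ A := Ex_nonneg fun ω => by positivity
      have hB0 : 0 ≤ B := Ex_nonneg fun ω => by positivity
      have hB9 : 9 * B ≤ 9 ^ d * t ^ 2 := by
        cases d with
        | zero =>
          have := h.D_zero i
          have hB : B = 0 := by
            simp only [B, this, ev_zero]; simp [Ex_zero]
          rw [hB, mul_zero]; positivity
        | succ d =>
          simp only [Nat.add_sub_cancel] at d4
          rw [pow_succ]; nlinarith
      have hM3 : 3 * M ≤ 9 ^ d * (s * t) := by
        have hnn : 0 ≤ 9 ^ d * (s * t) := by positivity
        refine (abs_le_of_sq_le_sq' ?_ hnn).2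
        calc (3 * M) ^ 2 = 9 * M ^ 2 := by ring
          _ ≤ 9 * (A * B) := by linarith
          _ = A * (9 * B) := by ring
          _ ≤ (9 ^ d * s ^ 2) * (9 ^ d * t ^ 2) := by gcongr
          _ = _ := by ring
      nlinarith

lemma moment2 {z : V → Ω → ℝ} (hz : Good z) (a : Finset V → ℝ) :
    Ex (fun ω => ev a (X z ω) ^ 2) = sq a :=
  (moments hz univ a (Fintype.card V) (fun I _ => ⟨subset_univ _, card_le_univ _⟩)).1

lemma moment4 {z : V → Ω → ℝ} (hz : Good z) {a : Finset V → ℝ} {J : Finset V} {d : ℕ} (h : Deg a J d) :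
    Ex (fun ω => ev a (X z ω) ^ 4) ≤ 9 ^ d * sq a ^ 2 := (moments hz J a d h).2

lemma moment22 {z : V → Ω → ℝ} (hz : Good z) {a b : Finset V → ℝ} {J J' : Finset V} {d : ℕ} (h : Deg a J d)
    (h' : Deg b J' d) :
    Ex (fun ω => ev a (X z ω) ^ 2 * ev b (X z ω) ^ 2) ≤ 9 ^ d * (sq a * sq b) := by
  have := Ex_cs (fun ω => ev a (X z ω) ^ 2) (fun ω => ev b (X z ω) ^ 2)
  simp only [← pow_mul] at this
  have ha := moment4 hz h
  have hb := moment4 hz h'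
  have sa := sq_nonneg' a
  have sb := sq_nonneg' b
  apply abs_le_of_sq_le_sq' _ (by positivity) |>.2
  refine this.trans ?_
  norm_num at *
  calc _ ≤ (9 ^ d * sq a ^ 2) * (9 ^ d * sq b ^ 2) := by
        apply mul_le_mul ha hb (Ex_nonneg fun ω => by positivity) (by positivity)
    _ = _ := by ring

lemma moment_vec {z : V → Ω → ℝ} (hz : Good z) {ι : Type} (s : Finset ι) (c : ι → ℝ) (hc : ∀ k ∈ s, 0 ≤ c k)
    (a : ι → Finset V → ℝ) {J : Finset V} {d : ℕ} (h : ∀ k ∈ s, Deg (a k) J d) :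
    Ex (fun ω => (∑ k ∈ s, c k * ev (a k) (X z ω) ^ 2) ^ 2) ≤ 9 ^ d * (∑ k ∈ s, c k * sq (a k)) ^ 2 := by
  have e : ∀ ω : V → Ω, (∑ k ∈ s, c k * ev (a k) (X z ω) ^ 2) ^ 2 =
      ∑ k ∈ s, ∑ l ∈ s, (c k * c l) * (ev (a k) (X z ω) ^ 2 * ev (a l) (X z ω) ^ 2) := by
    intro ω; rw [pow_two, sum_mul_sum]
    apply sum_congr rfl; intro k _; apply sum_congr rfl; intro l _; ring
  simp only [e]
  rw [Ex_sum]; simp only [Ex_sum, Ex_mul_left]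
  rw [pow_two, sum_mul_sum, mul_sum]
  apply sum_le_sum; intro k hk
  rw [mul_sum]
  apply sum_le_sum; intro l hl
  calc _ ≤ (c k * c l) * (9 ^ d * (sq (a k) * sq (a l))) := by
        have := hc k hk; have := hc l hl
        gcongr; exact moment22 hz (h k hk) (h l hl)
    _ = _ := by ring

/-- mean -/
lemma moment1 {z : V → Ω → ℝ} (hz : Good z) (J : Finset V) : ∀ (a : Finset V → ℝ) (d : ℕ), Deg a J d →
    Ex (fun ω => ev a (X z ω)) = a ∅ := by
  induction J using Finset.induction_on with
  | empty =>
    intro a d h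
    simp only [(Deg_empty_eq h).1, Ex_const]
  | insert i J hi ih =>
    intro a d h
    have hJ : (insert i J).erase i = J := erase_insert hi
    have hZ := h.Z i
    rw [hJ] at hZ
    have e : ∀ ω : V → Ω, ev a (X z ω) = ev (Z i a) (X z ω) + z i (ω i) * ev (D i a) (X z ω) := by
      intro ω; exact ev_split i a _
    simp only [e]
    rw [Ex_add, Ex_indep i (z i), (hz i).1, ih _ _ hZ]
    · simp [Z]
    · intro p o; exact ev_D_X_update z a p i o

end moments

section signs
variable {V : Type} [Fintype V] [DecidableEq V]

/-- sign of a bit -/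
def bs (b : Bool) : ℝ := if b then 1 else -1
/-- sign vector -/
def sg (σ : V → Bool) : V → ℝ := fun i => bs (σ i)

lemma bs_sq (b : Bool) : bs b ^ 2 = 1 := by cases b <;> simp [bs]
lemma bs_mul_self (b : Bool) : bs b * bs b = 1 := by cases b <;> simp [bs]
lemma bs_ne (b : Bool) : bs b ≠ 0 := by cases b <;> simp [bs]
lemma bs_not (b : Bool) : bs (!b) = - bs b := by cases b <;> simp [bs]

lemma good_sign : Good (fun (_ : V) (b : Bool) => bs b) := by
  intro i
  refine ⟨?_, ?_, ?_, ?_⟩ <;> simp [Ex, bs] <;> norm_num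

lemma sg_eq_X (σ : V → Bool) : sg σ = X (fun (_ : V) (b : Bool) => bs b) σ := rfl

lemma sg2 (a : Finset V → ℝ) : Ex (fun σ : V → Bool => ev a (sg σ) ^ 2) = sq a := moment2 good_sign a
lemma sg4 {a : Finset V → ℝ} {J : Finset V} {d : ℕ} (h : Deg a J d) :
    Ex (fun σ : V → Bool => ev a (sg σ) ^ 4) ≤ 9 ^ d * sq a ^ 2 := moment4 good_sign h

lemma mon_mul_sg (I K : Finset V) (σ : V → Bool) : mon I (sg σ) * mon K (sg σ) = mon (symmDiff I K) (sg σ) := by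
  have h : ∀ I : Finset V, mon I (sg σ) = ∏ i, if i ∈ I then sg σ i else 1 := by
    intro I; unfold mon; rw [prod_ite_mem]; simp
  rw [h, h, h, ← prod_mul_distrib]
  apply prod_congr rfl; intro i _
  by_cases h1 : i ∈ I <;> by_cases h2 : i ∈ K <;> simp [h1, h2, mem_symmDiff, sg, bs_mul_self]

lemma ev_mul_exists {a b : Finset V → ℝ} {d e : ℕ} (ha : Deg a univ d) (hb : Deg b univ e) :
    ∃ c : Finset V → ℝ, Deg c univ (d + e) ∧ ∀ σ : V → Bool, ev c (sg σ) = ev a (sg σ) * ev b (sg σ) := by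
  refine ⟨fun M => ∑ I, ∑ K, if symmDiff I K = M then a I * b K else 0, ?_, ?_⟩
  · intro M hM
    obtain ⟨I, -, hI⟩ := exists_ne_zero_of_sum_ne_zero hM
    obtain ⟨K, -, hK⟩ := exists_ne_zero_of_sum_ne_zero hI
    by_cases h : symmDiff I K = M
    · rw [if_pos h] at hK
      have h1 := (ha I (left_ne_zero_of_mul hK)).2
      have h2 := (hb K (right_ne_zero_of_mul hK)).2
      refine ⟨subset_univ _, ?_⟩
      subst h
      have : symmDiff I K ⊆ I ∪ K := by
        intro x hx; rw [mem_symmDiff] at hx; rw [mem_union]; tauto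
      have := card_le_card this
      have := card_union_le I K
      omega
    · rw [if_neg h] at hK; exact absurd rfl hK
  · intro σ
    unfold ev
    rw [sum_mul_sum]
    simp only [sum_mul]
    rw [sum_comm]
    apply sum_congr rfl; intro I _
    rw [sum_comm]
    apply sum_congr rfl; intro K _
    simp only [ite_mul, zero_mul]
    rw [sum_ite_eq]
    simp only [mem_univ, if_true]
    rw [← mon_mul_sg]; ring

lemma high_moment (q : ℕ) : ∀ d : ℕ, ∃ C : ℝ, 0 < C ∧ ∀ (V : Type) [Fintype V] [DecidableEq V] (a : Finset V → ℝ),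
    Deg a univ d → Ex (fun σ : V → Bool => ev a (sg σ) ^ (2 ^ (q + 1))) ≤ C * sq a ^ (2 ^ q) := by
  induction q with
  | zero =>
    intro d
    refine ⟨1, one_pos, ?_⟩
    intro V _ _ a h
    have := sg2 a
    simp [this]
  | succ q ih =>
    intro d
    obtain ⟨C, hC, h⟩ := ih (d + d)
    refine ⟨C * (9 ^ d) ^ (2 ^ q), by positivity, ?_⟩
    intro V _ _ a ha
    obtain ⟨b, hb, hbe⟩ := ev_mul_exists ha ha
    have h1 := h V b hb
    have h2 : ∀ σ : V → Bool, ev b (sg σ) ^ (2 ^ (q + 1)) = ev a (sg σ) ^ (2 ^ (q + 1 + 1)) := by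
      intro σ; rw [hbe, ← pow_two, ← pow_mul]; congr 1; ring
    simp only [h2] at h1
    have h3 : sq b ≤ 9 ^ d * sq a ^ 2 := by
      rw [← sg2 b]
      refine le_trans (le_of_eq ?_) (sg4 ha)
      apply Ex_congr; intro σ; rw [hbe]; ring
    have h0 := sq_nonneg' b
    calc _ ≤ C * sq b ^ (2 ^ q) := h1
      _ ≤ C * (9 ^ d * sq a ^ 2) ^ (2 ^ q) := by gcongr
      _ = _ := by rw [mul_pow, ← pow_mul]; ring

lemma sg_piecewise (B : Finset V) (σ τ : V → Bool) : sg (B.piecewise σ τ) = B.piecewise (sg σ) (sg τ) := by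
  funext i; by_cases h : i ∈ B <;> simp [sg, h]

lemma sg_update (σ : V → Bool) (i : V) (b : Bool) : sg (Function.update σ i b) = Function.update (sg σ) i (bs b) :=
  X_update (fun (_ : V) (b : Bool) => bs b) σ i b

/-- second moment of a restriction -/
lemma sq_rest (a : Finset V → ℝ) (B : Finset V) (ρ : V → ℝ) :
    sq (rest a B ρ) = Ex (fun σ : V → Bool => ev a (B.piecewise (sg σ) ρ) ^ 2) := by
  rw [← sg2]; simp only [ev_rest]

lemma Ex_sq_rest (a : Finset V → ℝ) (B : Finset V) :
    Ex (fun ρ : V → Bool => sq (rest a B (sg ρ))) = sq a := by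
  simp only [sq_rest, ← sg_piecewise]
  rw [Ex_piecewise B (fun σ => ev a (sg σ) ^ 2), sg2]

lemma Ex_sq_rest_sq {a : Finset V → ℝ} {J : Finset V} {d : ℕ} (h : Deg a J d) (B : Finset V) :
    Ex (fun ρ : V → Bool => sq (rest a B (sg ρ)) ^ 2) ≤ 9 ^ d * sq a ^ 2 := by
  refine le_trans ?_ (sg4 h)
  rw [← Ex_piecewise B (fun σ => ev a (sg σ) ^ 4)]
  apply Ex_mono; intro ρ
  rw [sq_rest]
  refine (Ex_sq_le _).trans (le_of_eq ?_)
  apply Ex_congr; intro σ; rw [sg_piecewise, ← pow_mul]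

lemma sq_D_rest (a : Finset V → ℝ) {B : Finset V} {i : V} (hi : i ∈ B) (ρ : V → ℝ) :
    sq (D i (rest a B ρ)) = sq (rest (D i a) B ρ) := by
  rw [sq_rest, ← sg2]; simp only [ev_D_rest hi]

end signs
end EdgeStat

namespace EdgeStat
set_option linter.all false

section trig

/-- trigonometric polynomial of degree at most `d` -/
def TrigDeg (d : ℕ) (T : ℝ → ℝ) : Prop :=
  ∃ p : Polynomial ℂ, p.natDegree ≤ 2 * d ∧
    ∀ θ : ℝ, (T θ : ℂ) * Complex.exp (Complex.I * (θ : ℂ)) ^ d = p.eval (Complex.exp (Complex.I * (θ : ℂ)))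

lemma TrigDeg.const (c : ℝ) : TrigDeg 0 (fun _ => c) :=
  ⟨Polynomial.C (c : ℂ), by simp, by intro θ; simp⟩

lemma TrigDeg.mono {d e : ℕ} {T : ℝ → ℝ} (h : TrigDeg d T) (hde : d ≤ e) : TrigDeg e T := by
  obtain ⟨p, hp, h⟩ := h
  refine ⟨p * Polynomial.X ^ (e - d), ?_, ?_⟩
  · refine Polynomial.natDegree_mul_le.trans ?_
    rw [Polynomial.natDegree_X_pow]; omega
  · intro θ
    rw [Polynomial.eval_mul, ← h θ, Polynomial.eval_pow, Polynomial.eval_X, mul_assoc, ← pow_add]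
    congr 2; omega

lemma TrigDeg.add {d : ℕ} {T S : ℝ → ℝ} (h : TrigDeg d T) (h' : TrigDeg d S) :
    TrigDeg d (fun θ => T θ + S θ) := by
  obtain ⟨p, hp, h⟩ := h
  obtain ⟨q, hq, h'⟩ := h'
  refine ⟨p + q, (Polynomial.natDegree_add_le _ _).trans (max_le hp hq), ?_⟩
  intro θ
  rw [Polynomial.eval_add, ← h, ← h']; push_cast; ring

lemma TrigDeg.mul {d e : ℕ} {T S : ℝ → ℝ} (h : TrigDeg d T) (h' : TrigDeg e S) :
    TrigDeg (d + e) (fun θ => T θ * S θ) := by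
  obtain ⟨p, hp, h⟩ := h
  obtain ⟨q, hq, h'⟩ := h'
  refine ⟨p * q, Polynomial.natDegree_mul_le.trans (by omega), ?_⟩
  intro θ
  rw [Polynomial.eval_mul, ← h, ← h']; push_cast; ring

lemma TrigDeg.zero (d : ℕ) : TrigDeg d (fun _ => 0) := (TrigDeg.const 0).mono (Nat.zero_le _)

lemma TrigDeg.sum {ι : Type} (s : Finset ι) {d : ℕ} {T : ι → ℝ → ℝ} (h : ∀ i ∈ s, TrigDeg d (T i)) :
    TrigDeg d (fun θ => ∑ i ∈ s, T i θ) := by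
  induction s using Finset.induction_on with
  | empty => simpa using TrigDeg.zero d
  | insert i s hi ih =>
    simp only [sum_insert hi]
    exact (h i (mem_insert_self _ _)).add (ih fun j hj => h j (mem_insert_of_mem hj))

lemma TrigDeg.prod {ι : Type} (s : Finset ι) {T : ι → ℝ → ℝ} (h : ∀ i ∈ s, TrigDeg 1 (T i)) :
    TrigDeg s.card (fun θ => ∏ i ∈ s, T i θ) := by
  induction s using Finset.induction_on with
  | empty => simpa using TrigDeg.const 1
  | insert i s hi ih =>
    simp only [prod_insert hi, card_insert_of_notMem hi]
    rw [add_comm]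
    exact (h i (mem_insert_self _ _)).mul (ih fun j hj => h j (mem_insert_of_mem hj))

lemma TrigDeg.cossin (A B : ℝ) : TrigDeg 1 (fun θ => A * Real.cos θ + B * Real.sin θ) := by
  refine ⟨Polynomial.C (((A : ℂ) - Complex.I * B) / 2) * Polynomial.X ^ 2
    + Polynomial.C (((A : ℂ) + Complex.I * B) / 2), ?_, ?_⟩
  · refine (Polynomial.natDegree_add_le _ _).trans (max_le ?_ ?_)
    · exact (Polynomial.natDegree_C_mul_X_pow_le _ _)
    · simp
  · intro θ
    simp only [Polynomial.eval_add, Polynomial.eval_mul, Polynomial.eval_C, Polynomial.eval_pow, Polynomial.eval_X,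
      pow_one]
    push_cast
    rw [Complex.cos, Complex.sin, mul_comm Complex.I (θ : ℂ)]
    have h : Complex.exp (-(θ : ℂ) * Complex.I) = (Complex.exp ((θ : ℂ) * Complex.I))⁻¹ := by
      rw [← Complex.exp_neg]; congr 1; ring
    have h0 := Complex.exp_ne_zero ((θ : ℂ) * Complex.I)
    rw [h]; field_simp
    ring

/-- the squashing function -/
noncomputable def gsq (ε y : ℝ) : ℝ := ε ^ 2 * y ^ 2 / (1 + ε ^ 2 * y ^ 2)

lemma gsq_nonneg (ε y : ℝ) : 0 ≤ gsq ε y := by unfold gsq; positivity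
lemma gsq_le_one (ε y : ℝ) : gsq ε y ≤ 1 := by
  unfold gsq; rw [div_le_one (by positivity)]; linarith

lemma frac_mono {s t : ℝ} (hs : 0 ≤ s) (h : s ≤ t) : s / (1 + s) ≤ t / (1 + t) := by
  rw [div_le_div_iff₀ (by linarith) (by linarith)]; nlinarith

lemma gsq_mono {ε y y' : ℝ} (hy : 0 ≤ y) (h : y ≤ y') : gsq ε y ≤ gsq ε y' := by
  unfold gsq; apply frac_mono (by positivity); gcongr

lemma gsq_add (ε y y' : ℝ) : gsq ε (y + y') ≤ 2 * gsq ε y + 2 * gsq ε y' := by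
  unfold gsq
  have h : ε ^ 2 * (y + y') ^ 2 ≤ 2 * (ε ^ 2 * y ^ 2) + 2 * (ε ^ 2 * y' ^ 2) := by
    nlinarith [mul_nonneg (sq_nonneg ε) (sq_nonneg (y - y'))]
  refine (frac_mono (by positivity) h).trans ?_
  set s := ε ^ 2 * y ^ 2
  set t := ε ^ 2 * y' ^ 2
  have hs : 0 ≤ s := by positivity
  have ht : 0 ≤ t := by positivity
  rw [add_div]
  have h1 : 2 * s / (1 + (2 * s + 2 * t)) ≤ 2 * (s / (1 + s)) := by
    rw [mul_div_assoc]; gcongr; linarith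
  have h2 : 2 * t / (1 + (2 * s + 2 * t)) ≤ 2 * (t / (1 + t)) := by
    rw [mul_div_assoc]; gcongr; linarith
  linarith

lemma gsq_multiset (ε : ℝ) (s : Multiset ℂ) (f : ℂ → ℂ) :
    gsq ε ‖(s.map f).sum‖ ≤ 2 ^ s.card * (s.map (fun w => gsq ε ‖f w‖)).sum := by
  induction s using Multiset.induction_on with
  | empty => simp [gsq]
  | cons a s ih =>
    simp only [Multiset.map_cons, Multiset.sum_cons, Multiset.card_cons]
    have h1 : gsq ε ‖f a + (s.map f).sum‖ ≤ 2 * gsq ε ‖f a‖ + 2 * gsq ε ‖(s.map f).sum‖ :=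
      (gsq_mono (norm_nonneg _) (norm_add_le _ _)).trans (gsq_add _ _ _)
    have h2 : (1:ℝ) ≤ 2 ^ s.card := one_le_pow₀ (by norm_num)
    have := gsq_nonneg ε ‖f a‖
    rw [pow_succ]
    nlinarith

/-- kernel -/
noncomputable def ker (ε : ℝ) (z w : ℂ) : ℝ := ε ^ 2 / (‖z - w‖ ^ 2 + ε ^ 2)

lemma ker_nonneg (ε : ℝ) (z w : ℂ) : 0 ≤ ker ε z w := by unfold ker; positivity

lemma gsq_inv {ε : ℝ} (hε : 0 < ε) {z w : ℂ} (h : z ≠ w) : gsq ε ‖1 / (z - w)‖ = ker ε z w := by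
  unfold gsq ker
  have : 0 < ‖z - w‖ := norm_pos_iff.mpr (sub_ne_zero.mpr h)
  rw [norm_div, norm_one]
  field_simp

lemma ratio_le {d : ℕ} {T T' : ℝ → ℝ} (hT : ∀ θ, HasDerivAt T (T' θ) θ) {p : Polynomial ℂ}
    (hp : p.natDegree ≤ 2 * d)
    (h : ∀ θ : ℝ, (T θ : ℂ) * Complex.exp (Complex.I * (θ : ℂ)) ^ d = p.eval (Complex.exp (Complex.I * (θ : ℂ))))
    {ε : ℝ} (hε : 0 < ε) (θ : ℝ) :
    ε ^ 2 * T' θ ^ 2 / (T θ ^ 2 + ε ^ 2 * T' θ ^ 2) ≤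
      2 * (ε ^ 2 * d ^ 2) + 2 * 2 ^ (2 * d) * (p.roots.map (fun w => ker ε (Complex.exp (Complex.I * (θ : ℂ))) w)).sum := by
  set z := Complex.exp (Complex.I * (θ : ℂ)) with hz
  have hsum0 : 0 ≤ (p.roots.map (fun w => ker ε z w)).sum := by
    apply Multiset.sum_nonneg; intro x hx
    obtain ⟨w, -, rfl⟩ := Multiset.mem_map.mp hx
    exact ker_nonneg _ _ _
  have hz0 : z ≠ 0 := Complex.exp_ne_zero _
  have hz1 : ‖z‖ = 1 := by rw [hz, mul_comm]; exact Complex.norm_exp_ofReal_mul_I θ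
  -- derivative identity
  have hder : (T' θ : ℂ) * z ^ d + (T θ : ℂ) * (d * z ^ d * Complex.I) = p.derivative.eval z * (z * Complex.I) := by
    have e1 : HasDerivAt (fun θ : ℝ => Complex.exp (Complex.I * (θ : ℂ))) (z * Complex.I) θ := by
      have : HasDerivAt (fun θ : ℝ => Complex.I * (θ : ℂ)) (Complex.I * 1) θ :=
        (Complex.ofRealCLM.hasDerivAt (x := θ)).const_mul Complex.I
      simpa [hz] using this.cexp
    have e2 : HasDerivAt (fun θ : ℝ => (T θ : ℂ)) (T' θ : ℂ) θ := (hT θ).ofReal_comp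
    have e3 := e2.mul (e1.pow d)
    have e4 := (p.hasDerivAt z).comp θ e1
    have e5 : HasDerivAt (fun θ : ℝ => (T θ : ℂ) * Complex.exp (Complex.I * (θ : ℂ)) ^ d)
        (p.derivative.eval z * (z * Complex.I)) θ := by
      simp only [h]; exact e4
    have := e3.unique e5
    rw [← this]
    simp only [Pi.pow_apply, ← hz]
    rcases Nat.eq_zero_or_pos d with rfl | hd
    · simp
    · have : z ^ d = z ^ (d - 1) * z := by rw [← pow_succ]; congr 1; omega
      rw [this]; ring
  by_cases hT0 : T θ = 0
  · by_cases hT1 : T' θ = 0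
    · rw [hT1]; simp; positivity
    · -- p has the root z
      have hr : p.eval z = 0 := by rw [← h θ, hT0]; simp
      have hp0 : p ≠ 0 := by
        rintro rfl
        simp [hT0, hT1, hz0] at hder
      have hmem : z ∈ p.roots := (Polynomial.mem_roots hp0).mpr hr
      have h1 : ker ε z z ≤ (p.roots.map (fun w => ker ε z w)).sum := by
        apply Multiset.single_le_sum
        · intro x hx
          obtain ⟨w, -, rfl⟩ := Multiset.mem_map.mp hx
          exact ker_nonneg _ _ _
        · exact Multiset.mem_map_of_mem _ hmem
      have h2 : ker ε z z = 1 := by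
        unfold ker; simp; exact hε.ne'
      have h3 : ε ^ 2 * T' θ ^ 2 / (T θ ^ 2 + ε ^ 2 * T' θ ^ 2) ≤ 1 := by
        apply div_le_one_of_le₀ _ (by positivity)
        nlinarith [sq_nonneg (T θ)]
      have h4 : (1:ℝ) ≤ 2 ^ (2 * d) := one_le_pow₀ (by norm_num)
      have h5 : 0 ≤ ε ^ 2 * (d:ℝ) ^ 2 := by positivity
      nlinarith
  · have hpz : p.eval z ≠ 0 := by
      rw [← h θ]; exact mul_ne_zero (by exact_mod_cast hT0) (pow_ne_zero _ hz0)
    have hsp := (IsAlgClosed.splits p).eval_derivative_div_eval_of_ne_zero hpz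
    have hnT : ‖(T θ : ℂ)‖ = |T θ| := Complex.norm_real _
    have hTpos : 0 < |T θ| := abs_pos.mpr hT0
    have e1 : (T' θ : ℂ) / (T θ : ℂ) = (p.roots.map (fun w => 1 / (z - w))).sum * (z * Complex.I) - d * Complex.I := by
      rw [← hsp, ← h θ, ← hz]
      have hTc : (T θ : ℂ) ≠ 0 := by exact_mod_cast hT0
      have hzd : z ^ d ≠ 0 := pow_ne_zero _ hz0
      field_simp
      linear_combination hder
    have e2 : |T' θ / T θ| ≤ d + ‖(p.roots.map (fun w => 1 / (z - w))).sum‖ := by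
      have : |T' θ / T θ| = ‖(T' θ : ℂ) / (T θ : ℂ)‖ := by
        rw [← Complex.ofReal_div, Complex.norm_real]; rfl
      rw [this, e1]
      refine (norm_sub_le _ _).trans ?_
      rw [norm_mul, norm_mul, norm_mul, hz1, Complex.norm_I, Complex.norm_natCast]
      linarith
    have e3 : ε ^ 2 * T' θ ^ 2 / (T θ ^ 2 + ε ^ 2 * T' θ ^ 2) = gsq ε |T' θ / T θ| := by
      unfold gsq; rw [sq_abs]; field_simp
    rw [e3]
    refine (gsq_mono (abs_nonneg _) e2).trans ((gsq_add _ _ _).trans ?_)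
    have e4 := gsq_multiset ε p.roots (fun w => 1 / (z - w))
    have e5 : (p.roots.map (fun w => gsq ε ‖1 / (z - w)‖)) = p.roots.map (fun w => ker ε z w) := by
      apply Multiset.map_congr rfl
      intro w hw
      apply gsq_inv hε
      rintro rfl
      exact hpz (Polynomial.isRoot_of_mem_roots hw)
    rw [e5] at e4
    have e6 : (2:ℝ) ^ p.roots.card ≤ 2 ^ (2 * d) :=
      pow_le_pow_right₀ (by norm_num) ((Polynomial.card_roots' p).trans hp)
    have e7 : gsq ε d ≤ ε ^ 2 * (d:ℝ) ^ 2 := by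
      unfold gsq; apply div_le_self (by positivity); linarith [show 0 ≤ ε ^ 2 * (d:ℝ) ^ 2 by positivity]
    have e8 := mul_le_mul_of_nonneg_right e6 hsum0
    linarith

end trig

section grid
variable {N : ℕ} [NeZero N]

/-- angle of a residue -/
noncomputable def ang (t : ZMod N) : ℝ := 2 * Real.pi * (t.val / N)

lemma chi_eq (t : ZMod N) : ZMod.stdAddChar t = Complex.exp (Complex.I * (ang t : ℂ)) := by
  rw [ZMod.stdAddChar_apply, ZMod.toCircle_apply]
  congr 1; unfold ang; push_cast; ring

lemma chi_norm (t : ZMod N) : ‖ZMod.stdAddChar t‖ = 1 := by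
  rw [chi_eq, mul_comm]; exact Complex.norm_exp_ofReal_mul_I _

lemma chi_dist (t : ZMod N) : 4 * (t.valMinAbs.natAbs : ℝ) / N ≤ ‖ZMod.stdAddChar t - 1‖ := by
  have hN : (0:ℝ) < N := by exact_mod_cast Nat.pos_of_ne_zero (NeZero.ne N)
  have h1 : ZMod.stdAddChar t = Complex.exp (Complex.I * ((2 * Real.pi * (t.valMinAbs / N) : ℝ) : ℂ)) := by
    conv_lhs => rw [← ZMod.coe_valMinAbs t]
    rw [ZMod.stdAddChar_coe]; congr 1; push_cast; ring
  rw [h1, Complex.norm_exp_I_mul_ofReal_sub_one]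
  have h2 : (t.valMinAbs.natAbs : ℝ) = |(t.valMinAbs : ℝ)| := by
    rw [Nat.cast_natAbs, Int.cast_abs]
  have h3 : 2 * (t.valMinAbs.natAbs : ℝ) ≤ N := by
    have := ZMod.natAbs_valMinAbs_le t
    have : 2 * t.valMinAbs.natAbs ≤ N := by omega
    exact_mod_cast this
  rw [norm_mul, Real.norm_eq_abs, Real.norm_eq_abs]
  set v := (t.valMinAbs : ℝ)
  rw [h2] at h3 ⊢
  have hx : 2 * Real.pi * (v / N) / 2 = Real.pi * (v / N) := by ring
  rw [hx]
  have hpi := Real.pi_pos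
  have h4 : |Real.pi * (v / N)| = Real.pi * (|v| / N) := by
    rw [abs_mul, abs_div, abs_of_pos hpi, abs_of_pos hN]
  have h5 : |v| / N ≤ 1 / 2 := by rw [div_le_iff₀ hN]; linarith
  rw [Real.abs_sin_eq_sin_abs_of_abs_le_pi (by rw [h4]; nlinarith), h4]
  have := Real.mul_le_sin (x := Real.pi * (|v| / N)) (by positivity) (by nlinarith)
  have e : 2 / Real.pi * (Real.pi * (|v| / N)) = 2 * (|v| / N) := by field_simp
  rw [e] at this
  simp only [abs_two]
  calc 4 * |v| / N = 2 * (2 * (|v| / N)) := by ring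
    _ ≤ _ := by linarith

lemma range_sum {L : ℝ} (hL : 1 ≤ L) (n : ℕ) :
    ∑ t ∈ range n, L ^ 2 / ((t:ℝ) ^ 2 + L ^ 2) ≤ 4 * L := by
  have key : ∀ n : ℕ, ∑ t ∈ range (n + 1), L ^ 2 / ((t:ℝ) ^ 2 + L ^ 2) ≤ 1 + 2 * L - 2 * L ^ 2 / (L + n) := by
    intro n
    induction n with
    | zero =>
      have h0 : L ≠ 0 := by linarith
      have e1 : L ^ 2 / (((0:ℕ):ℝ) ^ 2 + L ^ 2) = 1 := by
        simp [h0]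
      have e2 : 2 * L ^ 2 / (L + ((0:ℕ):ℝ)) = 2 * L := by
        simp; field_simp
      rw [zero_add, sum_range_one, e1, e2]; linarith
    | succ n ih =>
      rw [sum_range_succ]
      have hn : (0:ℝ) ≤ n := by positivity
      have e : L ^ 2 / (((n+1:ℕ):ℝ) ^ 2 + L ^ 2) ≤ 2 * L ^ 2 / (L + n) - 2 * L ^ 2 / (L + (n+1:ℕ)) := by
        push_cast
        rw [div_sub_div _ _ (by linarith) (by linarith), div_le_div_iff₀ (by positivity) (by positivity)]
        have : 2 * L ^ 2 * (L + (n + 1)) - (L + n) * (2 * L ^ 2) = 2 * L ^ 2 := by ring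
        rw [this]
        have h2 : (L + n) * (L + (n + 1)) ≤ 2 * ((n + 1) ^ 2 + L ^ 2) := by nlinarith [sq_nonneg (L - n - 1)]
        nlinarith [sq_nonneg L]
      linarith
  cases n with
  | zero => simp; linarith
  | succ n =>
    refine (key n).trans ?_
    have : 0 ≤ 2 * L ^ 2 / (L + n) := by positivity
    linarith

lemma zmod_sum (F : ℕ → ℝ) : ∑ x : ZMod N, F x.val = ∑ t ∈ range N, F t := by
  obtain ⟨n, rfl⟩ : ∃ n, N = n + 1 := ⟨N - 1, by have := NeZero.ne N; omega⟩
  exact Fin.sum_univ_eq_sum_range F (n + 1)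

lemma grid_kernel {ε : ℝ} (hε : 0 < ε) (hεN : 1 ≤ ε * N) (w : ℂ) :
    ∑ t : ZMod N, ker ε (ZMod.stdAddChar t) w ≤ 32 * (ε * N) := by
  have hN : (0:ℝ) < N := by exact_mod_cast Nat.pos_of_ne_zero (NeZero.ne N)
  set L := ε * N with hL
  obtain ⟨t0, -, ht0⟩ := exists_min_image (univ : Finset (ZMod N)) (fun t => ‖ZMod.stdAddChar t - w‖) ⟨0, mem_univ _⟩
  let F : ℕ → ℝ := fun e => L ^ 2 / ((e:ℝ) ^ 2 + L ^ 2)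
  have hF : ∀ e, 0 ≤ F e := fun e => by simp only [F]; positivity
  have h1 : ∀ t : ZMod N, ker ε (ZMod.stdAddChar t) w ≤ 4 * F ((t - t0).valMinAbs.natAbs) := by
    intro t
    have a1 : ‖ZMod.stdAddChar (t - t0) - 1‖ ≤ 2 * ‖ZMod.stdAddChar t - w‖ := by
      have : ‖ZMod.stdAddChar (t - t0) - 1‖ = ‖ZMod.stdAddChar t - ZMod.stdAddChar t0‖ := by
        have : ZMod.stdAddChar t = ZMod.stdAddChar (t - t0) * ZMod.stdAddChar t0 := by
          rw [← AddChar.map_add_eq_mul]; simp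
        rw [this, ← sub_one_mul, norm_mul, chi_norm, mul_one]
      rw [this]
      have a2 := norm_sub_le (ZMod.stdAddChar t - w) (ZMod.stdAddChar t0 - w)
      rw [sub_sub_sub_cancel_right] at a2
      have := ht0 t (mem_univ _)
      linarith
    have a2 := (chi_dist (t - t0)).trans a1
    set e := ((t - t0).valMinAbs.natAbs : ℝ) with he
    set δ := ‖ZMod.stdAddChar t - w‖
    have e0 : 0 ≤ e := by positivity
    have a3 : e ≤ N * δ := by
      rw [div_le_iff₀ hN] at a2; nlinarith [norm_nonneg (ZMod.stdAddChar t - w)]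
    have : F ((t - t0).valMinAbs.natAbs) = L ^ 2 / (e ^ 2 + L ^ 2) := rfl
    rw [this]
    unfold ker
    have a4 : ε ^ 2 / (δ ^ 2 + ε ^ 2) = L ^ 2 / ((N * δ) ^ 2 + L ^ 2) := by
      rw [hL]; field_simp
    rw [a4]
    calc _ ≤ L ^ 2 / (e ^ 2 + L ^ 2) := by gcongr
      _ ≤ _ := by linarith [show 0 ≤ L ^ 2 / (e ^ 2 + L ^ 2) by positivity]
  have h2 : ∀ x : ZMod N, F (x.valMinAbs.natAbs) ≤ F x.val + F (-x).val := by
    intro x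
    rw [ZMod.valMinAbs_natAbs_eq_min]
    by_cases hx : x = 0
    · subst hx; simp; exact hF 0
    · rw [ZMod.neg_val, if_neg hx]
      rcases min_choice x.val (N - x.val) with h | h <;> rw [h]
      · linarith [hF (N - x.val)]
      · linarith [hF x.val]
  calc _ ≤ ∑ t : ZMod N, 4 * F ((t - t0).valMinAbs.natAbs) := sum_le_sum fun t _ => h1 t
    _ = 4 * ∑ t : ZMod N, F (t.valMinAbs.natAbs) := by
        rw [← mul_sum]; congr 1
        exact (Equiv.subRight t0).sum_comp (fun t => F (t.valMinAbs.natAbs))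
    _ ≤ 4 * ∑ x : ZMod N, (F x.val + F (-x).val) := by gcongr with x; exact h2 x
    _ = 4 * (2 * ∑ t ∈ range N, F t) := by
        have := Equiv.sum_comp (Equiv.neg (ZMod N)) (fun x : ZMod N => F x.val)
        simp only [Equiv.neg_apply] at this
        rw [sum_add_distrib, this, zmod_sum]; ring
    _ ≤ 4 * (2 * (4 * L)) := by gcongr; exact range_sum hεN N
    _ = _ := by ring

lemma trig_main (d : ℕ) {T T' : ℝ → ℝ} (hT : ∀ θ, HasDerivAt T (T' θ) θ) (h : TrigDeg d T)
    {ε : ℝ} (hε : 0 < ε) (hε1 : ε ≤ 1) (hεN : 1 ≤ ε * N) :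
    Ex (fun t : ZMod N => ε ^ 2 * T' (ang t) ^ 2 / (T (ang t) ^ 2 + ε ^ 2 * T' (ang t) ^ 2)) ≤
      (2 * d ^ 2 + 2 * 2 ^ (2 * d) * (2 * d * 32)) * ε := by
  obtain ⟨p, hp, h⟩ := h
  have hN : (0:ℝ) < N := by exact_mod_cast Nat.pos_of_ne_zero (NeZero.ne N)
  unfold Ex
  rw [ZMod.card, div_le_iff₀ hN]
  have h1 := fun t : ZMod N => ratio_le hT hp h hε (ang t)
  simp only [← chi_eq] at h1
  have h2 : ∑ t : ZMod N, (p.roots.map (fun w => ker ε (ZMod.stdAddChar t) w)).sum ≤ (2 * d) * (32 * (ε * N)) := by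
    have : ∀ s : Multiset ℂ, ∑ t : ZMod N, (s.map (fun w => ker ε (ZMod.stdAddChar t) w)).sum ≤ s.card * (32 * (ε * N)) := by
      intro s
      induction s using Multiset.induction_on with
      | empty => simp
      | cons a s ih =>
        simp only [Multiset.map_cons, Multiset.sum_cons, Multiset.card_cons, sum_add_distrib]
        have := grid_kernel hε hεN a
        push_cast; linarith
    refine (this p.roots).trans ?_
    gcongr
    have := (Polynomial.card_roots' p).trans hp
    exact_mod_cast this
  calc _ ≤ ∑ t : ZMod N, (2 * (ε ^ 2 * d ^ 2) + 2 * 2 ^ (2 * d) * (p.roots.map (fun w => ker ε (ZMod.stdAddChar t) w)).sum) :=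
        sum_le_sum fun t _ => h1 t
    _ = N * (2 * (ε ^ 2 * d ^ 2)) + 2 * 2 ^ (2 * d) * ∑ t : ZMod N, (p.roots.map (fun w => ker ε (ZMod.stdAddChar t) w)).sum := by
        rw [sum_add_distrib, mul_sum]; simp [ZMod.card]
    _ ≤ N * (2 * (ε * d ^ 2)) + 2 * 2 ^ (2 * d) * ((2 * d) * (32 * (ε * N))) := by
        gcongr; nlinarith
    _ = _ := by ring

end grid
end EdgeStat

namespace EdgeStat
set_option linter.all false

section linear
variable {W : Type} [Fintype W] [DecidableEq W]

/-- coefficients of a linear form -/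
noncomputable def linc (r : W → ℝ) : Finset W → ℝ := fun K => ∑ j, if K = {j} then r j else 0

lemma ev_linc (r : W → ℝ) (x : W → ℝ) : ev (linc r) x = ∑ j, r j * x j := by
  unfold ev linc
  simp only [sum_mul]
  rw [sum_comm]
  apply sum_congr rfl; intro j _
  simp only [ite_mul, zero_mul]
  rw [sum_ite_eq']
  simp [mon]

lemma deg_linc (r : W → ℝ) : Deg (linc r) univ 1 := by
  intro K hK
  obtain ⟨j, -, hj⟩ := exists_ne_zero_of_sum_ne_zero hK
  by_cases h : K = {j}
  · subst h; simp
  · rw [if_neg h] at hj; exact absurd rfl hj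

lemma sq_linc (r : W → ℝ) : sq (linc r) = ∑ j, r j ^ 2 := by
  unfold sq
  have h : ∀ K, (linc r K) ^ 2 = ∑ j, if K = {j} then r j ^ 2 else 0 := by
    intro K
    unfold linc
    by_cases hK : ∃ i, K = {i}
    · obtain ⟨i, rfl⟩ := hK
      simp only [singleton_inj]
      simp
    · push Not at hK
      simp [hK]
  simp only [h]
  rw [sum_comm]
  apply sum_congr rfl; intro j _
  rw [sum_ite_eq']; simp

lemma lin2 (r : W → ℝ) : Ex (fun c : W → Bool => (∑ j, r j * bs (c j)) ^ 2) = ∑ j, r j ^ 2 := by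
  have := sg2 (linc r)
  simp only [ev_linc, sq_linc] at this
  exact this

lemma lin4 (r : W → ℝ) : Ex (fun c : W → Bool => (∑ j, r j * bs (c j)) ^ 4) ≤ 9 * (∑ j, r j ^ 2) ^ 2 := by
  have := sg4 (deg_linc r)
  simp only [ev_linc, sq_linc, pow_one] at this
  exact this

lemma lin_vec {ι : Type} (s : Finset ι) (r : ι → W → ℝ) :
    Ex (fun c : W → Bool => (∑ k ∈ s, (∑ j, r k j * bs (c j)) ^ 2) ^ 2) ≤ 9 * (∑ k ∈ s, ∑ j, r k j ^ 2) ^ 2 := by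
  have := moment_vec (good_sign (V := W)) s (fun _ => 1) (fun _ _ => zero_le_one) (fun k => linc (r k))
    (fun k _ => deg_linc (r k))
  simp only [← sg_eq_X, ev_linc, sq_linc, pow_one, one_mul] at this
  exact this
end linear

section bilinear
variable {W W' : Type} [Fintype W] [DecidableEq W] [Fintype W'] [DecidableEq W']

lemma bil_aux {U s u : ℝ} (hU : 0 ≤ U) (hs : 0 ≤ s) (hu : 0 ≤ u) (h : u ≤ 2 * s) :
    1 / 2 * u * (U + s) ≤ s * (U + u) := by
  nlinarith [mul_nonneg hU (sub_nonneg.2 h), mul_nonneg hs hu]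

set_option maxHeartbeats 800000 in
/-- the key lower bound from Paley and Zygmund and convexity -/
lemma bil_lower (r : W → W' → ℝ) (Y : W → ℝ) {ε U' : ℝ} (hε : 0 < ε) (hU' : 0 ≤ U')
    (hU : U' ≤ ∑ I, ∑ j, r I j ^ 2) :
    (1 / 324) ^ 2 * (1 / 2) * (ε ^ 2 * U' / ((∑ I, Y I ^ 2) + ε ^ 2 * U')) ≤
    Ex (fun w : W → Bool => Ex (fun c : W' → Bool =>
      ε ^ 2 * (∑ I, bs (w I) * ∑ j, bs (c j) * r I j) ^ 2 /
        ((∑ I, bs (w I) * Y I) ^ 2 + ε ^ 2 * (∑ I, bs (w I) * ∑ j, bs (c j) * r I j) ^ 2))) := by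
  set G := ∑ I, ∑ j, r I j ^ 2 with hG
  set U := ∑ I, Y I ^ 2 with hUdef
  have hU0 : 0 ≤ U := sum_nonneg fun _ _ => sq_nonneg _
  have hG0 : 0 ≤ G := sum_nonneg fun _ _ => sum_nonneg fun _ _ => sq_nonneg _
  rw [← Ex_prod (fun wc : (W → Bool) × (W' → Bool) => ε ^ 2 * (∑ I, bs (wc.1 I) * ∑ j, bs (wc.2 j) * r I j) ^ 2 /
        ((∑ I, bs (wc.1 I) * Y I) ^ 2 + ε ^ 2 * (∑ I, bs (wc.1 I) * ∑ j, bs (wc.2 j) * r I j) ^ 2))]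
  set F : (W → Bool) × (W' → Bool) → ℝ := fun wc => (∑ I, bs (wc.1 I) * ∑ j, bs (wc.2 j) * r I j) ^ 2 with hF
  set R : (W → Bool) × (W' → Bool) → ℝ := fun wc => (∑ I, bs (wc.1 I) * Y I) ^ 2 with hR
  have hF0 : ∀ wc, 0 ≤ F wc := fun _ => sq_nonneg _
  have hR0 : ∀ wc, 0 ≤ R wc := fun _ => sq_nonneg _
  have hFe : ∀ (w : W → Bool) (c : W' → Bool), (∑ I, bs (w I) * ∑ j, bs (c j) * r I j) =
      ∑ j, (∑ I, r I j * bs (w I)) * bs (c j) := by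
    intro w c
    simp only [mul_sum, sum_mul]
    rw [sum_comm]
    apply sum_congr rfl; intro j _; apply sum_congr rfl; intro I _; ring
  have hEF : Ex F = G := by
    rw [Ex_prod]
    simp only [hF, hFe, lin2]
    rw [Ex_sum]
    simp only [lin2]
    rw [hG, sum_comm]
  have hEF2 : Ex (fun wc => F wc ^ 2) ≤ 81 * (Ex F) ^ 2 := by
    rw [hEF, Ex_prod]
    have : ∀ w : W → Bool, Ex (fun c : W' → Bool => F (w, c) ^ 2) ≤ 9 * (∑ j, (∑ I, r I j * bs (w I)) ^ 2) ^ 2 := by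
      intro w
      simp only [hF, hFe, ← pow_mul]
      exact lin4 _
    refine (Ex_mono this).trans ?_
    rw [Ex_mul_left]
    have := lin_vec univ (fun j I => r I j)
    rw [hG, sum_comm]
    linarith
  have hER : Ex R = U := by
    rw [Ex_prod]
    simp only [hR, Ex_const]
    rw [hUdef, ← lin2]
    apply Ex_congr; intro w; congr 1; apply sum_congr rfl; intro I _; ring
  by_cases hG1 : G = 0
  · have : U' = 0 := le_antisymm (hG1 ▸ hU) hU'
    rw [this]; simp
    exact Ex_nonneg fun wc => by positivity
  have hGpos : 0 < G := lt_of_le_of_ne hG0 (Ne.symm hG1)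
  have hp := pz hF0 (by norm_num : (0:ℝ) < 81) hEF2 (by rw [hEF]; exact hGpos)
  rw [hEF] at hp
  set p := Ex (fun wc => ind (G / 2 ≤ F wc)) with hpdef
  have hppos : 0 < p := lt_of_lt_of_le (by norm_num) hp
  set s := ε ^ 2 * G / 2 with hs
  have hspos : 0 < s := by positivity
  set A := U / p + s with hA
  have hApos : 0 < A := by positivity
  have hpt : ∀ wc, ind (G / 2 ≤ F wc) * (2 * s / A) - s / A ^ 2 * (R wc + s * ind (G / 2 ≤ F wc)) ≤
      ε ^ 2 * F wc / (R wc + ε ^ 2 * F wc) := by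
    intro wc
    by_cases h : G / 2 ≤ F wc
    · rw [ind_true h]
      have h1 : s / (R wc + s) ≤ ε ^ 2 * F wc / (R wc + ε ^ 2 * F wc) := by
        have h2 : s ≤ ε ^ 2 * F wc := by rw [hs]; nlinarith [sq_nonneg ε]
        have := hR0 wc
        rw [div_le_div_iff₀ (by linarith) (by linarith)]
        have h3 := mul_nonneg this (sub_nonneg.2 h2)
        linarith [h3, mul_comm s (R wc), mul_comm s (ε ^ 2 * F wc), mul_add s (R wc) (ε ^ 2 * F wc), mul_add (ε ^ 2 * F wc) (R wc) s, mul_sub (R wc) (ε ^ 2 * F wc) s, mul_comm (R wc) (ε ^ 2 * F wc)]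
      refine le_trans ?_ h1
      have hX : 0 < R wc + s := by linarith [hR0 wc]
      rw [le_div_iff₀ hX]
      have e : (1 * (2 * s / A) - s / A ^ 2 * (R wc + s * 1)) * (R wc + s)
        = s - s * ((R wc + s) / A - 1) ^ 2 := by field_simp; ring
      rw [e]; nlinarith [mul_nonneg hspos.le (sq_nonneg ((R wc + s) / A - 1))]
    · rw [ind_false h]
      have h1 : 0 ≤ ε ^ 2 * F wc / (R wc + ε ^ 2 * F wc) := by
        have := hR0 wc; have := hF0 wc; positivity
      have h2 : 0 ≤ s / A ^ 2 * R wc := by have := hR0 wc; positivity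
      linarith
  have hE := Ex_mono hpt
  rw [Ex_sub, Ex_mul_right, Ex_mul_left, Ex_add, Ex_mul_left, ← hpdef, hER] at hE
  refine le_trans ?_ hE
  have e1 : U + s * p = p * A := by rw [hA]; field_simp
  rw [e1]
  have e2 : p * (2 * s / A) - s / A ^ 2 * (p * A) = p * s / A := by field_simp; ring
  rw [e2]
  have hp1 : p ≤ 1 := Ex_le_const fun wc => ind_le_one _
  have e3 : p ^ 2 * (s / (U + s)) ≤ p * s / A := by
    have : p * A ≤ U + s := by rw [← e1]; nlinarith
    calc p ^ 2 * (s / (U + s)) ≤ p ^ 2 * (s / (p * A)) := by gcongr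
      _ = p * s / A := by field_simp
  refine le_trans ?_ e3
  have e4 : (1 / 324 : ℝ) ≤ p := by norm_num at hp; linarith
  have e5 : 1 / 2 * (ε ^ 2 * U' / (U + ε ^ 2 * U')) ≤ s / (U + s) := by
    rcases hU'.eq_or_lt with h0 | h0
    · rw [← h0]; simp; positivity
    rw [← mul_div_assoc, div_le_div_iff₀ (by positivity) (by positivity)]
    have h5 : ε ^ 2 * U' ≤ 2 * s := by rw [hs]; nlinarith [sq_nonneg ε]
    have h6 : 0 < ε ^ 2 * U' := by positivity
    exact bil_aux hU0 hspos.le h6.le h5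
  rw [mul_assoc]
  gcongr
end bilinear

section arc
variable {N : ℕ} [NeZero N]

/-- arc coordinate -/
noncomputable def ax (o : ZMod N) : ℝ := √2 * Real.cos (ang o)
/-- conjugate arc coordinate -/
noncomputable def ay (o : ZMod N) : ℝ := √2 * Real.sin (ang o)

lemma cos_ang (o : ZMod N) : Real.cos (ang o) = (ZMod.stdAddChar o).re := by
  rw [chi_eq, mul_comm, Complex.exp_ofReal_mul_I_re]
lemma sin_ang (o : ZMod N) : Real.sin (ang o) = (ZMod.stdAddChar o).im := by
  rw [chi_eq, mul_comm, Complex.exp_ofReal_mul_I_im]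

lemma ax_add (o t : ZMod N) : ax (o + t) = ax o * Real.cos (ang t) - ay o * Real.sin (ang t) := by
  unfold ax ay
  simp only [cos_ang, sin_ang, AddChar.map_add_eq_mul, Complex.mul_re]; ring
lemma ay_add (o t : ZMod N) : ay (o + t) = ay o * Real.cos (ang t) + ax o * Real.sin (ang t) := by
  unfold ax ay
  simp only [cos_ang, sin_ang, AddChar.map_add_eq_mul, Complex.mul_im]; ring
lemma chi_neg (t : ZMod N) : ZMod.stdAddChar (-t) = (starRingEnd ℂ) (ZMod.stdAddChar t) := by
  rw [AddChar.map_neg_eq_inv, Complex.inv_def, Complex.normSq_eq_norm_sq, chi_norm]; simp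
lemma cos_ang_neg (t : ZMod N) : Real.cos (ang (-t)) = Real.cos (ang t) := by
  rw [cos_ang, cos_ang, chi_neg, Complex.conj_re]
lemma sin_ang_neg (t : ZMod N) : Real.sin (ang (-t)) = - Real.sin (ang t) := by
  rw [sin_ang, sin_ang, chi_neg, Complex.conj_im]

lemma ax_ay (o : ZMod N) : ay o ^ 2 = 2 - ax o ^ 2 := by
  unfold ax ay
  rw [mul_pow, mul_pow, Real.sq_sqrt (by norm_num)]
  have := Real.sin_sq_add_cos_sq (ang o); linarith

lemma good_arc {V : Type} {N' : ℕ} (hN : N = 4 * N') : Good (fun (_ : V) (o : ZMod N) => ax o) := by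
  have hN0 : (N' : ℂ) ≠ 0 := by
    have := NeZero.ne N
    intro h; have : N' = 0 := by exact_mod_cast h
    omega
  have hI : ZMod.stdAddChar ((N' : ℤ) : ZMod N) = Complex.I := by
    rw [ZMod.stdAddChar_coe]
    have : 2 * (Real.pi : ℂ) * Complex.I * ((N' : ℤ) : ℂ) / (N : ℂ) = (Real.pi / 2 : ℂ) * Complex.I := by
      rw [hN]; push_cast; field_simp; ring
    rw [this, Complex.exp_pi_div_two_mul_I]
  set s : ZMod N := ((N' : ℤ) : ZMod N)
  have hc : Real.cos (ang s) = 0 := by rw [cos_ang, hI, Complex.I_re]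
  have hs : Real.sin (ang s) = 1 := by rw [sin_ang, hI, Complex.I_im]
  have h1 : ∀ o : ZMod N, ax (o + s) = - ay o := by intro o; rw [ax_add, hc, hs]; ring
  have h1' : ∀ o : ZMod N, ay (o + s) = ax o := by intro o; rw [ay_add, hc, hs]; ring
  have h2 : ∀ o : ZMod N, ax (o + s + s) = - ax o := by intro o; rw [h1, h1']
  intro i
  have sh : ∀ f : ZMod N → ℝ, Ex (fun o => f (o + s + s)) = Ex f := by
    intro f
    have e1 := Ex_equiv (Equiv.addRight s) (fun o => f (o + s))
    have e2 := Ex_equiv (Equiv.addRight s) f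
    exact e1.trans e2
  have sh1 : ∀ f : ZMod N → ℝ, Ex (fun o => f (o + s)) = Ex f := by
    intro f; exact Ex_equiv (Equiv.addRight s) f
  refine ⟨?_, ?_, ?_, ?_⟩
  · have := sh ax
    simp only [h2, Ex_neg] at this
    show Ex (fun o : ZMod N => ax o) = 0
    have e : Ex (fun o : ZMod N => ax o) = Ex ax := rfl
    rw [e] at this ⊢; linarith
  · have := sh1 (fun o => ax o ^ 2)
    simp only [h1, neg_sq, ax_ay, Ex_sub, Ex_const] at this
    show Ex (fun o : ZMod N => ax o ^ 2) = 1
    linarith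
  · have := sh (fun o => ax o ^ 3)
    simp only [h2] at this
    have e : ∀ o : ZMod N, (- ax o) ^ 3 = - (ax o ^ 3) := by intro o; ring
    simp only [e, Ex_neg] at this
    show Ex (fun o : ZMod N => ax o ^ 3) = 0
    linarith
  · apply Ex_le_const; intro o
    show ax o ^ 4 ≤ 9
    have h3 : 0 ≤ ay o ^ 2 := sq_nonneg _
    rw [ax_ay] at h3
    nlinarith [sq_nonneg (ax o)]
end arc

section path
variable {V : Type} [Fintype V] [DecidableEq V]

lemma ev_D_sum (j : V) (b : Finset V → ℝ) (x : V → ℝ) :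
    ev (D j b) x = ∑ K, if j ∈ K then b K * mon (K.erase j) x else 0 := by
  rw [sum_split j]; unfold ev
  apply sum_congr rfl; intro K _
  by_cases h : j ∈ K <;> simp [D, h]

lemma hasDerivAt_mon (K : Finset V) {x x' : V → ℝ → ℝ} {θ : ℝ} (h : ∀ i, HasDerivAt (x i) (x' i θ) θ) :
    HasDerivAt (fun θ => mon K (fun i => x i θ)) (∑ j ∈ K, mon (K.erase j) (fun i => x i θ) * x' j θ) θ := by
  unfold mon
  have := HasDerivAt.fun_finsetProd (u := K) (f := x) (f' := fun i => x' i θ) (x := θ) (fun i _ => h i)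
  simpa [smul_eq_mul] using this

lemma hasDerivAt_ev (b : Finset V → ℝ) {x x' : V → ℝ → ℝ} {θ : ℝ} (h : ∀ i, HasDerivAt (x i) (x' i θ) θ) :
    HasDerivAt (fun θ => ev b (fun i => x i θ)) (∑ j, ev (D j b) (fun i => x i θ) * x' j θ) θ := by
  unfold ev
  have h1 : HasDerivAt (fun θ => ∑ K, b K * mon K (fun i => x i θ))
      (∑ K, b K * ∑ j ∈ K, mon (K.erase j) (fun i => x i θ) * x' j θ) θ :=
    HasDerivAt.fun_sum fun K _ => (hasDerivAt_mon K h).const_mul _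
  convert h1 using 1
  have := fun j => ev_D_sum j b (fun i => x i θ)
  unfold ev at this
  simp only [this, sum_mul]
  rw [sum_comm]
  apply sum_congr rfl; intro K _
  rw [mul_sum, ← sum_filter_add_sum_filter_not univ (fun j => j ∈ K)]
  have e : univ.filter (fun j => j ∈ K) = K := by ext; simp
  rw [e]
  rw [sum_eq_zero (s := univ.filter (fun j => j ∉ K))]
  · rw [add_zero]; apply sum_congr rfl; intro j hj; simp [hj]; ring
  · intro j hj; simp at hj; simp [hj]

/-- the tensor of level `l` -/
noncomputable def Yl (a : Finset V → ℝ) (l : ℕ) (x y : V → ℝ) (I : Finset V) : ℝ :=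
  if I.card = l then mon I y * ev (der I a) x else 0
/-- its derivative along rotation of coordinate `j` -/
noncomputable def rl (a : Finset V → ℝ) (l : ℕ) (x y : V → ℝ) (I : Finset V) (j : V) : ℝ :=
  if I.card = l then (if j ∈ I then mon (I.erase j) y * x j * ev (der I a) x
    else - (mon (insert j I) y * ev (der (insert j I) a) x)) else 0

lemma hasDerivAt_Yl (a : Finset V → ℝ) (l : ℕ) (c : V → Bool) (x y : V → ℝ → ℝ) (θ : ℝ)
    (hx : ∀ i, HasDerivAt (x i) (- bs (c i) * y i θ) θ) (hy : ∀ i, HasDerivAt (y i) (bs (c i) * x i θ) θ)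
    (I : Finset V) :
    HasDerivAt (fun θ => Yl a l (fun i => x i θ) (fun i => y i θ) I)
      (∑ j, bs (c j) * rl a l (fun i => x i θ) (fun i => y i θ) I j) θ := by
  unfold Yl rl
  by_cases hI : I.card = l
  · simp only [hI, if_true]
    have h1 := (hasDerivAt_mon (x := y) (x' := fun i θ => bs (c i) * x i θ) I hy).fun_mul
      (hasDerivAt_ev (x := x) (x' := fun i θ => - bs (c i) * y i θ) (der I a) hx)
    refine h1.congr_deriv (Eq.symm ?_)
    rw [sum_mul, mul_sum]
    rw [← sum_filter_add_sum_filter_not univ (fun j => j ∈ I),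
      ← sum_filter_add_sum_filter_not univ (fun j => j ∈ I) (fun i => mon I (fun i => y i θ) * _)]
    have e : univ.filter (fun j => j ∈ I) = I := by ext; simp
    rw [e]
    have e2 : ∑ j ∈ I, mon I (fun i => y i θ) * (ev (D j (der I a)) (fun i => x i θ) * (-bs (c j) * y j θ)) = 0 := by
      apply sum_eq_zero; intro j hj; rw [D_der_mem hj, ev_zero]; ring
    rw [e2, zero_add]
    congr 1
    · apply sum_congr rfl; intro j hj; simp only [hj, if_true]; ring
    · apply sum_congr rfl; intro j hj
      have hj : j ∉ I := by simpa using hj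
      simp only [hj, if_false]
      rw [D_der hj]
      have : mon (insert j I) (fun i => y i θ) = y j θ * mon I (fun i => y i θ) := by
        unfold mon; rw [prod_insert hj]
      rw [this]; ring
  · simp only [hI, if_false]
    simpa using hasDerivAt_const θ (0:ℝ)

lemma trigDeg_ev {b : Finset V → ℝ} {J : Finset V} {d : ℕ} (h : Deg b J d) {x : V → ℝ → ℝ}
    (hx : ∀ i, TrigDeg 1 (x i)) : TrigDeg d (fun θ => ev b (fun i => x i θ)) := by
  unfold ev
  apply TrigDeg.sum; intro K _
  by_cases h0 : b K = 0
  · simp only [h0, zero_mul]; exact TrigDeg.zero d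
  · have := (TrigDeg.const (b K)).mul (TrigDeg.prod K (fun i _ => hx i))
    rw [zero_add] at this
    exact this.mono (h K h0).2

lemma trigDeg_Yl {a : Finset V → ℝ} {J : Finset V} {d : ℕ} (h : Deg a J d) (l : ℕ) {x y : V → ℝ → ℝ}
    (hx : ∀ i, TrigDeg 1 (x i)) (hy : ∀ i, TrigDeg 1 (y i)) (I : Finset V) :
    TrigDeg (l + d) (fun θ => Yl a l (fun i => x i θ) (fun i => y i θ) I) := by
  unfold Yl
  by_cases hI : I.card = l
  · simp only [hI, if_true]
    have h1 := TrigDeg.prod I (fun i _ => hy i)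
    rw [hI] at h1
    exact h1.mul (trigDeg_ev ((h.der I).mono (subset_refl _) (Nat.sub_le _ _)) hx)
  · simp only [hI, if_false]; exact TrigDeg.zero _

/-- `U_l` -/
noncomputable def Ul (a : Finset V → ℝ) (l : ℕ) (x : V → ℝ) : ℝ :=
  ∑ I, if I.card = l then (∏ i ∈ I, (2 - x i ^ 2)) * ev (der I a) x ^ 2 else 0

lemma Yl_sq (a : Finset V → ℝ) (l : ℕ) {x y : V → ℝ} (h : ∀ i, y i ^ 2 = 2 - x i ^ 2) :
    ∑ I, Yl a l x y I ^ 2 = Ul a l x := by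
  unfold Ul Yl
  apply sum_congr rfl; intro I _
  by_cases hI : I.card = l
  · simp only [hI, if_true, mul_pow, mon, ← prod_pow, h]
  · simp [hI]

lemma rl_sq (a : Finset V → ℝ) (l : ℕ) {x y : V → ℝ} (h : ∀ i, y i ^ 2 = 2 - x i ^ 2) :
    Ul a (l + 1) x ≤ ∑ I, ∑ j, rl a l x y I j ^ 2 := by
  rw [← Yl_sq a (l+1) h]
  have h1 : ∀ j, ∑ K, (if j ∈ K then Yl a (l+1) x y K ^ 2 else 0) ≤ ∑ I, rl a l x y I j ^ 2 := by
    intro j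
    rw [sum_split j]
    apply sum_le_sum; intro I _
    by_cases hj : j ∈ I
    · simp only [hj, if_true]; positivity
    · simp only [hj, if_false, mem_insert_self, if_true, zero_add, Yl, rl, card_insert_of_notMem hj,
        Nat.add_right_cancel_iff]
      split_ifs
      · rw [neg_sq]
      · simp
  rw [sum_comm]
  refine le_trans ?_ (sum_le_sum fun j _ => h1 j)
  rw [sum_comm]
  apply sum_le_sum; intro K _
  by_cases hK : K.card = l + 1
  · obtain ⟨j, hj⟩ : K.Nonempty := by rw [← card_pos]; omega
    have := single_le_sum (f := fun j => if j ∈ K then Yl a (l+1) x y K ^ 2 else 0)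
      (fun i _ => by split_ifs <;> positivity) (mem_univ j)
    simpa [hj] using this
  · simp [Yl, hK]

lemma Ul_nonneg (a : Finset V → ℝ) (l : ℕ) {x : V → ℝ} (h : ∀ i, 0 ≤ 2 - x i ^ 2) : 0 ≤ Ul a l x := by
  unfold Ul; apply sum_nonneg; intro I _
  split_ifs
  · exact mul_nonneg (prod_nonneg fun i _ => h i) (sq_nonneg _)
  · exact le_refl _

variable {N : ℕ} [NeZero N]

/-- arc point -/
noncomputable def AX (ω : V → ZMod N) : V → ℝ := fun i => ax (ω i)
/-- conjugate arc point -/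
noncomputable def AY (ω : V → ZMod N) : V → ℝ := fun i => ay (ω i)

lemma path_bound {a : Finset V → ℝ} {J : Finset V} {d : ℕ} (h : Deg a J d) (l : ℕ)
    {ε : ℝ} (hε : 0 < ε) (hε1 : ε ≤ 1) (hεN : 1 ≤ ε * N) (w : Finset V → Bool) (c : V → Bool) :
    Ex (fun ω : V → ZMod N => ε ^ 2 * (∑ I, bs (w I) * ∑ j, bs (c j) * rl a l (AX ω) (AY ω) I j) ^ 2 /
      ((∑ I, bs (w I) * Yl a l (AX ω) (AY ω) I) ^ 2
        + ε ^ 2 * (∑ I, bs (w I) * ∑ j, bs (c j) * rl a l (AX ω) (AY ω) I j) ^ 2)) ≤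
      (2 * ((l + d : ℕ):ℝ) ^ 2 + 2 * 2 ^ (2 * (l + d)) * (2 * ((l + d : ℕ):ℝ) * 32)) * ε := by
  set Ψ : (V → ZMod N) → ℝ := fun ω => ε ^ 2 * (∑ I, bs (w I) * ∑ j, bs (c j) * rl a l (AX ω) (AY ω) I j) ^ 2 /
      ((∑ I, bs (w I) * Yl a l (AX ω) (AY ω) I) ^ 2
        + ε ^ 2 * (∑ I, bs (w I) * ∑ j, bs (c j) * rl a l (AX ω) (AY ω) I j) ^ 2) with hΨ
  let sh : ZMod N → (V → ZMod N) := fun t i => if c i then t else -t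
  have h1 : Ex Ψ = Ex (fun ω : V → ZMod N => Ex (fun t : ZMod N => Ψ (ω + sh t))) := by
    rw [Ex_comm]
    have : ∀ t, Ex (fun ω : V → ZMod N => Ψ (ω + sh t)) = Ex Ψ := fun t => Ex_equiv (Equiv.addRight (sh t)) Ψ
    simp only [this, Ex_const]
  rw [h1]
  apply Ex_le_const; intro ω
  let px : V → ℝ → ℝ := fun i θ => AX ω i * Real.cos θ + (- bs (c i) * AY ω i) * Real.sin θ
  let py : V → ℝ → ℝ := fun i θ => AY ω i * Real.cos θ + (bs (c i) * AX ω i) * Real.sin θ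
  have hAX : ∀ t, AX (ω + sh t) = fun i => px i (ang t) := by
    intro t; funext i
    simp only [AX, AY, Pi.add_apply, px, sh, ax_add]
    cases c i <;> simp [bs, cos_ang_neg, sin_ang_neg]; ring
  have hAY : ∀ t, AY (ω + sh t) = fun i => py i (ang t) := by
    intro t; funext i
    simp only [AX, AY, Pi.add_apply, py, sh, ay_add]
    cases c i <;> simp [bs, cos_ang_neg, sin_ang_neg]
  have hpx : ∀ i θ, HasDerivAt (px i) (- bs (c i) * py i θ) θ := by
    intro i θ
    have := ((Real.hasDerivAt_cos θ).const_mul (AX ω i)).fun_add ((Real.hasDerivAt_sin θ).const_mul (- bs (c i) * AY ω i))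
    refine this.congr_deriv (Eq.symm ?_)
    simp only [py]; linear_combination (- AX ω i * Real.sin θ) * bs_sq (c i)
  have hpy : ∀ i θ, HasDerivAt (py i) (bs (c i) * px i θ) θ := by
    intro i θ
    have := ((Real.hasDerivAt_cos θ).const_mul (AY ω i)).fun_add ((Real.hasDerivAt_sin θ).const_mul (bs (c i) * AX ω i))
    refine this.congr_deriv (Eq.symm ?_)
    simp only [px]; linear_combination (- AY ω i * Real.sin θ) * bs_sq (c i)
  let T : ℝ → ℝ := fun θ => ∑ I, bs (w I) * Yl a l (fun i => px i θ) (fun i => py i θ) I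
  let T' : ℝ → ℝ := fun θ => ∑ I, bs (w I) * ∑ j, bs (c j) * rl a l (fun i => px i θ) (fun i => py i θ) I j
  have hT : ∀ θ, HasDerivAt T (T' θ) θ := by
    intro θ
    exact HasDerivAt.fun_sum fun I _ => (hasDerivAt_Yl a l c px py θ (fun i => hpx i θ) (fun i => hpy i θ) I).const_mul _
  have hTd : TrigDeg (l + d) T := by
    apply TrigDeg.sum; intro I _
    have := (TrigDeg.const (bs (w I))).mul (trigDeg_Yl (x := px) (y := py) h l (fun i => TrigDeg.cossin _ _) (fun i => TrigDeg.cossin _ _) I)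
    rw [zero_add] at this
    exact this
  have := trig_main (N := N) (l + d) hT hTd hε hε1 hεN
  simp only [hΨ, hAX, hAY]
  exact this

/-- Kane's estimate on arcs -/
lemma kane_arc (l d : ℕ) : ∃ C : ℝ, 0 < C ∧ ∀ (V : Type) [Fintype V] [DecidableEq V] (N : ℕ) [NeZero N]
    (a : Finset V → ℝ) (J : Finset V), Deg a J d → ∀ ε : ℝ, 0 < ε → ε ≤ 1 → 1 ≤ ε * N →
    Ex (fun ω : V → ZMod N => ε ^ 2 * Ul a (l+1) (AX ω) / (Ul a l (AX ω) + ε ^ 2 * Ul a (l+1) (AX ω))) ≤ C * ε := by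
  refine ⟨2 * 324 ^ 2 * (2 * ((l + d : ℕ):ℝ) ^ 2 + 2 * 2 ^ (2 * (l + d)) * (2 * ((l + d : ℕ):ℝ) * 32) + 1), by positivity, ?_⟩
  intro V _ _ N _ a J h ε hε hε1 hεN
  have hxy : ∀ (ω : V → ZMod N) i, AY ω i ^ 2 = 2 - AX ω i ^ 2 := fun ω i => ax_ay _
  have hx : ∀ (ω : V → ZMod N) i, 0 ≤ 2 - AX ω i ^ 2 := fun ω i => by rw [← hxy]; positivity
  have h1 : ∀ ω : V → ZMod N, _ := fun ω => bil_lower (rl a l (AX ω) (AY ω)) (Yl a l (AX ω) (AY ω)) hε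
    (Ul_nonneg a (l+1) (hx ω)) (rl_sq a l (hxy ω))
  have h2 := Ex_mono h1
  rw [Ex_mul_left, Ex_comm] at h2
  have h3 : ∀ w : Finset V → Bool, _ := fun w => Ex_comm (fun (ω : V → ZMod N) (c : V → Bool) => ε ^ 2 * (∑ I, bs (w I) * ∑ j, bs (c j) * rl a l (AX ω) (AY ω) I j) ^ 2 /
      ((∑ I, bs (w I) * Yl a l (AX ω) (AY ω) I) ^ 2
        + ε ^ 2 * (∑ I, bs (w I) * ∑ j, bs (c j) * rl a l (AX ω) (AY ω) I j) ^ 2))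
  simp only [h3] at h2
  have h4 := h2.trans (Ex_le_const fun w => Ex_le_const fun c => path_bound h l hε hε1 hεN w c)
  simp only [Yl_sq a l (hxy _)] at h4
  nlinarith
end path
end EdgeStat

namespace EdgeStat
set_option linter.all false

section scalar

lemma abs_mul_le' {x y X Y : ℝ} (hx : |x| ≤ X) (hy : |y| ≤ Y) : |x * y| ≤ X * Y := by
  rw [abs_mul]
  exact mul_le_mul hx hy (abs_nonneg _) ((abs_nonneg _).trans hx)

/-- pointwise long division estimate -/
lemma lind_pt {c0 p e b g s t : ℝ} (hc0 : 0 ≤ c0) (hc1 : c0 ≤ 1) (hp : |p| ≤ 2 * s) (he : |e| ≤ s ^ 2)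
    (hb : |b| ≤ 2 * s) (hg : |g| ≤ s ^ 2) (hs0 : 0 ≤ s) (hs : s ≤ 1 / 8) (ht : t ^ 2 ≤ 2) :
    |(c0 + p * t + e * t ^ 2) / (1 + b * t + g * t ^ 2) -
      (c0 + (p - b * c0) * t + (e - b * (p - b * c0) - g * c0) * t ^ 2
        + (- b * (e - b * (p - b * c0) - g * c0) - g * (p - b * c0)) * t ^ 3)| ≤ 600 * s ^ 4 := by
  have ht1 : |t| ≤ 3 / 2 := by
    apply abs_le_of_sq_le_sq' _ (by norm_num) |> abs_le.2
    linarith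
  have hc : |c0| ≤ 1 := by rw [abs_of_nonneg hc0]; exact hc1
  have ht2 : |t ^ 2| ≤ 2 := by rw [abs_of_nonneg (sq_nonneg t)]; exact ht
  have hbt := abs_mul_le' hb ht1
  have hgt := abs_mul_le' hg ht2
  have hden : 1 / 2 ≤ 1 + b * t + g * t ^ 2 := by
    have h1 := (abs_le.1 hbt).1
    have h2 := (abs_le.1 hgt).1
    nlinarith
  set c1 := p - b * c0 with hc1d
  have h1 : |c1| ≤ 4 * s := by
    have := abs_mul_le' hb hc
    have := abs_sub p (b * c0)
    linarith
  set c2 := e - b * c1 - g * c0 with hc2d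
  have h2 : |c2| ≤ 10 * s ^ 2 := by
    have e1 := abs_mul_le' hb h1
    have e2 := abs_mul_le' hg hc
    have e3 := abs_sub (e - b * c1) (g * c0)
    have e4 := abs_sub e (b * c1)
    nlinarith
  set c3 := - b * c2 - g * c1 with hc3d
  have h3 : |c3| ≤ 24 * s ^ 3 := by
    have e1 := abs_mul_le' hb h2
    have e2 := abs_mul_le' hg h1
    have e3 := abs_sub (- b * c2) (g * c1)
    rw [neg_mul, abs_neg] at e3
    rw [hc3d, neg_mul]
    nlinarith
  have hpos : 0 < 1 + b * t + g * t ^ 2 := by linarith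
  have key : (c0 + p * t + e * t ^ 2) / (1 + b * t + g * t ^ 2) -
      (c0 + c1 * t + c2 * t ^ 2 + c3 * t ^ 3) =
      - (t ^ 2 * t ^ 2 * (b * c3 + g * c2 + g * (c3 * t))) / (1 + b * t + g * t ^ 2) := by
    rw [eq_div_iff hpos.ne', sub_mul, div_mul_cancel₀ _ hpos.ne']
    rw [hc3d, hc2d, hc1d]; ring
  rw [key, abs_div, abs_neg, abs_of_pos hpos, div_le_iff₀ hpos]
  have f1 := abs_mul_le' hb h3
  have f2 := abs_mul_le' hg h2
  have f3 := abs_mul_le' hg (abs_mul_le' h3 ht1)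
  have f4 : |b * c3 + g * c2 + g * (c3 * t)| ≤ 75 * s ^ 4 := by
    have g1 := abs_add_le (b * c3 + g * c2) (g * (c3 * t))
    have g2 := abs_add_le (b * c3) (g * c2)
    have g3 : s ^ 5 ≤ s ^ 4 * (1 / 8) := by rw [pow_succ]; gcongr
    have g4 : 0 ≤ s ^ 4 := by positivity
    nlinarith
  have f5 := abs_mul_le' (abs_mul_le' ht2 ht2) f4
  have g4 : 0 ≤ s ^ 4 := by positivity
  nlinarith

lemma lind_ex {Ω : Type} [Fintype Ω] [Nonempty Ω] {z : Ω → ℝ} (z1 : Ex z = 0) (z2 : Ex (fun o => z o ^ 2) = 1)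
    (z3 : Ex (fun o => z o ^ 3) = 0) (hz : ∀ o, z o ^ 2 ≤ 2)
    {c0 p e b g s : ℝ} (hc0 : 0 ≤ c0) (hc1 : c0 ≤ 1) (hp : |p| ≤ 2 * s) (he : |e| ≤ s ^ 2)
    (hb : |b| ≤ 2 * s) (hg : |g| ≤ s ^ 2) (hs0 : 0 ≤ s) (hs : s ≤ 1 / 8) :
    |Ex (fun o => (c0 + p * z o + e * z o ^ 2) / (1 + b * z o + g * z o ^ 2)) -
      (c0 + (e - b * (p - b * c0) - g * c0))| ≤ 600 * s ^ 4 := by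
  set c2 := (e - b * (p - b * c0) - g * c0) with hc2
  set c3 := (- b * (e - b * (p - b * c0) - g * c0) - g * (p - b * c0)) with hc3
  have h : c0 + c2 = Ex (fun o => c0 + (p - b * c0) * z o + c2 * z o ^ 2 + c3 * z o ^ 3) := by
    simp only [Ex_add, Ex_mul_left, Ex_const, z2, z3]
    have : Ex (fun o => z o) = 0 := z1
    rw [this]; ring
  rw [h, ← Ex_sub]
  refine (Ex_abs _).trans (Ex_le_const fun o => ?_)
  exact lind_pt hc0 hc1 hp he hb hg hs0 hs (hz o)

/-- comparing two distributions for one coordinate -/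
lemma lind_one {Ω : Type} [Fintype Ω] [Nonempty Ω] {z z' : Ω → ℝ} (z1 : Ex z = 0) (z2 : Ex (fun o => z o ^ 2) = 1)
    (z3 : Ex (fun o => z o ^ 3) = 0) (hz : ∀ o, z o ^ 2 ≤ 2)
    (z1' : Ex z' = 0) (z2' : Ex (fun o => z' o ^ 2) = 1)
    (z3' : Ex (fun o => z' o ^ 3) = 0) (hz' : ∀ o, z' o ^ 2 ≤ 2)
    {A B α β γ κ η : ℝ} (hη : 0 < η) (hα : η ≤ α) (hA : A ^ 2 ≤ α) (hB : B ^ 2 ≤ κ) (hβ : β ^ 2 ≤ 4 * α * κ)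
    (hγ : |γ| ≤ κ)
    (hf : ∀ t : ℝ, t ^ 2 ≤ 2 → 0 ≤ (A + B * t) ^ 2 / (α + β * t + γ * t ^ 2) ∧
      (A + B * t) ^ 2 / (α + β * t + γ * t ^ 2) ≤ 1) :
    |Ex (fun o => (A + B * z o) ^ 2 / (α + β * z o + γ * z o ^ 2))
      - Ex (fun o => (A + B * z' o) ^ 2 / (α + β * z' o + γ * z' o ^ 2))| ≤ 4096 * (κ / η) ^ 2 := by
  have hα0 : 0 < α := by linarith
  have hκ : 0 ≤ κ := (sq_nonneg _).trans hB
  have hk : κ / α ≤ κ / η := by gcongr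
  have hk0 : 0 ≤ κ / α := by positivity
  have hk2 : (κ / α) ^ 2 ≤ (κ / η) ^ 2 := by gcongr
  set s := √(κ / α) with hs
  have hs0 : 0 ≤ s := Real.sqrt_nonneg _
  have hs2 : s ^ 2 = κ / α := Real.sq_sqrt hk0
  have hs4 : s ^ 4 = (κ / α) ^ 2 := by rw [← hs2]; ring
  by_cases hcase : s ≤ 1 / 8
  · have heq : ∀ t : ℝ, (A + B * t) ^ 2 / (α + β * t + γ * t ^ 2) =
        (A ^ 2 / α + (2 * A * B / α) * t + (B ^ 2 / α) * t ^ 2) / (1 + (β / α) * t + (γ / α) * t ^ 2) := by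
      intro t
      have e1 : (A ^ 2 / α + (2 * A * B / α) * t + (B ^ 2 / α) * t ^ 2) = (A + B * t) ^ 2 / α := by
        field_simp; ring
      have e2 : (1 + (β / α) * t + (γ / α) * t ^ 2) = (α + β * t + γ * t ^ 2) / α := by
        field_simp
      rw [e1, e2, div_div_div_cancel_right₀ hα0.ne']
    simp only [heq]
    have hc0 : 0 ≤ A ^ 2 / α := by positivity
    have hc1 : A ^ 2 / α ≤ 1 := by rw [div_le_one hα0]; exact hA
    have he : |B ^ 2 / α| ≤ s ^ 2 := by
      rw [abs_of_nonneg (by positivity), hs2]; gcongr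
    have hp : |2 * A * B / α| ≤ 2 * s := by
      apply abs_le_of_sq_le_sq _ (by positivity)
      rw [mul_pow, hs2, div_pow, div_le_iff₀ (by positivity)]
      have : A ^ 2 * B ^ 2 ≤ α * κ := mul_le_mul hA hB (sq_nonneg _) hα0.le
      have e : 2 ^ 2 * (κ / α) * α ^ 2 = 4 * (α * κ) := by field_simp; ring
      rw [e]; nlinarith
    have hb : |β / α| ≤ 2 * s := by
      apply abs_le_of_sq_le_sq _ (by positivity)
      rw [mul_pow, hs2, div_pow, div_le_iff₀ (by positivity)]
      have e : 2 ^ 2 * (κ / α) * α ^ 2 = 4 * α * κ := by field_simp; ring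
      rw [e]; exact hβ
    have hg : |γ / α| ≤ s ^ 2 := by
      rw [abs_div, abs_of_pos hα0, hs2]; gcongr
    have l1 := lind_ex z1 z2 z3 hz hc0 hc1 hp he hb hg hs0 hcase
    have l2 := lind_ex z1' z2' z3' hz' hc0 hc1 hp he hb hg hs0 hcase
    rw [abs_sub_comm] at l2
    refine (abs_sub_le _ _ _).trans ((add_le_add l1 l2).trans ?_)
    rw [hs4]; nlinarith [sq_nonneg (κ / α)]
  · push Not at hcase
    have h1 : (1 / 8 : ℝ) ^ 4 ≤ s ^ 4 := by gcongr
    rw [hs4] at h1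
    have a1 : 0 ≤ Ex (fun o => (A + B * z o) ^ 2 / (α + β * z o + γ * z o ^ 2)) := Ex_nonneg fun o => (hf _ (hz o)).1
    have a2 : Ex (fun o => (A + B * z o) ^ 2 / (α + β * z o + γ * z o ^ 2)) ≤ 1 := Ex_le_const fun o => (hf _ (hz o)).2
    have a3 : 0 ≤ Ex (fun o => (A + B * z' o) ^ 2 / (α + β * z' o + γ * z' o ^ 2)) := Ex_nonneg fun o => (hf _ (hz' o)).1
    have a4 : Ex (fun o => (A + B * z' o) ^ 2 / (α + β * z' o + γ * z' o ^ 2)) ≤ 1 := Ex_le_const fun o => (hf _ (hz' o)).2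
    rw [abs_le]; constructor <;> nlinarith
end scalar

section den
variable {V : Type} [Fintype V] [DecidableEq V]

/-- product weight -/
def pw (I : Finset V) (x : V → ℝ) : ℝ := ∏ i ∈ I, (2 - x i ^ 2)
/-- denominators -/
def den (w : ℕ → ℝ) (η : ℝ) (a : Finset V → ℝ) (x : V → ℝ) : ℝ :=
  η + ∑ I, w I.card * (pw I x * ev (der I a) x ^ 2)
/-- influence density -/
def kap (i : V) (a : Finset V → ℝ) (x : V → ℝ) : ℝ :=
  ∑ I, if i ∈ I then 0 else pw I x * ev (der (insert i I) a) x ^ 2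
/-- constant coefficient -/
def alp (w : ℕ → ℝ) (η : ℝ) (i : V) (a : Finset V → ℝ) (x : V → ℝ) : ℝ :=
  η + ∑ I, if i ∈ I then 0 else pw I x * (w I.card * ev (Z i (der I a)) x ^ 2
    + 2 * w (I.card + 1) * ev (der (insert i I) a) x ^ 2)
/-- linear coefficient -/
def bet (w : ℕ → ℝ) (i : V) (a : Finset V → ℝ) (x : V → ℝ) : ℝ :=
  2 * ∑ I, if i ∈ I then 0 else pw I x * (w I.card * ev (Z i (der I a)) x * ev (der (insert i I) a) x)
/-- quadratic coefficient -/
def gam (w : ℕ → ℝ) (i : V) (a : Finset V → ℝ) (x : V → ℝ) : ℝ :=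
  ∑ I, if i ∈ I then 0 else pw I x * ((w I.card - w (I.card + 1)) * ev (der (insert i I) a) x ^ 2)

lemma pw_update {I : Finset V} {i : V} (hi : i ∉ I) (x : V → ℝ) (t : ℝ) : pw I (Function.update x i t) = pw I x := by
  unfold pw; apply prod_congr rfl; intro j hj
  rw [Function.update_of_ne]; rintro rfl; exact hi hj

lemma pw_insert {I : Finset V} {i : V} (hi : i ∉ I) (x : V → ℝ) (t : ℝ) :
    pw (insert i I) (Function.update x i t) = (2 - t ^ 2) * pw I x := by
  have : pw (insert i I) (Function.update x i t) = (2 - t ^ 2) * pw I (Function.update x i t) := by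
    unfold pw; rw [prod_insert hi, Function.update_self]
  rw [this, pw_update hi]

lemma pw_nonneg {x : V → ℝ} (hx : ∀ i, x i ^ 2 ≤ 2) (I : Finset V) : 0 ≤ pw I x :=
  prod_nonneg fun i _ => by linarith [hx i]

lemma pw_le {x : V → ℝ} (hx : ∀ i, x i ^ 2 ≤ 2) (I : Finset V) : pw I x ≤ 2 ^ I.card := by
  unfold pw
  calc _ ≤ ∏ i ∈ I, (2:ℝ) := prod_le_prod (fun i _ => by linarith [hx i]) (fun i _ => by nlinarith [sq_nonneg (x i)])
    _ = _ := by simp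

lemma den_update (w : ℕ → ℝ) (η : ℝ) (i : V) (a : Finset V → ℝ) (x : V → ℝ) (t : ℝ) :
    den w η a (Function.update x i t) = alp w η i a x + bet w i a x * t + gam w i a x * t ^ 2 := by
  unfold den alp bet gam
  rw [sum_split i, add_assoc, add_assoc, mul_sum, sum_mul, sum_mul, ← sum_add_distrib, ← sum_add_distrib]
  congr 1
  apply sum_congr rfl; intro I _
  by_cases hi : i ∈ I
  · simp [hi]
  · simp only [hi, if_false]
    rw [pw_update hi, pw_insert hi, card_insert_of_notMem hi, ev_update, ← D_der hi, ev_D_update]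
    ring

lemma kap_update (i : V) (a : Finset V → ℝ) (x : V → ℝ) (t : ℝ) : kap i a (Function.update x i t) = kap i a x := by
  unfold kap
  apply sum_congr rfl; intro I _
  by_cases hi : i ∈ I
  · simp [hi]
  · simp only [hi, if_false]
    rw [pw_update hi, ← D_der hi, ev_D_update]

lemma den_lower {w : ℕ → ℝ} (hw : ∀ l, 0 ≤ w l) (hw0 : w 0 = 1) (η : ℝ) (a : Finset V → ℝ) {x : V → ℝ}
    (hx : ∀ i, x i ^ 2 ≤ 2) : η + ev a x ^ 2 ≤ den w η a x := by
  unfold den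
  have := single_le_sum (f := fun I => w I.card * (pw I x * ev (der I a) x ^ 2))
    (fun I _ => mul_nonneg (hw _) (mul_nonneg (pw_nonneg hx I) (sq_nonneg _))) (mem_univ ∅)
  simp [hw0, pw, der_empty] at this
  simp only [pw]
  linarith [this]

lemma kap_nonneg (i : V) (a : Finset V → ℝ) {x : V → ℝ} (hx : ∀ i, x i ^ 2 ≤ 2) : 0 ≤ kap i a x := by
  unfold kap; apply sum_nonneg; intro I _
  split_ifs
  · exact le_refl _
  · exact mul_nonneg (pw_nonneg hx I) (sq_nonneg _)

lemma D_sq_le_kap (i : V) (a : Finset V → ℝ) {x : V → ℝ} (hx : ∀ i, x i ^ 2 ≤ 2) : ev (D i a) x ^ 2 ≤ kap i a x := by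
  unfold kap
  have := single_le_sum (f := fun I => if i ∈ I then 0 else pw I x * ev (der (insert i I) a) x ^ 2)
    (fun I _ => by split_ifs; exacts [le_refl _, mul_nonneg (pw_nonneg hx I) (sq_nonneg _)]) (mem_univ ∅)
  simp only [notMem_empty, if_false, pw, prod_empty, one_mul, ← D_der (notMem_empty i), der_empty] at this
  exact this

lemma alp_lower {w : ℕ → ℝ} (hw : ∀ l, 0 ≤ w l) (hw0 : w 0 = 1) (η : ℝ) (i : V) (a : Finset V → ℝ) {x : V → ℝ}
    (hx : ∀ i, x i ^ 2 ≤ 2) : η + ev (Z i a) x ^ 2 ≤ alp w η i a x := by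
  unfold alp
  have := single_le_sum (f := fun I => if i ∈ I then 0 else pw I x * (w I.card * ev (Z i (der I a)) x ^ 2
    + 2 * w (I.card + 1) * ev (der (insert i I) a) x ^ 2))
    (fun I _ => by
      split_ifs
      · exact le_refl _
      · have := hw I.card; have := hw (I.card + 1); have := pw_nonneg hx I
        positivity) (mem_univ ∅)
  simp only [notMem_empty, if_false, pw, prod_empty, one_mul, der_empty, card_empty, hw0] at this
  have h2 := mul_nonneg (mul_nonneg zero_le_two (hw (0 + 1))) (sq_nonneg (ev (der (insert i ∅) a) x))
  simp only [pw]
  linarith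

lemma bet_sq {w : ℕ → ℝ} (hw : ∀ l, 0 ≤ w l) (hw1 : ∀ l, w l ≤ 1) {η : ℝ} (hη : 0 ≤ η) (i : V) (a : Finset V → ℝ) {x : V → ℝ}
    (hx : ∀ i, x i ^ 2 ≤ 2) : bet w i a x ^ 2 ≤ 4 * alp w η i a x * kap i a x := by
  unfold bet
  rw [mul_pow]
  have h1 := Finset.sum_sq_le_sum_mul_sum_of_sq_eq_mul (univ : Finset (Finset V))
    (r := fun I => if i ∈ I then 0 else pw I x * (w I.card * ev (Z i (der I a)) x * ev (der (insert i I) a) x))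
    (f := fun I => if i ∈ I then 0 else pw I x * (w I.card * ev (Z i (der I a)) x ^ 2))
    (g := fun I => if i ∈ I then 0 else pw I x * (w I.card * ev (der (insert i I) a) x ^ 2))
    (fun I _ => by
      have := hw I.card; have := pw_nonneg hx I
      split_ifs <;> positivity)
    (fun I _ => by
      have := hw I.card; have := pw_nonneg hx I
      split_ifs <;> positivity)
    (fun I _ => by split_ifs <;> ring)
  have h2 : ∑ I, (if i ∈ I then 0 else pw I x * (w I.card * ev (Z i (der I a)) x ^ 2)) ≤ alp w η i a x := by
    unfold alp
    refine le_trans (sum_le_sum fun I _ => ?_) (le_add_of_nonneg_left hη)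
    split_ifs
    · exact le_refl _
    · have := hw (I.card + 1); have := pw_nonneg hx I
      apply mul_le_mul_of_nonneg_left _ this
      have : 0 ≤ 2 * w (I.card + 1) * ev (der (insert i I) a) x ^ 2 := by positivity
      linarith
  have h3 : ∑ I, (if i ∈ I then 0 else pw I x * (w I.card * ev (der (insert i I) a) x ^ 2)) ≤ kap i a x := by
    unfold kap
    refine sum_le_sum fun I _ => ?_
    split_ifs
    · exact le_refl _
    · apply mul_le_mul_of_nonneg_left _ (pw_nonneg hx I)
      exact mul_le_of_le_one_left (sq_nonneg _) (hw1 _)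
  have h4 : 0 ≤ ∑ I, (if i ∈ I then 0 else pw I x * (w I.card * ev (der (insert i I) a) x ^ 2)) := by
    apply sum_nonneg; intro I _
    have := hw I.card; have := pw_nonneg hx I
    split_ifs <;> positivity
  have h5 : 0 ≤ alp w η i a x := by
    refine le_trans ?_ h2
    apply sum_nonneg; intro I _
    have := hw I.card; have := pw_nonneg hx I
    split_ifs <;> positivity
  have h6 := h1.trans (mul_le_mul h2 h3 h4 h5)
  linarith

lemma gam_abs {w : ℕ → ℝ} (hw : ∀ l, 0 ≤ w l) (hw1 : ∀ l, w l ≤ 1) (i : V) (a : Finset V → ℝ) {x : V → ℝ}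
    (hx : ∀ i, x i ^ 2 ≤ 2) : |gam w i a x| ≤ kap i a x := by
  unfold gam kap
  refine (abs_sum_le_sum_abs _ _).trans (sum_le_sum fun I _ => ?_)
  split_ifs
  · simp
  · rw [abs_mul, abs_of_nonneg (pw_nonneg hx I)]
    apply mul_le_mul_of_nonneg_left _ (pw_nonneg hx I)
    rw [abs_mul, abs_of_nonneg (sq_nonneg (ev _ _))]
    apply mul_le_of_le_one_left (sq_nonneg _)
    rw [abs_le]; constructor <;> linarith [hw I.card, hw1 I.card, hw (I.card + 1), hw1 (I.card + 1)]

lemma Ex_kap_sq {Ω : Type} [Fintype Ω] [Nonempty Ω] {z : V → Ω → ℝ} (hz : Good z) (hz2 : ∀ i o, z i o ^ 2 ≤ 2)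
    {a : Finset V → ℝ} {J : Finset V} {d : ℕ} (h : Deg a J d) (i : V) :
    Ex (fun ω => kap i a (X z ω) ^ 2) ≤ 144 ^ d * sq (D i a) ^ 2 := by
  have h1 : ∀ ω, kap i a (X z ω) ≤ ∑ I, (if i ∈ I then 0 else 2 ^ d) * ev (der (insert i I) a) (X z ω) ^ 2 := by
    intro ω; unfold kap
    apply sum_le_sum; intro I _
    split_ifs with hi
    · simp
    · by_cases hd : d < I.card
      · have : d < (insert i I).card := lt_of_lt_of_le hd (card_le_card (subset_insert _ _))
        rw [h.der_zero this, ev_zero]; simp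
      · have h2 := pw_le (x := X z ω) (fun i => hz2 i _) I
        have h3 : (2:ℝ) ^ I.card ≤ 2 ^ d := pow_le_pow_right₀ (by norm_num) (by omega)
        have := h2.trans h3
        gcongr
  have h2 := moment_vec hz univ (fun I => if i ∈ I then (0:ℝ) else 2 ^ d) (fun I _ => by split_ifs <;> positivity)
    (fun I => der (insert i I) a) (fun I _ => (h.der (insert i I)).mono (subset_refl _) (Nat.sub_le _ _))
  have h3 : ∑ I, (if i ∈ I then (0:ℝ) else 2 ^ d) * sq (der (insert i I) a) ≤ 4 ^ d * sq (D i a) := by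
    have e1 : ∀ I, (if i ∈ I then (0:ℝ) else 2 ^ d) * sq (der (insert i I) a) ≤
        ∑ K, (if I ⊆ K ∧ i ∈ K then (2:ℝ) ^ d * a K ^ 2 else 0) := by
      intro I
      rw [sq_der, mul_sum]
      apply sum_le_sum; intro K _
      by_cases hK : insert i I ⊆ K
      · have : I ⊆ K ∧ i ∈ K := ⟨(subset_insert _ _).trans hK, hK (mem_insert_self _ _)⟩
        simp only [hK, this, if_true, and_self]
        split_ifs
        · simp; positivity
        · exact le_refl _
      · simp only [hK, if_false, mul_zero]
        split_ifs <;> positivity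
    refine (sum_le_sum fun I _ => e1 I).trans ?_
    rw [sum_comm, sq_D, mul_sum]
    apply sum_le_sum; intro K _
    by_cases hi : i ∈ K
    · simp only [hi, and_true, if_true]
      rw [← sum_filter, sum_const, nsmul_eq_mul]
      by_cases hK : a K = 0
      · simp [hK]
      have e2 : univ.filter (fun I => I ⊆ K) = K.powerset := by ext; simp
      rw [e2, card_powerset]
      have e3 : (2:ℝ) ^ K.card ≤ 2 ^ d := pow_le_pow_right₀ (by norm_num) (h K hK).2
      have e4 : (4:ℝ) ^ d = 2 ^ d * 2 ^ d := by rw [← mul_pow]; norm_num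
      rw [e4, mul_assoc]; push_cast
      gcongr
    · simp [hi]
  refine (Ex_mono (fun ω => ?_)).trans (h2.trans ?_)
  · have := kap_nonneg i a (x := X z ω) (fun i => hz2 i _)
    have := h1 ω
    gcongr
  · have h4 : 0 ≤ ∑ I, (if i ∈ I then (0:ℝ) else 2 ^ d) * sq (der (insert i I) a) := by
      apply sum_nonneg; intro I _
      have := sq_nonneg' (der (insert i I) a)
      split_ifs <;> positivity
    have e : (144:ℝ) ^ d * sq (D i a) ^ 2 = 9 ^ d * (4 ^ d * sq (D i a)) ^ 2 := by
      have : (144:ℝ) = 9 * (4 * 4) := by norm_num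
      rw [this, mul_pow, mul_pow]; ring
    rw [e]; gcongr
end den

section hybrid
variable {V : Type} [Fintype V] [DecidableEq V] {N : ℕ} [NeZero N]

/-- hybrid coordinates -/
noncomputable def hyb (S : Finset V) : V → Bool × ZMod N → ℝ := fun i o => if i ∈ S then ax o.2 else bs o.1

lemma ax_sq_le (o : ZMod N) : ax o ^ 2 ≤ 2 := by
  have := ax_ay o; nlinarith [sq_nonneg (ay o)]

lemma hyb_sq (S : Finset V) (i : V) (o : Bool × ZMod N) : hyb S i o ^ 2 ≤ 2 := by
  unfold hyb; split_ifs
  · exact ax_sq_le _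
  · rw [bs_sq]; norm_num

lemma good_hyb {N' : ℕ} (hN : N = 4 * N') (S : Finset V) : Good (hyb (N := N) S) := by
  have h1 := good_arc (V := V) (N := N) hN
  have h2 := good_sign (V := V)
  intro i
  have f1 : ∀ f : ℝ → ℝ, Ex (fun o : Bool × ZMod N => f (ax o.2)) = Ex (fun o : ZMod N => f (ax o)) := by
    intro f; rw [Ex_prod]; simp only [Ex_const]
  have f2 : ∀ f : ℝ → ℝ, Ex (fun o : Bool × ZMod N => f (bs o.1)) = Ex (fun o : Bool => f (bs o)) := by
    intro f; rw [Ex_prod]; simp only [Ex_const]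
  by_cases hi : i ∈ S
  · have : hyb (N := N) S i = fun o => ax o.2 := by funext o; simp [hyb, hi]
    rw [this]
    exact ⟨(f1 (fun x => x)).trans (h1 i).1, (f1 (fun x => x ^ 2)).trans (h1 i).2.1, (f1 (fun x => x ^ 3)).trans (h1 i).2.2.1,
      (f1 (fun x => x ^ 4)).trans_le (h1 i).2.2.2⟩
  · have : hyb (N := N) S i = fun o => bs o.1 := by funext o; simp [hyb, hi]
    rw [this]
    exact ⟨(f2 (fun x => x)).trans (h2 i).1, (f2 (fun x => x ^ 2)).trans (h2 i).2.1, (f2 (fun x => x ^ 3)).trans (h2 i).2.2.1,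
      (f2 (fun x => x ^ 4)).trans_le (h2 i).2.2.2⟩

lemma Ex_arrow_fst {A B : Type} [Fintype A] [Fintype B] [Nonempty B] (f : (V → A) → ℝ) :
    Ex (fun ω : V → A × B => f (fun i => (ω i).1)) = Ex f := by
  have := Ex_equiv (Equiv.arrowProdEquivProdArrow V (fun _ => A) (fun _ => B)) (fun p => f p.1)
  rw [Ex_prod] at this
  simp only [Ex_const] at this
  exact this

lemma Ex_arrow_snd {A B : Type} [Fintype A] [Fintype B] [Nonempty A] (f : (V → B) → ℝ) :
    Ex (fun ω : V → A × B => f (fun i => (ω i).2)) = Ex f := by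
  have := Ex_equiv (Equiv.arrowProdEquivProdArrow V (fun _ => A) (fun _ => B)) (fun p => f p.2)
  rw [Ex_prod] at this
  simp only [Ex_const] at this
  exact this

/-- Lindeberg replacement -/
lemma lindeberg {N' : ℕ} (hN : N = 4 * N') {a : Finset V → ℝ} {J : Finset V} {d : ℕ} (h : Deg a J d)
    {w : ℕ → ℝ} (hw : ∀ l, 0 ≤ w l) (hw1 : ∀ l, w l ≤ 1) (hw0 : w 0 = 1) {η : ℝ} (hη : 0 < η)
    (P : (V → ℝ) → ℝ) (hP : ∀ x : V → ℝ, (∀ i, x i ^ 2 ≤ 2) → P x ^ 2 ≤ η + ev a x ^ 2)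
    (hP' : ∀ x : V → ℝ, (∀ i, x i ^ 2 ≤ 2) → ∀ i, ∃ A B : ℝ, (∀ t, P (Function.update x i t) = A + B * t) ∧
      A ^ 2 ≤ η + ev (Z i a) x ^ 2 ∧ B ^ 2 ≤ ev (D i a) x ^ 2) :
    |Ex (fun ω : V → ZMod N => P (AX ω) ^ 2 / den w η a (AX ω)) -
      Ex (fun σ : V → Bool => P (sg σ) ^ 2 / den w η a (sg σ))| ≤ 4096 * 144 ^ d / η ^ 2 * ∑ i, sq (D i a) ^ 2 := by
  set F : (V → ℝ) → ℝ := fun x => P x ^ 2 / den w η a x with hF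
  have step : ∀ (S : Finset V) (i : V), i ∉ S →
      |Ex (fun ω => F (X (hyb (N := N) (insert i S)) ω)) - Ex (fun ω => F (X (hyb (N := N) S) ω))| ≤
      4096 * 144 ^ d / η ^ 2 * sq (D i a) ^ 2 := by
    intro S i hi
    have g1 := good_hyb hN S i
    have g2 := good_hyb hN (insert i S) i
    rw [← Ex_update i (fun ω => F (X (hyb (N := N) (insert i S)) ω)), ← Ex_update i (fun ω => F (X (hyb (N := N) S) ω)), ← Ex_sub]
    refine (Ex_abs _).trans ?_
    have pt : ∀ ω : V → Bool × ZMod N, |Ex (fun o => F (X (hyb (N := N) (insert i S)) (Function.update ω i o))) -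
        Ex (fun o => F (X (hyb (N := N) S) (Function.update ω i o)))| ≤ 4096 / η ^ 2 * kap i a (X (hyb (N := N) S) ω) ^ 2 := by
      intro ω
      set x := X (hyb (N := N) S) ω with hx
      have hx2 : ∀ j, x j ^ 2 ≤ 2 := fun j => hyb_sq _ _ _
      have e1 : ∀ o, X (hyb (N := N) S) (Function.update ω i o) = Function.update x i (hyb (N := N) S i o) := fun o => X_update _ _ _ _
      have e2 : ∀ o, X (hyb (N := N) (insert i S)) (Function.update ω i o) = Function.update x i (hyb (N := N) (insert i S) i o) := by
        intro o; funext j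
        by_cases hj : j = i
        · subst hj; simp [X]
        · simp [X, hj, hx, hyb]
      obtain ⟨A, B, hAB, hA, hB⟩ := hP' x hx2 i
      simp only [e1, e2, hF, den_update, hAB]
      have hupd : ∀ t : ℝ, t ^ 2 ≤ 2 → ∀ j, Function.update x i t j ^ 2 ≤ 2 := by
        intro t ht j
        by_cases hj : j = i
        · subst hj; simpa using ht
        · simp [hj, hx2 j]
      have := lind_one (z := hyb (N := N) (insert i S) i) (z' := hyb (N := N) S i) g2.1 g2.2.1 g2.2.2.1 (hyb_sq _ _) g1.1 g1.2.1 g1.2.2.1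
        (hyb_sq _ _) hη (A := A) (B := B) (α := alp w η i a x) (β := bet w i a x) (γ := gam w i a x) (κ := kap i a x)
        (by have := alp_lower hw hw0 η i a hx2; nlinarith [sq_nonneg (ev (Z i a) x)])
        (hA.trans (alp_lower hw hw0 η i a hx2)) (hB.trans (D_sq_le_kap i a hx2)) (bet_sq hw hw1 hη.le i a hx2)
        (gam_abs hw hw1 i a hx2)
        (by
          intro t ht
          rw [← hAB, ← den_update]
          have h1 := den_lower hw hw0 η a (hupd t ht)
          have h2 := hP _ (hupd t ht)
          have h3 : 0 < den w η a (Function.update x i t) := by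
            have := sq_nonneg (ev a (Function.update x i t)); linarith
          exact ⟨by positivity, by rw [div_le_one h3]; linarith⟩)
      refine this.trans (le_of_eq ?_)
      field_simp
    refine (Ex_mono pt).trans ?_
    rw [Ex_mul_left]
    have := Ex_kap_sq (good_hyb hN S) (hyb_sq S) h i
    calc _ ≤ 4096 / η ^ 2 * (144 ^ d * sq (D i a) ^ 2) := by gcongr
      _ = _ := by ring
  have all : ∀ S : Finset V, |Ex (fun ω => F (X (hyb (N := N) S) ω)) - Ex (fun ω => F (X (hyb (N := N) ∅) ω))| ≤
      4096 * 144 ^ d / η ^ 2 * ∑ i ∈ S, sq (D i a) ^ 2 := by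
    intro S
    induction S using Finset.induction_on with
    | empty => simp
    | insert i S hi ih =>
      rw [sum_insert hi, mul_add]
      exact (abs_sub_le _ _ _).trans (add_le_add (step S i hi) ih)
  have fin := all univ
  have e1 : Ex (fun ω => F (X (hyb (N := N) (univ : Finset V)) ω)) = Ex (fun ω : V → ZMod N => F (AX ω)) := by
    rw [← Ex_arrow_snd (A := Bool) (fun ω : V → ZMod N => F (AX ω))]
    apply Ex_congr; intro ω; congr 1; funext i; simp [X, hyb, AX]
  have e2 : Ex (fun ω => F (X (hyb (N := N) (∅ : Finset V)) ω)) = Ex (fun σ : V → Bool => F (sg σ)) := by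
    rw [← Ex_arrow_fst (B := ZMod N) (fun σ : V → Bool => F (sg σ))]
    apply Ex_congr; intro ω; congr 1
  rw [e1, e2] at fin
  exact fin
end hybrid
end EdgeStat

namespace EdgeStat
set_option linter.all false

section low
variable {V : Type} [Fintype V] [DecidableEq V]

lemma pw_sg (I : Finset V) (σ : V → Bool) : pw I (sg σ) = 1 := by
  unfold pw; apply prod_eq_one; intro i _; simp only [sg, bs_sq]; norm_num

lemma sg_sq_le (σ : V → Bool) (i : V) : sg σ i ^ 2 ≤ 2 := by simp only [sg, bs_sq]; norm_num

/-- level weights -/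
noncomputable def Wl (a : Finset V → ℝ) (l : ℕ) : ℝ := ∑ I, if I.card = l then a I ^ 2 else 0

lemma Wl_nonneg (a : Finset V → ℝ) (l : ℕ) : 0 ≤ Wl a l :=
  sum_nonneg fun I _ => by split_ifs <;> positivity

lemma Wl_sum {a : Finset V → ℝ} {J : Finset V} {d : ℕ} (h : Deg a J d) (j : ℕ) :
    ∑ l ∈ Ico j (d + 1), Wl a l = ∑ K, if j ≤ K.card then a K ^ 2 else 0 := by
  unfold Wl; rw [sum_comm]
  apply sum_congr rfl; intro K _
  by_cases h0 : a K = 0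
  · simp [h0]
  · rw [sum_ite_eq]
    have := (h K h0).2
    have e : K.card ∈ Ico j (d + 1) ↔ j ≤ K.card := by simp; omega
    simp only [e]

lemma dev_eq {a : Finset V → ℝ} {J : Finset V} {d : ℕ} (h : Deg a J d) (I : Finset V) :
    Ex (fun σ : V → Bool => (ev (der I a) (sg σ) - a I) ^ 2) = sq (der I a) - a I ^ 2 := by
  have e : ∀ σ : V → Bool, (ev (der I a) (sg σ) - a I) ^ 2 = ev (der I a) (sg σ) ^ 2 - (2 * a I) * ev (der I a) (sg σ) + a I ^ 2 := by
    intro σ; ring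
  simp only [e, Ex_add, Ex_sub, Ex_mul_left, sg2, Ex_const]
  have := moment1 (good_sign (V := V)) J (der I a) _ (h.der I)
  simp only [← sg_eq_X] at this
  rw [this]
  have : der I a ∅ = a I := by simp [der]
  rw [this]; ring

lemma dev_sum {a : Finset V → ℝ} {J : Finset V} {d : ℕ} (h : Deg a J d) (j : ℕ) :
    Ex (fun σ : V → Bool => ∑ I, if I.card = j then (ev (der I a) (sg σ) - a I) ^ 2 else 0) ≤
      2 ^ d * ∑ l ∈ Ico (j + 1) (d + 1), Wl a l := by
  rw [Wl_sum h, Ex_sum]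
  have h1 : ∀ I : Finset V, Ex (fun σ : V → Bool => if I.card = j then (ev (der I a) (sg σ) - a I) ^ 2 else 0) ≤
      ∑ K, if I ⊆ K ∧ j + 1 ≤ K.card then a K ^ 2 else 0 := by
    intro I
    by_cases hI : I.card = j
    · simp only [hI, if_true]
      rw [dev_eq h, sq_der]
      have : a I ^ 2 = ∑ K, if K = I then a K ^ 2 else 0 := by simp
      rw [this, ← sum_sub_distrib]
      apply sum_le_sum; intro K _
      by_cases hK : K = I
      · subst hK; simp; split_ifs <;> positivity
      · by_cases hs : I ⊆ K
        · have : j + 1 ≤ K.card := by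
            have := card_lt_card (lt_of_le_of_ne hs (Ne.symm hK)); omega
          simp [hK, hs, this]
        · simp [hK, hs]
    · simp only [hI, if_false, Ex_zero]
      exact sum_nonneg fun K _ => by split_ifs <;> positivity
  refine (sum_le_sum fun I _ => h1 I).trans ?_
  rw [sum_comm, mul_sum]
  apply sum_le_sum; intro K _
  by_cases hK : a K = 0
  · simp [hK]
  by_cases hc : j + 1 ≤ K.card
  · simp only [hc, and_true, if_true]
    rw [← sum_filter, sum_const, nsmul_eq_mul]
    have e2 : univ.filter (fun I => I ⊆ K) = K.powerset := by ext; simp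
    rw [e2, card_powerset]; push_cast
    have e3 : (2:ℝ) ^ K.card ≤ 2 ^ d := pow_le_pow_right₀ (by norm_num) (h K hK).2
    gcongr
  · simp [hc]

lemma geo_le {ε : ℝ} (hε : 0 < ε) (hε1 : ε ≤ 1 / 2) (n : ℕ) : ∑ l ∈ range n, ε ^ l ≤ 2 := by
  refine le_trans (sum_le_sum fun l _ => ?_) (sum_geometric_two_le n)
  gcongr

lemma den_low {a : Finset V → ℝ} {J : Finset V} {d : ℕ} (h : Deg a J d) (hS : 0 < sq a)
    {ε : ℝ} (hε : 0 < ε) (hε1 : ε ≤ 1 / 2) :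
    Ex (fun σ : V → Bool => ε ^ (3 * d + 1) * sq a / den (fun l => ε ^ (2 * l)) (ε ^ (3 * d + 1) * sq a) a (sg σ))
      ≤ (8 * 2 ^ d + 8) * ε := by
  set S := sq a with hSd
  set η := ε ^ (3 * d + 1) * S with hη
  have hη0 : 0 < η := by positivity
  -- choice of the level
  have hex : ∃ j ∈ range (d + 1), ε ^ j * S / 2 ≤ Wl a j ∧ ∀ l ∈ range (d + 1), j < l → Wl a l < ε ^ l * S / 2 := by
    have hne : ((range (d + 1)).filter (fun j => ε ^ j * S / 2 ≤ Wl a j)).Nonempty := by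
      by_contra hc
      rw [not_nonempty_iff_eq_empty, filter_eq_empty_iff] at hc
      have h1 := Wl_sum h 0
      simp only [Nat.zero_le, if_true, ← range_eq_Ico] at h1
      have h2 : ∑ l ∈ range (d + 1), Wl a l < ∑ l ∈ range (d + 1), ε ^ l * S / 2 :=
        sum_lt_sum_of_nonempty ⟨0, by simp⟩ fun l hl => not_le.mp (hc hl)
      have h3 : ∑ l ∈ range (d + 1), ε ^ l * S / 2 = (∑ l ∈ range (d + 1), ε ^ l) * (S / 2) := by
        rw [sum_mul]; apply sum_congr rfl; intro l _; ring
      have h4 := geo_le hε hε1 (d + 1)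
      have h5 : (∑ K, a K ^ 2) = S := rfl
      rw [h1, h5, h3] at h2
      nlinarith
    obtain ⟨j, hj, hmax⟩ := exists_max_image _ id hne
    rw [mem_filter] at hj
    refine ⟨j, hj.1, hj.2, ?_⟩
    intro l hl hjl
    by_contra hc
    have := hmax l (mem_filter.2 ⟨hl, not_lt.mp hc⟩)
    simp at this; omega
  obtain ⟨j, hj, hW, hmax⟩ := hex
  have hjd : j ≤ d := by simp at hj; omega
  have hWpos : 0 < Wl a j := lt_of_lt_of_le (by positivity) hW
  set S' : (V → Bool) → ℝ := fun σ => ∑ I, if I.card = j then (ev (der I a) (sg σ) - a I) ^ 2 else 0 with hS'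
  have hS'0 : ∀ σ, 0 ≤ S' σ := fun σ => sum_nonneg fun I _ => by split_ifs <;> positivity
  have hES' : Ex S' ≤ 2 ^ d * (ε ^ (j + 1) * S) := by
    refine (dev_sum h j).trans ?_
    gcongr
    have h1 : ∑ l ∈ Ico (j + 1) (d + 1), Wl a l ≤ ∑ l ∈ Ico (j + 1) (d + 1), ε ^ l * (S / 2) := by
      apply sum_le_sum; intro l hl
      simp at hl
      have := hmax l (by simp; omega) (by omega)
      linarith
    refine h1.trans ?_
    rw [← sum_mul, sum_Ico_eq_sum_range]
    simp only [pow_add ε (j + 1)]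
    rw [← mul_sum]
    have := geo_le hε hε1 (d + 1 - (j + 1))
    have hp : 0 < ε ^ (j + 1) := by positivity
    have : ε ^ (j + 1) * ∑ i ∈ range (d + 1 - (j + 1)), ε ^ i ≤ ε ^ (j + 1) * 2 := by gcongr
    nlinarith
  have pt : ∀ σ : V → Bool, η / den (fun l => ε ^ (2 * l)) η a (sg σ) ≤ 4 / Wl a j * S' σ + 8 * ε := by
    intro σ
    have hden : η + ε ^ (2 * j) * (Wl a j / 2 - S' σ) ≤ den (fun l => ε ^ (2 * l)) η a (sg σ) := by
      unfold den
      simp only [pw_sg, one_mul]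
      gcongr
      rw [hS', Wl]
      simp only [sum_div]
      rw [← sum_sub_distrib, mul_sum]
      apply sum_le_sum; intro I _
      by_cases hI : I.card = j
      · simp only [hI, if_true]
        have : a I ^ 2 / 2 - (ev (der I a) (sg σ) - a I) ^ 2 ≤ ev (der I a) (sg σ) ^ 2 := by
          nlinarith [sq_nonneg (2 * ev (der I a) (sg σ) - a I)]
        gcongr
      · simp [hI]; positivity
    have hdenη : η ≤ den (fun l => ε ^ (2 * l)) η a (sg σ) := by
      have := den_lower (w := fun l => ε ^ (2 * l)) (fun l => by positivity) (by simp) η a (sg_sq_le σ)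
      nlinarith [sq_nonneg (ev a (sg σ))]
    have hdpos := hη0.trans_le hdenη
    by_cases hc : S' σ ≤ Wl a j / 4
    · have h1 : ε ^ (2 * j) * (Wl a j / 4) ≤ den (fun l => ε ^ (2 * l)) η a (sg σ) := by
        refine le_trans ?_ hden
        have : ε ^ (2 * j) * (Wl a j / 4) ≤ ε ^ (2 * j) * (Wl a j / 2 - S' σ) := by
          gcongr; linarith
        linarith
      have h2 : 0 ≤ 4 / Wl a j * S' σ := mul_nonneg (by positivity) (hS'0 σ)
      have h3 : η / den (fun l => ε ^ (2 * l)) η a (sg σ) ≤ 8 * ε := by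
        rw [div_le_iff₀ hdpos]
        have h4 : 8 * ε * (ε ^ (2 * j) * ((ε ^ j * S / 2) / 4)) ≤ 8 * ε * den (fun l => ε ^ (2 * l)) η a (sg σ) := by
          refine mul_le_mul_of_nonneg_left (le_trans ?_ h1) (by positivity)
          gcongr
        refine le_trans ?_ h4
        have h5 : ε ^ (3 * d + 1) ≤ ε ^ (3 * j + 1) := pow_le_pow_of_le_one hε.le (by linarith) (by omega)
        have h6 : 8 * ε * (ε ^ (2 * j) * ((ε ^ j * S / 2) / 4)) = ε ^ (3 * j + 1) * S := by
          rw [show 3 * j + 1 = 1 + 2 * j + j by ring, pow_add, pow_add]; ring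
        rw [h6, hη]; gcongr
      linarith
    · push Not at hc
      have h1 : η / den (fun l => ε ^ (2 * l)) η a (sg σ) ≤ 1 := by rw [div_le_one hdpos]; exact hdenη
      have h2 : 1 ≤ 4 / Wl a j * S' σ := by
        rw [div_mul_eq_mul_div, le_div_iff₀ hWpos]; linarith
      linarith
  refine (Ex_mono pt).trans ?_
  rw [Ex_add, Ex_mul_left, Ex_const]
  have h1 : 4 / Wl a j * Ex S' ≤ 8 * 2 ^ d * ε := by
    rw [div_mul_eq_mul_div, div_le_iff₀ hWpos]
    have h2 : 8 * 2 ^ d * ε * (ε ^ j * S / 2) ≤ 8 * 2 ^ d * ε * Wl a j := by gcongr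
    refine le_trans ?_ h2
    calc 4 * Ex S' ≤ 4 * (2 ^ d * (ε ^ (j + 1) * S)) := by gcongr
      _ = _ := by rw [pow_succ]; ring
  linarith
end low

section outer
variable {V : Type} [Fintype V] [DecidableEq V]

lemma Ul_zero (a : Finset V → ℝ) (x : V → ℝ) : Ul a 0 x = ev a x ^ 2 := by
  unfold Ul
  simp only [card_eq_zero]
  rw [sum_ite_eq']; simp [der_empty]

lemma Ul_one (a : Finset V → ℝ) (x : V → ℝ) : Ul a 1 x = ∑ i, (2 - x i ^ 2) * ev (D i a) x ^ 2 := by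
  unfold Ul
  rw [← sum_filter]
  have : univ.filter (fun I : Finset V => I.card = 1) = (univ : Finset V).powersetCard 1 := by
    ext I; simp [mem_powersetCard]
  rw [this, powersetCard_one, sum_map]
  apply sum_congr rfl; intro i _
  have : D i a = der {i} a := by
    rw [← der_empty a, D_der (notMem_empty i), der_empty]; rfl
  simp [this]

lemma den_eq {a : Finset V → ℝ} {J : Finset V} {d : ℕ} (h : Deg a J d) (ε η : ℝ) (x : V → ℝ) :
    den (fun l => ε ^ (2 * l)) η a x = η + ∑ l ∈ range (d + 2), ε ^ (2 * l) * Ul a l x := by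
  unfold den Ul
  congr 1
  simp only [mul_sum]
  rw [sum_comm]
  apply sum_congr rfl; intro I _
  by_cases hI : d < I.card
  · rw [h.der_zero hI, ev_zero]; simp
  · simp only [mul_ite, mul_zero]
    rw [sum_ite_eq, if_pos (by simp; omega)]
    rfl

set_option maxHeartbeats 1600000 in
/-- the outer estimate -/
lemma outer (d : ℕ) : ∃ C : ℝ, 0 < C ∧ ∀ (V : Type) [Fintype V] [DecidableEq V] (a : Finset V → ℝ) (J : Finset V),
    Deg a J d → 0 < sq a → ∀ ε : ℝ, 0 < ε → ε ≤ 1 / 2 →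
    Ex (fun σ : V → Bool => ε ^ 2 * (∑ i, ev (D i a) (sg σ) ^ 2) /
      (ev a (sg σ) ^ 2 + ε ^ 2 * (∑ i, ev (D i a) (sg σ) ^ 2))) ≤
      C * (ε + (∑ i, sq (D i a) ^ 2) / (ε ^ (6 * d + 2) * sq a ^ 2)) := by
  choose C hC hk using kane_arc
  refine ⟨(∑ l ∈ range (d + 1), C l d) + (8 * 2 ^ d + 8) + 2 * (4096 * 144 ^ d), ?_, ?_⟩
  · have : 0 ≤ ∑ l ∈ range (d + 1), C l d := sum_nonneg fun l _ => (hC l d).le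
    positivity
  intro V _ _ a J h hS ε hε hε1
  set S := sq a with hSd
  set η := ε ^ (3 * d + 1) * S with hη
  have hη0 : 0 < η := by positivity
  set w : ℕ → ℝ := fun l => ε ^ (2 * l) with hw
  have hw0 : ∀ l, 0 ≤ w l := fun l => by positivity
  have hw1 : ∀ l, w l ≤ 1 := fun l => pow_le_one₀ hε.le (by linarith)
  have hwz : w 0 = 1 := by simp [hw]
  set N' := ⌈1 / ε⌉₊ + 1 with hN'
  set N := 4 * N' with hN
  haveI : NeZero N := ⟨by omega⟩
  have hεN : 1 ≤ ε * N := by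
    have h1 : 1 / ε ≤ N := by
      refine (Nat.le_ceil _).trans ?_
      exact_mod_cast (by omega : ⌈1 / ε⌉₊ ≤ N)
    rw [div_le_iff₀ hε] at h1; linarith
  set err := 4096 * 144 ^ d / η ^ 2 * ∑ i, sq (D i a) ^ 2 with herr
  have hden : ∀ x : V → ℝ, (∀ i, x i ^ 2 ≤ 2) → η + ev a x ^ 2 ≤ den w η a x := fun x hx => den_lower hw0 hwz η a hx
  have hdpos : ∀ x : V → ℝ, (∀ i, x i ^ 2 ≤ 2) → 0 < den w η a x := fun x hx => by
    have := hden x hx; nlinarith [sq_nonneg (ev a x)]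
  have L1 := lindeberg (N := N) hN h hw0 hw1 hwz hη0 (fun x => ev a x)
    (fun x hx => by linarith) (fun x hx i => ⟨ev (Z i a) x, ev (D i a) x, fun t => by rw [ev_update]; ring, by linarith, le_refl _⟩)
  have L2 := lindeberg (N := N) hN h hw0 hw1 hwz hη0 (fun x => √η)
    (fun x hx => by rw [Real.sq_sqrt hη0.le]; nlinarith [sq_nonneg (ev a x)])
    (fun x hx i => ⟨√η, 0, fun t => by ring, by rw [Real.sq_sqrt hη0.le]; nlinarith [sq_nonneg (ev (Z i a) x)], by rw [zero_pow two_ne_zero]; exact sq_nonneg _⟩)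
  simp only [Real.sq_sqrt hη0.le] at L2
  have hA2 : ∀ (ω : V → ZMod N) i, AX ω i ^ 2 ≤ 2 := fun ω i => ax_sq_le _
  -- step 1
  have s1 : Ex (fun σ : V → Bool => ε ^ 2 * (∑ i, ev (D i a) (sg σ) ^ 2) /
      (ev a (sg σ) ^ 2 + ε ^ 2 * (∑ i, ev (D i a) (sg σ) ^ 2))) ≤ 1 - Ex (fun σ : V → Bool => ev a (sg σ) ^ 2 / den w η a (sg σ)) := by
    have : (1:ℝ) = Ex (fun σ : V → Bool => (1:ℝ)) := (Ex_const 1).symm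
    rw [this, ← Ex_sub]
    apply Ex_mono; intro σ
    set G := ∑ i, ev (D i a) (sg σ) ^ 2 with hG
    have hG0 : 0 ≤ G := sum_nonneg fun _ _ => sq_nonneg _
    set Q := ev a (sg σ) ^ 2 with hQ
    have hQ0 : 0 ≤ Q := sq_nonneg _
    have hlow : Q + ε ^ 2 * G ≤ den w η a (sg σ) := by
      rw [hw, den_eq h, sum_range_succ', sum_range_succ']
      have e1 : Ul a (0 + 1) (sg σ) = G := by
        rw [zero_add, Ul_one]; apply sum_congr rfl; intro i _; simp only [sg, bs_sq]; norm_num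
      rw [e1, Ul_zero, ← hQ]
      have : 0 ≤ ∑ k ∈ range d, ε ^ (2 * (k + 1 + 1)) * Ul a (k + 1 + 1) (sg σ) :=
        sum_nonneg fun l _ => mul_nonneg (by positivity) (Ul_nonneg a _ (fun i => by linarith [sg_sq_le σ i]))
      have e2 : ε ^ (2 * (0 + 1)) = ε ^ 2 := by norm_num
      rw [e2]; simp; linarith
    have hd := hdpos _ (sg_sq_le σ)
    rcases (by positivity : 0 ≤ Q + ε ^ 2 * G).eq_or_lt with h0 | h0
    · rw [← h0, div_zero]
      have : Q = 0 := by linarith [mul_nonneg (sq_nonneg ε) hG0]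
      rw [this]; simp
    · have h1 : Q / den w η a (sg σ) ≤ Q / (Q + ε ^ 2 * G) := by gcongr
      have h2 : ε ^ 2 * G / (Q + ε ^ 2 * G) = 1 - Q / (Q + ε ^ 2 * G) := by field_simp; ring
      rw [h2]; linarith
  -- step 2
  have s2 : 1 - Ex (fun ω : V → ZMod N => ev a (AX ω) ^ 2 / den w η a (AX ω)) ≤
      Ex (fun ω : V → ZMod N => η / den w η a (AX ω)) + ∑ l ∈ range (d + 1), C l d * ε := by
    have : (1:ℝ) = Ex (fun ω : V → ZMod N => (1:ℝ)) := (Ex_const 1).symm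
    rw [this, ← Ex_sub]
    refine le_trans ?_ (add_le_add_right (sum_le_sum fun l _ => hk l d V N a J h ε hε (by linarith) hεN) _)
    rw [← Ex_sum, ← Ex_add]
    apply Ex_mono; intro ω
    have hd := hdpos _ (hA2 ω)
    have hU : ∀ l, 0 ≤ Ul a l (AX ω) := fun l => Ul_nonneg a l (fun i => by linarith [hA2 ω i])
    have e1 : (1:ℝ) = den w η a (AX ω) / den w η a (AX ω) := (div_self hd.ne').symm
    rw [e1, ← sub_div]
    have e2 : den w η a (AX ω) - ev a (AX ω) ^ 2 = η + ∑ l ∈ range (d + 1), ε ^ (2 * (l + 1)) * Ul a (l + 1) (AX ω) := by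
      rw [hw, den_eq h, sum_range_succ', Ul_zero]; simp; ring
    rw [e2, add_div, sum_div]
    refine add_le_add (le_refl _) (sum_le_sum fun l hl => ?_)
    have hUl := hU l
    have hUl1 := hU (l + 1)
    have hle : ε ^ (2 * l) * Ul a l (AX ω) + ε ^ (2 * (l + 1)) * Ul a (l + 1) (AX ω) ≤ den w η a (AX ω) := by
      rw [hw, den_eq h]
      have hl' : l < d + 1 := mem_range.1 hl
      have : ∑ m ∈ ({l, l + 1} : Finset ℕ), ε ^ (2 * m) * Ul a m (AX ω) ≤ ∑ m ∈ range (d + 2), ε ^ (2 * m) * Ul a m (AX ω) := by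
        apply sum_le_sum_of_subset_of_nonneg
        · intro m hm; simp at hm; simp; omega
        · intro m _ _; exact mul_nonneg (by positivity) (hU m)
      rw [sum_pair (by omega)] at this
      linarith
    rcases hUl1.eq_or_lt with h0 | h0
    · rw [← h0]; simp
    · have hpos : 0 < ε ^ (2 * l) * Ul a l (AX ω) + ε ^ (2 * (l + 1)) * Ul a (l + 1) (AX ω) := by positivity
      calc _ ≤ ε ^ (2 * (l + 1)) * Ul a (l + 1) (AX ω) / (ε ^ (2 * l) * Ul a l (AX ω) + ε ^ (2 * (l + 1)) * Ul a (l + 1) (AX ω)) := by gcongr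
        _ = _ := by
          have e3 : ε ^ (2 * (l + 1)) = ε ^ (2 * l) * ε ^ 2 := by rw [← pow_add]; ring_nf
          rw [e3, mul_assoc, ← mul_add, mul_div_mul_left _ _ (by positivity)]
  have s3 := den_low h hS hε hε1
  have a1 := (abs_le.1 L1).2
  have a2 := (abs_le.1 L2).2
  have herr2 : err = 4096 * 144 ^ d * ((∑ i, sq (D i a) ^ 2) / (ε ^ (6 * d + 2) * S ^ 2)) := by
    rw [herr, hη, mul_pow, ← pow_mul, show (3 * d + 1) * 2 = 6 * d + 2 by ring]; ring
  rw [← herr] at a1 a2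
  set R := (∑ i, sq (D i a) ^ 2) / (ε ^ (6 * d + 2) * S ^ 2) with hR
  have hR0 : 0 ≤ R := by
    rw [hR]; have : 0 ≤ ∑ i, sq (D i a) ^ 2 := sum_nonneg fun _ _ => sq_nonneg _
    positivity
  rw [← sum_mul] at s2
  have hCs : 0 ≤ ∑ l ∈ range (d + 1), C l d := sum_nonneg fun l _ => (hC l d).le
  set Cs := ∑ l ∈ range (d + 1), C l d with hCsd
  have tot : Ex (fun σ : V → Bool => ε ^ 2 * (∑ i, ev (D i a) (sg σ) ^ 2) /
      (ev a (sg σ) ^ 2 + ε ^ 2 * (∑ i, ev (D i a) (sg σ) ^ 2))) ≤ Cs * ε + (8 * 2 ^ d + 8) * ε + 2 * err := by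
    linarith [s1, s2, s3, a1, a2]
  refine tot.trans ?_
  rw [herr2]
  have p1 : 0 ≤ Cs * R := by positivity
  have p2 : (0:ℝ) ≤ (8 * 2 ^ d + 8) * R := by positivity
  have p3 : (0:ℝ) ≤ 2 * (4096 * 144 ^ d) * ε := by positivity
  linear_combination p1 + p2 + p3
end outer
end EdgeStat

namespace EdgeStat
set_option linter.all false

section sens
variable {V : Type} [Fintype V] [DecidableEq V]

/-- average sensitivity of the zero set -/
noncomputable def asn (a : Finset V → ℝ) : ℝ :=
  ∑ i, Ex (fun σ : V → Bool => ind (ev a (sg σ) = 0 ∧ ev (D i a) (sg σ) ≠ 0))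

lemma asn_nonneg (a : Finset V → ℝ) : 0 ≤ asn a :=
  sum_nonneg fun _ _ => Ex_nonneg fun _ => ind_nonneg _

lemma asn_term_zero {a : Finset V → ℝ} {i : V} (h : D i a = fun _ => 0) :
    Ex (fun σ : V → Bool => ind (ev a (sg σ) = 0 ∧ ev (D i a) (sg σ) ≠ 0)) = 0 := by
  have : ∀ σ : V → Bool, ind (ev a (sg σ) = 0 ∧ ev (D i a) (sg σ) ≠ 0) = 0 := by
    intro σ
    rw [ind_false]; rintro ⟨_, h2⟩
    rw [h, ev_zero] at h2; exact h2 rfl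
  simp only [this, Ex_zero]

lemma asn_le_prob {a : Finset V → ℝ} {J : Finset V} {d : ℕ} (h : Deg a J d) :
    asn a ≤ (#J : ℝ) * Ex (fun σ : V → Bool => ind (ev a (sg σ) = 0)) := by
  have h1 : ∀ i, Ex (fun σ : V → Bool => ind (ev a (sg σ) = 0 ∧ ev (D i a) (sg σ) ≠ 0))
      ≤ if i ∈ J then Ex (fun σ : V → Bool => ind (ev a (sg σ) = 0)) else 0 := by
    intro i
    by_cases hi : i ∈ J
    · rw [if_pos hi]; exact Ex_mono fun σ => ind_mono And.left
    · rw [if_neg hi, asn_term_zero (h.D_out hi)]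
  refine (sum_le_sum fun i _ => h1 i).trans ?_
  rw [sum_ite_mem, univ_inter, sum_const, nsmul_eq_mul]

lemma asn_le_card {a : Finset V → ℝ} {J : Finset V} {d : ℕ} (h : Deg a J d) : asn a ≤ (#J : ℝ) := by
  refine (asn_le_prob h).trans ?_
  have := Ex_le_const (f := fun σ : V → Bool => ind (ev a (sg σ) = 0)) (c := 1) fun _ => ind_le_one _
  nlinarith [Nat.cast_nonneg (α := ℝ) (#J)]

lemma asn_zero_of {a : Finset V → ℝ} (h : ∀ i, D i a = fun _ => 0) : asn a = 0 := by
  unfold asn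
  exact sum_eq_zero fun i _ => asn_term_zero (h i)

lemma asn_rest (a : Finset V → ℝ) (B : Finset V) :
    ∑ i ∈ B, Ex (fun σ : V → Bool => ind (ev a (sg σ) = 0 ∧ ev (D i a) (sg σ) ≠ 0))
      = Ex (fun ρ : V → Bool => asn (rest a B (sg ρ))) := by
  unfold asn
  rw [Ex_sum, ← sum_subset (subset_univ B)]
  · apply sum_congr rfl; intro i hi
    rw [← Ex_piecewise B]
    simp only [sg_piecewise, ev_rest, ev_D_rest hi]
  · intro i _ hi
    simp only [fun ρ : V → Bool => asn_term_zero (ev_D_rest_out hi a (sg ρ)), Ex_zero]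

lemma frac_tangent {q t t0 : ℝ} (hq : 0 ≤ q) (ht : 0 ≤ t) (ht0 : 0 ≤ t0) (h : 0 < q + t0) :
    t / (q + t) ≤ t0 / (q + t0) + q * (t - t0) / (q + t0) ^ 2 := by
  rcases eq_or_lt_of_le (add_nonneg hq ht) with h0 | h0
  · have h1 : q = 0 := by linarith
    subst h1
    have h2 : t = 0 := by linarith
    subst h2; simp; positivity
  · have e : t0 / (q + t0) + q * (t - t0) / (q + t0) ^ 2 - t / (q + t)
        = q * (t - t0) ^ 2 / ((q + t0) ^ 2 * (q + t)) := by
      field_simp; ring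
    have : 0 ≤ q * (t - t0) ^ 2 / ((q + t0) ^ 2 * (q + t)) := by positivity
    linarith

lemma frac_jensen {n : ℕ} (hn : 0 < n) {q : ℝ} (hq : 0 ≤ q) (t : Fin n → ℝ) (ht : ∀ b, 0 ≤ t b) {t0 : ℝ}
    (h : ∑ b, t b = n * t0) : ∑ b, t b / (q + t b) ≤ n * (t0 / (q + t0)) := by
  have hn' : (0:ℝ) < n := by exact_mod_cast hn
  have ht0 : 0 ≤ t0 := by
    have : 0 ≤ ∑ b, t b := sum_nonneg fun b _ => ht b
    rw [h] at this; exact nonneg_of_mul_nonneg_right this hn'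
  rcases eq_or_lt_of_le (add_nonneg hq ht0) with h0 | h0
  · have h1 : t0 = 0 := by linarith
    rw [h1, mul_zero] at h
    have h2 : ∀ b, t b = 0 := fun b => (sum_eq_zero_iff_of_nonneg (fun b _ => ht b)).mp h b (mem_univ b)
    simp [h2, h1]
  · refine (sum_le_sum fun b _ => frac_tangent hq (ht b) ht0 h0).trans ?_
    have e : ∀ x, q * (t x - t0) / (q + t0) ^ 2 = (q / (q + t0) ^ 2) * (t x - t0) := fun x => by ring
    simp only [e]
    rw [sum_add_distrib, ← mul_sum, sum_sub_distrib, h]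
    simp

lemma sq_le_g {a : Finset V → ℝ} : sq a ≤ a ∅ ^ 2 + ∑ i, sq (D i a) := by
  simp only [sq_D]
  rw [sum_comm]; unfold sq
  rw [← add_sum_erase univ _ (mem_univ (∅ : Finset V))]
  gcongr
  rw [← add_sum_erase univ (fun I => ∑ i, if i ∈ I then a I ^ 2 else 0) (mem_univ (∅ : Finset V))]
  have : ∑ I ∈ univ.erase (∅ : Finset V), a I ^ 2 ≤ ∑ I ∈ univ.erase (∅ : Finset V), ∑ i, if i ∈ I then a I ^ 2 else 0 := by
    apply sum_le_sum; intro I hI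
    obtain ⟨i, hi⟩ := nonempty_iff_ne_empty.mpr (ne_of_mem_erase hI)
    refine le_trans ?_ (single_le_sum (f := fun i => if i ∈ I then a I ^ 2 else 0) ?_ (mem_univ i))
    · simp [hi]
    · intro j _; split_ifs <;> positivity
  simpa using this

lemma noncrit (q d : ℕ) : ∃ C : ℝ, 0 < C ∧ ∀ (V : Type) [Fintype V] [DecidableEq V] (a : Finset V → ℝ) (J : Finset V),
    Deg a J d → ∀ Λ : ℝ, 0 < Λ → 0 < ∑ i, sq (D i a) → Λ * ∑ i, sq (D i a) ≤ a ∅ ^ 2 →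
    asn a ≤ (#J : ℝ) * (C / Λ ^ (2 ^ q)) := by
  obtain ⟨C, hC, hm⟩ := high_moment q d
  refine ⟨C, hC, ?_⟩
  intro V _ _ a J h Λ hΛ hg hμ
  refine (asn_le_prob h).trans ?_
  gcongr
  set g := ∑ i, sq (D i a) with hgdef
  let b : Finset V → ℝ := fun I => if I = ∅ then 0 else a I
  have hb : Deg b univ d := by
    intro I hI
    refine ⟨subset_univ _, (h I ?_).2⟩
    intro h0; apply hI; simp [b, h0]
  have hsq : sq b ≤ g := by
    have h1 : sq a = a ∅ ^ 2 + sq b := by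
      unfold sq
      rw [← add_sum_erase univ _ (mem_univ (∅ : Finset V)), ← add_sum_erase univ (fun I => b I ^ 2) (mem_univ (∅ : Finset V))]
      have : ∑ I ∈ univ.erase (∅ : Finset V), a I ^ 2 = ∑ I ∈ univ.erase (∅ : Finset V), b I ^ 2 := by
        apply sum_congr rfl; intro I hI
        simp [b, ne_of_mem_erase hI]
      rw [this]; simp [b]
    have := sq_le_g (a := a)
    linarith
  have hev : ∀ x, ev a x = a ∅ + ev b x := by
    intro x; unfold ev
    rw [← add_sum_erase univ _ (mem_univ (∅ : Finset V)), ← add_sum_erase univ (fun I => b I * mon I x) (mem_univ (∅ : Finset V))]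
    have : ∑ I ∈ univ.erase (∅ : Finset V), a I * mon I x = ∑ I ∈ univ.erase (∅ : Finset V), b I * mon I x := by
      apply sum_congr rfl; intro I hI
      simp [b, ne_of_mem_erase hI]
    rw [this]; simp [b, mon]
  have hpos : 0 < (Λ * g) ^ (2 ^ q) := by positivity
  have h1 : Ex (fun σ : V → Bool => ind (ev a (sg σ) = 0))
      ≤ Ex (fun σ : V → Bool => ind ((Λ * g) ^ (2 ^ q) ≤ ev b (sg σ) ^ (2 ^ (q + 1)))) := by
    apply Ex_mono; intro σ
    apply ind_mono; intro h0
    rw [hev] at h0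
    have : ev b (sg σ) = - a ∅ := by linarith
    rw [this, pow_succ, mul_comm (2 ^ q) 2, pow_mul, neg_sq]
    exact pow_le_pow_left₀ (by positivity) hμ _
  have h2 := markov (f := fun σ : V → Bool => ev b (sg σ) ^ (2 ^ (q + 1))) (fun σ => by
    rw [pow_succ, mul_comm (2 ^ q) 2, pow_mul]; positivity) hpos
  refine h1.trans (h2.trans ?_)
  refine (div_le_div_of_nonneg_right (hm V b hb) hpos.le).trans ?_
  rw [mul_pow, div_le_div_iff₀ (by positivity) (by positivity)]
  have : sq b ^ 2 ^ q ≤ g ^ 2 ^ q := pow_le_pow_left₀ (sq_nonneg' b) hsq _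
  calc C * sq b ^ 2 ^ q * Λ ^ 2 ^ q ≤ C * g ^ 2 ^ q * Λ ^ 2 ^ q := by gcongr
    _ = C * (Λ ^ 2 ^ q * g ^ 2 ^ q) := by ring

lemma crit {a : Finset V → ℝ} {J : Finset V} {d : ℕ} (h : Deg a J d) {Λ : ℝ} (hΛ : 0 < Λ)
    (hg : 0 < ∑ i, sq (D i a)) (hμ : a ∅ ^ 2 ≤ Λ * ∑ i, sq (D i a)) :
    1 ≤ 4 * (4 * 9 ^ d) * Ex (fun σ : V → Bool => (4 * (4 * 9 ^ d) * (Λ + 1)) * (∑ i, ev (D i a) (sg σ) ^ 2)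
      / (ev a (sg σ) ^ 2 + (4 * (4 * 9 ^ d) * (Λ + 1)) * (∑ i, ev (D i a) (sg σ) ^ 2))) := by
  set g := ∑ i, sq (D i a) with hgdef
  set P : ℝ := 4 * 9 ^ d with hP
  have hPpos : 0 < P := by positivity
  set G : (V → Bool) → ℝ := fun σ => ∑ i, ev (D i a) (sg σ) ^ 2 with hG
  have hG0 : ∀ σ, 0 ≤ G σ := fun σ => sum_nonneg fun _ _ => sq_nonneg _
  have hEG : Ex G = g := by
    rw [hG, Ex_sum]; simp only [sg2]; rfl
  have hEG2 : Ex (fun σ => G σ ^ 2) ≤ 9 ^ d * (Ex G) ^ 2 := by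
    have := moment_vec (good_sign (V := V)) univ (fun _ => 1) (by simp) (fun i => D i a) (J := J) (d := d)
      (fun i _ => (h.D i).mono (erase_subset _ _) (Nat.sub_le _ _))
    simp only [one_mul] at this
    rw [hEG]; exact this
  have h1 := pz hG0 (by positivity : (0:ℝ) < 9 ^ d) hEG2 (by rw [hEG]; exact hg)
  rw [hEG, ← hP] at h1
  have h2 := markov (f := fun σ : V → Bool => ev a (sg σ) ^ 2) (fun σ => sq_nonneg _)
    (t := 2 * P * (Λ + 1) * g) (by positivity)
  rw [sg2] at h2
  have hsq : sq a ≤ (Λ + 1) * g := by have := sq_le_g (a := a); linarith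
  have h3 : sq a / (2 * P * (Λ + 1) * g) ≤ 1 / (2 * P) := by
    rw [div_le_div_iff₀ (by positivity) (by positivity)]
    nlinarith
  have h4 : ∀ σ : V → Bool, (1/2) * (ind (g / 2 ≤ G σ) - ind (2 * P * (Λ + 1) * g ≤ ev a (sg σ) ^ 2))
      ≤ 4 * P * (Λ + 1) * G σ / (ev a (sg σ) ^ 2 + 4 * P * (Λ + 1) * G σ) := by
    intro σ
    have hnn : 0 ≤ 4 * P * (Λ + 1) * G σ / (ev a (sg σ) ^ 2 + 4 * P * (Λ + 1) * G σ) := by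
      have := hG0 σ; positivity
    by_cases c1 : g / 2 ≤ G σ
    · by_cases c2 : 2 * P * (Λ + 1) * g ≤ ev a (sg σ) ^ 2
      · rw [ind_true c1, ind_true c2]; simpa using hnn
      · rw [ind_true c1, ind_false c2]
        push Not at c2
        have hGp : 0 < G σ := by linarith
        have h5 : ev a (sg σ) ^ 2 ≤ 4 * P * (Λ + 1) * G σ := by
          have : 2 * P * (Λ + 1) * g ≤ 2 * P * (Λ + 1) * (2 * G σ) := by gcongr; linarith
          linarith
        rw [le_div_iff₀ (by positivity)]
        linarith
    · rw [ind_false c1]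
      have := ind_nonneg (2 * P * (Λ + 1) * g ≤ ev a (sg σ) ^ 2)
      linarith
  have h5 := Ex_mono h4
  rw [Ex_mul_left, Ex_sub] at h5
  have h6 : 1 / (2 * P) = (1 / P) / 2 := by field_simp
  have h7 : (1 / P) / 4 ≤ Ex (fun σ => 4 * P * (Λ + 1) * G σ / (ev a (sg σ) ^ 2 + 4 * P * (Λ + 1) * G σ)) := by
    linarith
  have h8 : 4 * P * ((1 / P) / 4) = 1 := by field_simp
  calc (1:ℝ) = 4 * P * ((1 / P) / 4) := h8.symm
    _ ≤ _ := by gcongr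

/-- pointwise block estimate -/
lemma block_point (q d : ℕ) : ∃ C : ℝ, 0 < C ∧ ∀ (V : Type) [Fintype V] [DecidableEq V] (a : Finset V → ℝ) (J : Finset V),
    Deg a J d → ∀ Λ B : ℝ, 0 < Λ → asn a ≤ B →
    asn a ≤ B * (4 * (4 * 9 ^ d) * Ex (fun σ : V → Bool => (4 * (4 * 9 ^ d) * (Λ + 1)) * (∑ i, ev (D i a) (sg σ) ^ 2)
      / (ev a (sg σ) ^ 2 + (4 * (4 * 9 ^ d) * (Λ + 1)) * (∑ i, ev (D i a) (sg σ) ^ 2)))) +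
      (#J : ℝ) * (C / Λ ^ (2 ^ q)) := by
  obtain ⟨C, hC, hm⟩ := noncrit q d
  refine ⟨C, hC, ?_⟩
  intro V _ _ a J h Λ B hΛ hB
  have hB0 : 0 ≤ B := (asn_nonneg a).trans hB
  set Y := 4 * (4 * 9 ^ d) * Ex (fun σ : V → Bool => (4 * (4 * 9 ^ d) * (Λ + 1)) * (∑ i, ev (D i a) (sg σ) ^ 2)
      / (ev a (sg σ) ^ 2 + (4 * (4 * 9 ^ d) * (Λ + 1)) * (∑ i, ev (D i a) (sg σ) ^ 2))) with hY
  have hY0 : 0 ≤ Y := by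
    apply mul_nonneg (by positivity)
    apply Ex_nonneg; intro σ
    have : 0 ≤ ∑ i, ev (D i a) (sg σ) ^ 2 := sum_nonneg fun _ _ => sq_nonneg _
    positivity
  have ht0 : 0 ≤ (#J : ℝ) * (C / Λ ^ (2 ^ q)) := by positivity
  have hg0 : 0 ≤ ∑ i, sq (D i a) := sum_nonneg fun _ _ => sq_nonneg' _
  rcases eq_or_lt_of_le hg0 with hg | hg
  · have : asn a = 0 := by
      apply asn_zero_of; intro i
      apply sq_eq_zero
      exact (sum_eq_zero_iff_of_nonneg (fun i _ => sq_nonneg' _)).mp hg.symm i (mem_univ i)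
    rw [this]; positivity
  · rcases le_total (a ∅ ^ 2) (Λ * ∑ i, sq (D i a)) with hμ | hμ
    · have := crit h hΛ hg hμ
      rw [← hY] at this
      nlinarith
    · have := hm V a J h Λ hΛ hg hμ
      have : 0 ≤ B * Y := by positivity
      linarith

set_option maxHeartbeats 1600000 in
/-- estimate for a polynomial cut into blocks -/
lemma block_sum (q d : ℕ) : ∃ C : ℝ, 0 < C ∧ ∀ (V : Type) [Fintype V] [DecidableEq V] (a : Finset V → ℝ) (J : Finset V),
    Deg a J d → 0 < sq a → ∀ (n : ℕ) (χ : V → Fin n) (Λ B e : ℝ), 0 < n → 0 < Λ → 0 ≤ B → 0 < e → e ≤ 1/2 →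
    (n:ℝ) * e ^ 2 = 4 * (4 * 9 ^ d) * (Λ + 1) →
    (∀ b (z : V → Bool), asn (rest a (univ.filter (fun i => χ i = b)) (sg z)) ≤ B) →
    asn a ≤ B * (C * n * (e + (∑ i, sq (D i a) ^ 2) / (e ^ (6 * d + 2) * sq a ^ 2))) +
      (#J : ℝ) * (C / Λ ^ (2 ^ q)) := by
  obtain ⟨C1, hC1, hm⟩ := block_point q d
  obtain ⟨C2, hC2, ho⟩ := outer d
  refine ⟨C1 + 4 * (4 * 9 ^ d) * C2, by positivity, ?_⟩
  intro V _ _ a J h hsq n χ Λ B e hn hΛ hB he he' hne hblock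
  set Λ' := 4 * (4 * 9 ^ d) * (Λ + 1) with hΛ'
  have hΛ'0 : 0 < Λ' := by positivity
  set F : Fin n → Finset V := fun b => univ.filter (fun i => χ i = b) with hF
  have hn' : (0:ℝ) < n := by exact_mod_cast hn
  -- split
  have e1 : asn a = ∑ b, Ex (fun ρ : V → Bool => asn (rest a (F b) (sg ρ))) := by
    simp only [← asn_rest]
    unfold asn
    rw [← sum_fiberwise univ χ]
  have e2 : ∀ b, Ex (fun ρ : V → Bool => asn (rest a (F b) (sg ρ)))
      ≤ B * (4 * (4 * 9 ^ d) * Ex (fun σ : V → Bool => Λ' * (∑ i ∈ F b, ev (D i a) (sg σ) ^ 2)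
        / (ev a (sg σ) ^ 2 + Λ' * (∑ i ∈ F b, ev (D i a) (sg σ) ^ 2)))) + (#(J ∩ F b) : ℝ) * (C1 / Λ ^ (2 ^ q)) := by
    intro b
    refine (Ex_mono fun ρ => hm V (rest a (F b) (sg ρ)) (J ∩ F b) (h.rest (F b) (sg ρ)) Λ B hΛ (hblock b ρ)).trans ?_
    rw [Ex_add, Ex_mul_left, Ex_mul_left, Ex_const]
    apply le_of_eq
    congr 3
    rw [← Ex_piecewise (F b) (fun σ : V → Bool => Λ' * (∑ i ∈ F b, ev (D i a) (sg σ) ^ 2)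
        / (ev a (sg σ) ^ 2 + Λ' * (∑ i ∈ F b, ev (D i a) (sg σ) ^ 2)))]
    apply Ex_congr; intro ρ
    apply Ex_congr; intro σ
    have : ∑ i, ev (D i (rest a (F b) (sg ρ))) (sg σ) ^ 2
        = ∑ i ∈ F b, ev (D i a) (sg ((F b).piecewise σ ρ)) ^ 2 := by
      rw [← sum_subset (subset_univ (F b))]
      · apply sum_congr rfl; intro i hi
        rw [ev_D_rest hi, sg_piecewise]
      · intro i _ hi
        rw [ev_D_rest_out hi, ev_zero]; simp
    rw [this, ev_rest, sg_piecewise]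
  have e3 : ∑ b, Ex (fun σ : V → Bool => Λ' * (∑ i ∈ F b, ev (D i a) (sg σ) ^ 2)
        / (ev a (sg σ) ^ 2 + Λ' * (∑ i ∈ F b, ev (D i a) (sg σ) ^ 2)))
      ≤ n * Ex (fun σ : V → Bool => e ^ 2 * (∑ i, ev (D i a) (sg σ) ^ 2)
        / (ev a (sg σ) ^ 2 + e ^ 2 * (∑ i, ev (D i a) (sg σ) ^ 2))) := by
    rw [← Ex_sum, ← Ex_mul_left]
    apply Ex_mono; intro σ
    apply frac_jensen hn (sq_nonneg _) (fun b => Λ' * (∑ i ∈ F b, ev (D i a) (sg σ) ^ 2))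
    · intro b
      exact mul_nonneg hΛ'0.le (sum_nonneg fun _ _ => sq_nonneg _)
    · rw [← mul_sum, sum_fiberwise univ χ, ← hne]; ring
  have e4 := ho V a J h hsq e he he'
  have e5 : ∑ b, (#(J ∩ F b) : ℝ) = (#J : ℝ) := by
    have := card_eq_sum_card_fiberwise (f := χ) (s := J) (t := univ) (fun _ _ => mem_univ _)
    rw [this]; push_cast
    apply sum_congr rfl; intro b _
    congr 2
    ext i; simp [F]
  set S := e + (∑ i, sq (D i a) ^ 2) / (e ^ (6 * d + 2) * sq a ^ 2) with hS
  have hS0 : 0 ≤ S := by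
    have : 0 ≤ ∑ i, sq (D i a) ^ 2 := sum_nonneg fun _ _ => sq_nonneg _
    positivity
  calc asn a ≤ ∑ b, (B * (4 * (4 * 9 ^ d) * Ex (fun σ : V → Bool => Λ' * (∑ i ∈ F b, ev (D i a) (sg σ) ^ 2)
        / (ev a (sg σ) ^ 2 + Λ' * (∑ i ∈ F b, ev (D i a) (sg σ) ^ 2)))) + (#(J ∩ F b) : ℝ) * (C1 / Λ ^ (2 ^ q))) := by
        rw [e1]; exact sum_le_sum fun b _ => e2 b
    _ = B * (4 * (4 * 9 ^ d) * ∑ b, Ex (fun σ : V → Bool => Λ' * (∑ i ∈ F b, ev (D i a) (sg σ) ^ 2)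
        / (ev a (sg σ) ^ 2 + Λ' * (∑ i ∈ F b, ev (D i a) (sg σ) ^ 2)))) + (#J : ℝ) * (C1 / Λ ^ (2 ^ q)) := by
        rw [sum_add_distrib, ← mul_sum, ← mul_sum, ← sum_mul, e5]
    _ ≤ B * (4 * (4 * 9 ^ d) * (n * (C2 * S))) + (#J : ℝ) * (C1 / Λ ^ (2 ^ q)) := by
        have := e3.trans (mul_le_mul_of_nonneg_left e4 hn'.le)
        gcongr
    _ ≤ _ := by
        have h1 : C1 ≤ C1 + 4 * (4 * 9 ^ d) * C2 := by
          have : 0 ≤ 4 * (4 * 9 ^ d) * C2 := by positivity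
          linarith
        have h2 : B * (4 * (4 * 9 ^ d) * (n * (C2 * S))) ≤ B * ((C1 + 4 * (4 * 9 ^ d) * C2) * n * S) := by
          have : 0 ≤ C1 * n * S := by positivity
          apply mul_le_mul_of_nonneg_left _ hB
          linarith
        have h3 : (#J : ℝ) * (C1 / Λ ^ (2 ^ q)) ≤ (#J : ℝ) * ((C1 + 4 * (4 * 9 ^ d) * C2) / Λ ^ (2 ^ q)) := by
          gcongr
        linarith

end sens
end EdgeStat

namespace EdgeStat
set_option linter.all false

section sens2
variable {V : Type} [Fintype V] [DecidableEq V]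

set_option maxHeartbeats 1600000 in
/-- one step of the recursion -/
lemma one_step (q d : ℕ) : ∃ C : ℝ, 0 < C ∧ ∀ (V : Type) [Fintype V] [DecidableEq V] (a : Finset V → ℝ) (J : Finset V),
    Deg a J d → ∀ (n : ℕ) (χ : V → Fin n) (Λ B1 B2 e τ t : ℝ), 0 < n → 0 < Λ → 0 ≤ B1 → 0 ≤ B2 → 0 < e → e ≤ 1/2 →
    (n:ℝ) * e ^ 2 = 4 * (4 * 9 ^ d) * (Λ + 1) → 0 < τ →
    (∀ b, (#(J.filter (fun i => χ i = b)) : ℝ) ≤ t) →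
    (∀ (b : Finset V → ℝ) (J' : Finset V), Deg b J' d → #J' < #J → asn b ≤ B1) →
    (∀ (b : Finset V → ℝ) (J' : Finset V), Deg b J' d → (#J' : ℝ) ≤ t → asn b ≤ B2) →
    asn a ≤ d / τ + (1 - 1 / (4 * 9 ^ d)) * B1 + B2 * (C * n * (e + τ / e ^ (6 * d + 2))) +
      (#J : ℝ) * (C / Λ ^ (2 ^ q)) := by
  obtain ⟨C, hC, hm⟩ := block_sum q d
  refine ⟨C * (1 + 4 * 9 ^ d * d), by positivity, ?_⟩
  intro V _ _ a J h n χ Λ B1 B2 e τ t hn hΛ hB1 hB2 he he' hne hτ hχ hI1 hI2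
  have hn' : (0:ℝ) < n := by exact_mod_cast hn
  set N := 6 * d + 2 with hN
  have hc : 1 / (4 * (9:ℝ) ^ d) ≤ 1 := by
    rw [div_le_one (by positivity)]
    have : (1:ℝ) ≤ 9 ^ d := one_le_pow₀ (by norm_num)
    linarith
  rcases eq_or_lt_of_le (sq_nonneg' a) with hs | hs
  · have h0 := sq_eq_zero hs.symm
    have : asn a = 0 := by
      apply asn_zero_of; intro i
      rw [h0]; funext K; simp [D]
    rw [this]
    have : 0 ≤ (1 - 1 / (4 * (9:ℝ) ^ d)) * B1 := mul_nonneg (by linarith) hB1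
    have : 0 ≤ B2 * (C * (1 + 4 * 9 ^ d * d) * n * (e + τ / e ^ N)) := by positivity
    have : 0 ≤ (#J : ℝ) * (C * (1 + 4 * 9 ^ d * d) / Λ ^ (2 ^ q)) := mul_nonneg (Nat.cast_nonneg _) (by clear h0; positivity)
    have : 0 ≤ d / τ := by positivity
    linarith
  set H : Finset V := univ.filter (fun i => τ * sq a ≤ sq (D i a)) with hH
  have hHJ : ∀ i ∈ H, i ∈ J := by
    intro i hi
    by_contra hiJ
    rw [hH, mem_filter, h.D_out hiJ] at hi
    have h1 : sq (fun _ : Finset V => (0:ℝ)) = 0 := by simp [sq]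
    rw [h1] at hi
    have := mul_pos hτ hs
    linarith [hi.2]
  have hHc : (#H : ℝ) ≤ d / τ := by
    rw [le_div_iff₀ hτ]
    have h1 : (#H : ℝ) * (τ * sq a) ≤ ∑ i, sq (D i a) := by
      rw [← nsmul_eq_mul, ← sum_const]
      refine (sum_le_sum fun i hi => (mem_filter.mp hi).2).trans ?_
      exact sum_le_sum_of_subset_of_nonneg (subset_univ _) fun i _ _ => sq_nonneg' _
    have h2 := h1.trans (sum_sq_D_le h)
    have h3 : (#H : ℝ) * τ * sq a ≤ d * sq a := by linarith
    exact le_of_mul_le_mul_right h3 hs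
  set Q : (V → Bool) → Finset V → ℝ := fun ρ => rest a Hᶜ (sg ρ) with hQ
  have hsplit : asn a ≤ (#H : ℝ) + Ex (fun ρ => asn (Q ρ)) := by
    rw [hQ, ← asn_rest]
    unfold asn
    rw [← sum_add_sum_compl H]
    gcongr
    rw [← mul_one (#H : ℝ), ← nsmul_eq_mul, ← sum_const]
    exact sum_le_sum fun i _ => Ex_le_const fun _ => ind_le_one _
  have hQdeg : ∀ ρ, Deg (Q ρ) (J ∩ Hᶜ) d := fun ρ => h.rest _ _
  set T := (#J : ℝ) * (C / Λ ^ (2 ^ q)) with hT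
  have hT0 : 0 ≤ T := by positivity
  have hpt : ∀ ρ, asn (Q ρ) ≤ B1 * ind (¬ (sq a / 2 ≤ sq (Q ρ)))
      + (B2 * (C * n) * (e + (4 / (e ^ N * sq a ^ 2)) * ∑ i, sq (D i (Q ρ)) ^ 2) + T) := by
    intro ρ
    have hsum0 : 0 ≤ ∑ i, sq (D i (Q ρ)) ^ 2 := sum_nonneg fun _ _ => sq_nonneg _
    have hnn : 0 ≤ B2 * (C * n) * (e + (4 / (e ^ N * sq a ^ 2)) * ∑ i, sq (D i (Q ρ)) ^ 2) := by positivity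
    by_cases hc : sq a / 2 ≤ sq (Q ρ)
    · rw [ind_false (not_not.mpr hc), mul_zero, zero_add]
      have hsQ : 0 < sq (Q ρ) := by linarith
      have := hm V (Q ρ) (J ∩ Hᶜ) (hQdeg ρ) hsQ n χ Λ B2 e hn hΛ hB2 he he' hne (by
        intro b z
        apply hI2 _ _ ((hQdeg ρ).rest _ _)
        refine le_trans ?_ (hχ b)
        norm_cast
        apply card_le_card
        intro i hi
        simp only [mem_inter, mem_filter, mem_univ, true_and] at hi ⊢
        exact ⟨hi.1.1, hi.2⟩)
      refine this.trans ?_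
      have k1 : (#(J ∩ Hᶜ) : ℝ) * (C / Λ ^ (2 ^ q)) ≤ T := by
        rw [hT]; gcongr; exact inter_subset_left
      have k2 : (∑ i, sq (D i (Q ρ)) ^ 2) / (e ^ N * sq (Q ρ) ^ 2)
          ≤ (4 / (e ^ N * sq a ^ 2)) * ∑ i, sq (D i (Q ρ)) ^ 2 := by
        rw [div_mul_eq_mul_div, div_le_div_iff₀ (by positivity) (by positivity)]
        have k3 : sq a ^ 2 ≤ 4 * sq (Q ρ) ^ 2 := by
          have := pow_le_pow_left₀ (by positivity) hc 2
          linarith [this]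
        have := mul_le_mul_of_nonneg_left k3 (mul_nonneg hsum0 (pow_nonneg he.le N))
        linarith
      have k4 : B2 * (C * n * (e + (∑ i, sq (D i (Q ρ)) ^ 2) / (e ^ N * sq (Q ρ) ^ 2)))
          ≤ B2 * (C * n) * (e + (4 / (e ^ N * sq a ^ 2)) * ∑ i, sq (D i (Q ρ)) ^ 2) := by
        rw [mul_assoc B2]
        gcongr
      linarith
    · rw [ind_true hc, mul_one]
      have hHn : H.Nonempty := by
        rw [nonempty_iff_ne_empty]; intro hH0
        apply hc
        have : sq (Q ρ) = sq a := by
          rw [hQ]; dsimp only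
          rw [sq_rest, hH0, compl_empty, ← sg2 a]
          apply Ex_congr; intro σ; rw [piecewise_univ]
        rw [this]; linarith
      obtain ⟨i, hi⟩ := hHn
      have : asn (Q ρ) ≤ B1 := by
        apply hI1 _ _ (hQdeg ρ)
        apply card_lt_card
        refine ⟨inter_subset_left, fun hsub => ?_⟩
        have := hsub (hHJ i hi)
        simp [hi] at this
      linarith
  have hEx := Ex_mono hpt
  rw [Ex_add, Ex_mul_left, Ex_add, Ex_mul_left, Ex_add, Ex_mul_left, Ex_const, Ex_const] at hEx
  have hp : Ex (fun ρ => ind (¬ (sq a / 2 ≤ sq (Q ρ)))) ≤ 1 - 1 / (4 * 9 ^ d) := by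
    simp only [ind_not]
    rw [Ex_sub, Ex_const]
    have e1 : Ex (fun ρ => sq (Q ρ)) = sq a := Ex_sq_rest a Hᶜ
    have := pz (f := fun ρ => sq (Q ρ)) (fun ρ => sq_nonneg' _) (C := 9 ^ d) (by positivity)
      (by rw [e1]; exact Ex_sq_rest_sq h _) (by rw [e1]; exact hs)
    rw [e1] at this
    linarith
  have hD : Ex (fun ρ => ∑ i, sq (D i (Q ρ)) ^ 2) ≤ 9 ^ d * (τ * d * sq a ^ 2) := by
    rw [Ex_sum]
    have h1 : ∀ i, Ex (fun ρ => sq (D i (Q ρ)) ^ 2) ≤ 9 ^ d * (τ * sq a * sq (D i a)) := by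
      intro i
      by_cases hi : i ∈ H
      · have : ∀ ρ, sq (D i (Q ρ)) ^ 2 = 0 := by
          intro ρ
          rw [hQ]; dsimp only
          rw [ev_D_rest_out (by simp [hi])]
          simp [sq]
        simp only [this, Ex_zero]
        have := sq_nonneg' (D i a)
        positivity
      · have hi' : i ∈ Hᶜ := by simpa using hi
        have : ∀ ρ, sq (D i (Q ρ)) ^ 2 = sq (rest (D i a) Hᶜ (sg ρ)) ^ 2 := by
          intro ρ; rw [hQ]; dsimp only; rw [sq_D_rest a hi']
        simp only [this]
        refine (Ex_sq_rest_sq ((h.D i).mono (erase_subset _ _) (Nat.sub_le _ _)) Hᶜ).trans ?_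
        have h2 : sq (D i a) ≤ τ * sq a := by
          rw [hH, mem_filter] at hi; push Not at hi
          exact (hi (mem_univ i)).le
        rw [pow_two]
        have := sq_nonneg' (D i a)
        gcongr
    refine (sum_le_sum fun i _ => h1 i).trans ?_
    rw [← mul_sum, ← mul_sum]
    have h2 := sum_sq_D_le h
    calc 9 ^ d * (τ * sq a * ∑ i, sq (D i a)) ≤ 9 ^ d * (τ * sq a * (d * sq a)) := by gcongr
      _ = _ := by ring
  have k1 : B1 * Ex (fun ρ => ind (¬ (sq a / 2 ≤ sq (Q ρ)))) ≤ (1 - 1 / (4 * 9 ^ d)) * B1 := by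
    rw [mul_comm]; gcongr
  have k2 : e + 4 / (e ^ N * sq a ^ 2) * Ex (fun ρ => ∑ i, sq (D i (Q ρ)) ^ 2)
      ≤ (1 + 4 * 9 ^ d * d) * (e + τ / e ^ N) := by
    calc e + 4 / (e ^ N * sq a ^ 2) * Ex (fun ρ => ∑ i, sq (D i (Q ρ)) ^ 2)
        ≤ e + 4 / (e ^ N * sq a ^ 2) * (9 ^ d * (τ * d * sq a ^ 2)) := by gcongr
      _ = e + 4 * 9 ^ d * d * (τ / e ^ N) := by field_simp
      _ ≤ _ := by
          have : 0 ≤ τ / e ^ N := by positivity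
          have : 0 ≤ 4 * 9 ^ d * d * e := by positivity
          linarith
  have k3 : B2 * (C * n) * (e + 4 / (e ^ N * sq a ^ 2) * Ex (fun ρ => ∑ i, sq (D i (Q ρ)) ^ 2))
      ≤ B2 * (C * (1 + 4 * 9 ^ d * d) * n * (e + τ / e ^ N)) := by
    refine (mul_le_mul_of_nonneg_left k2 (by positivity)).trans (le_of_eq ?_)
    ring
  have k4 : T ≤ (#J : ℝ) * (C * (1 + 4 * 9 ^ d * d) / Λ ^ (2 ^ q)) := by
    rw [hT]; gcongr
    have : 0 ≤ C * (4 * 9 ^ d * d) := by positivity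
    linarith
  linarith

/-- balanced colouring -/
lemma coloring (J : Finset V) {n : ℕ} (hn : 0 < n) : ∃ χ : V → Fin n, ∀ b, #(J.filter (fun i => χ i = b)) ≤ #J / n + 1 := by
  let e := J.equivFin
  refine ⟨fun i => if h : i ∈ J then ⟨(e ⟨i, h⟩ : ℕ) % n, Nat.mod_lt _ hn⟩ else ⟨0, hn⟩, ?_⟩
  intro b
  rw [← card_range (#J / n + 1)]
  apply card_le_card_of_injOn (fun i => if h : i ∈ J then (e ⟨i, h⟩ : ℕ) / n else 0)
  · intro i hi
    simp only [coe_filter, Set.mem_setOf_eq] at hi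
    have hiJ := hi.1
    simp only [hiJ, dif_pos, coe_range, Set.mem_Iio]
    have := (e ⟨i, hiJ⟩).2
    have h2 : (e ⟨i, hiJ⟩ : ℕ) / n ≤ #J / n := Nat.div_le_div_right this.le
    omega
  · intro i hi j hj hij
    simp only [coe_filter, Set.mem_setOf_eq] at hi hj
    have hiJ := hi.1
    have hjJ := hj.1
    have h1 := hi.2.trans hj.2.symm
    simp only [hiJ, hjJ, dif_pos, Fin.mk.injEq] at h1 hij
    have h2 : (e ⟨i, hiJ⟩ : ℕ) = e ⟨j, hjJ⟩ := by
      rw [← Nat.div_add_mod (e ⟨i, hiJ⟩ : ℕ) n, ← Nat.div_add_mod (e ⟨j, hjJ⟩ : ℕ) n, h1, hij]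
    have h3 := e.injective (Fin.ext h2)
    simpa using h3

lemma exists_root (E : ℕ) (hE : 0 < E) (M : ℕ) : ∃ n : ℕ, n ^ E ≤ M ∧ M < (n + 1) ^ E := by
  have hex : ∃ n : ℕ, M < (n + 1) ^ E := ⟨M, by
    calc M < M + 1 := Nat.lt_succ_self M
      _ ≤ (M + 1) ^ E := Nat.le_self_pow hE.ne' _⟩
  refine ⟨Nat.find hex, ?_, Nat.find_spec hex⟩
  rcases Nat.eq_zero_or_pos (Nat.find hex) with h | h
  · rw [h, zero_pow hE.ne']; exact Nat.zero_le _
  · obtain ⟨m, hm⟩ := Nat.exists_eq_succ_of_ne_zero h.ne'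
    have := Nat.find_min hex (m := m) (by omega)
    rw [hm]; exact not_lt.mp this

end sens2
end EdgeStat

namespace EdgeStat
set_option linter.all false

lemma lsq {a b : ℝ} (h : a ^ 2 ≤ b ^ 2) (hb : 0 ≤ b) : a ≤ b := by
  nlinarith

/-- arithmetic of the main term -/
lemma main_arith {x y u e A S φ K C c B τ : ℝ} {N : ℕ} (hx : 1 ≤ x) (hu : 0 < u) (hux : u ^ 2 = x) (hy : 1 ≤ y) (hA : 1 ≤ A)
    (hS : 0 < S) (hS2 : S ^ 2 = 2 * A) (he : 0 < e) (hxe : x * e ^ 2 = A * (y ^ 2 + 1)) (hφ : 0 ≤ φ) (hK : 0 ≤ K) (hC : 0 < C)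
    (hB : B ≤ K * (2 * φ / (u * y ^ 2))) (hτ : τ = 1 / x ^ (N + 1)) (hc : 16 * C * S ≤ c * y) :
    B * (C * x * (e + τ / e ^ N)) ≤ c / 4 * (K * φ) := by
  have hx0 : 0 < x := by linarith
  have hy0 : 0 < y := by linarith
  have h1 : u * e ≤ S * y := by
    have : (u * e) ^ 2 ≤ (S * y) ^ 2 := by
      rw [mul_pow, mul_pow, hux, hxe, hS2]
      have h3 : 1 ≤ y ^ 2 := one_le_pow₀ hy
      nlinarith [mul_le_mul_of_nonneg_left h3 (by linarith : 0 ≤ A)]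
    exact lsq this (by positivity)
  have h2 : 1 / x ≤ e := by
    have : (1 / x) ^ 2 ≤ e ^ 2 := by
      rw [div_pow, div_le_iff₀ (by positivity), one_pow]
      have : 1 ≤ x * e ^ 2 := by rw [hxe]; nlinarith
      nlinarith
    exact lsq this he.le
  have h3 : τ / e ^ N ≤ e := by
    rw [div_le_iff₀ (by positivity), ← pow_succ', hτ, ← one_div_pow]
    exact pow_le_pow_left₀ (by positivity) h2 _
  have h0 : 0 ≤ τ / e ^ N := by rw [hτ]; positivity
  calc B * (C * x * (e + τ / e ^ N)) ≤ (K * (2 * φ / (u * y ^ 2))) * (C * x * (e + e)) := by gcongr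
    _ = K * φ * (4 * C) * (u * e) / y ^ 2 := by rw [← hux]; field_simp; ring
    _ ≤ K * φ * (4 * C) * (S * y) / y ^ 2 := by gcongr
    _ = K * φ * ((16 * C * S) / y / 4) := by field_simp; ring
    _ ≤ K * φ * ((c * y) / y / 4) := by gcongr
    _ = _ := by field_simp

set_option maxHeartbeats 1600000 in
/-- average sensitivity of zero sets -/
theorem sens_main (d : ℕ) (ε : ℝ) (hε : 0 < ε) (hε1 : ε ≤ 1 / 2) : ∃ K : ℝ, 0 < K ∧
    ∀ (V : Type) [Fintype V] [DecidableEq V] (a : Finset V → ℝ) (J : Finset V), Deg a J d →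
      asn a ≤ K * (#J : ℝ) ^ (1 / 2 + ε) := by
  set N := 6 * d + 2 with hN
  set E := 2 * (N + 1) with hE
  obtain ⟨q, hq⟩ : ∃ q : ℕ, (E : ℝ) ≤ ε * 2 ^ q := by
    obtain ⟨q, hq⟩ := pow_unbounded_of_one_lt ((E : ℝ) / ε) (by norm_num : (1:ℝ) < 2)
    refine ⟨q, ?_⟩
    rw [div_lt_iff₀ hε] at hq; linarith
  obtain ⟨C, hC, hstep⟩ := one_step q d
  set A : ℝ := 4 * (4 * 9 ^ d) with hA
  have hA1 : 1 ≤ A := by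
    have : (1:ℝ) ≤ 9 ^ d := one_le_pow₀ (by norm_num)
    linarith
  set S := √(2 * A) with hS
  have hS0 : 0 < S := Real.sqrt_pos.mpr (by linarith)
  have hS2 : S ^ 2 = 2 * A := Real.sq_sqrt (by linarith)
  set c : ℝ := 1 / (4 * 9 ^ d) with hc
  have hc0 : 0 < c := by positivity
  obtain ⟨n0, hn0, hn01, hn02⟩ : ∃ n0 : ℕ, 3 ≤ n0 ∧ (∀ n : ℕ, n0 ≤ n → 8 * A ≤ (n:ℝ) ^ (1 - ε)) ∧
      (∀ n : ℕ, n0 ≤ n → 16 * C * S / c ≤ (n:ℝ) ^ (ε / 2)) := by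
    have t1 := (tendsto_rpow_atTop (by linarith : 0 < 1 - ε)).comp (tendsto_natCast_atTop_atTop (R := ℝ))
    have t2 := (tendsto_rpow_atTop (by linarith : 0 < ε / 2)).comp (tendsto_natCast_atTop_atTop (R := ℝ))
    obtain ⟨m1, h1⟩ := Filter.eventually_atTop.mp (t1.eventually_ge_atTop (8 * A))
    obtain ⟨m2, h2⟩ := Filter.eventually_atTop.mp (t2.eventually_ge_atTop (16 * C * S / c))
    exact ⟨max 3 (max m1 m2), le_max_left _ _, fun n hn => h1 n (by omega), fun n hn => h2 n (by omega)⟩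
  set K : ℝ := n0 ^ E + 4 * d / c + 4 * (C * 2 ^ E) / c with hK
  have hK0 : 0 < K := by
    have : (0:ℝ) < n0 := by exact_mod_cast (by omega : 0 < n0)
    positivity
  refine ⟨K, hK0, ?_⟩
  intro V _ _
  have main : ∀ M : ℕ, ∀ (a : Finset V → ℝ) (J : Finset V), #J = M → Deg a J d → asn a ≤ K * (M : ℝ) ^ (1 / 2 + ε) := by
    intro M
    induction M using Nat.strong_induction_on with
    | _ M ih =>
    intro a J hJ h
    rcases Nat.eq_zero_or_pos M with hM | hM
    · have := asn_le_card h
      rw [hJ, hM] at this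
      refine this.trans ?_
      simp only [Nat.cast_zero]
      positivity
    have hM1 : (1:ℝ) ≤ M := by exact_mod_cast hM
    have hφ1 : 1 ≤ (M:ℝ) ^ (1 / 2 + ε) := Real.one_le_rpow hM1 (by linarith)
    set φ := (M:ℝ) ^ (1 / 2 + ε) with hφ
    obtain ⟨n, hnl, hnu⟩ := exists_root E (by omega) M
    by_cases hnn : n < n0
    · have h1 := asn_le_card h
      rw [hJ] at h1
      have h2 : (M:ℝ) ≤ n0 ^ E := by
        have : M ≤ n0 ^ E := hnu.le.trans (Nat.pow_le_pow_left (by omega) E)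
        exact_mod_cast this
      have h3 : (n0:ℝ) ^ E ≤ K := by
        rw [hK]
        have : 0 ≤ 4 * d / c := by positivity
        have : 0 ≤ 4 * (C * 2 ^ E) / c := by positivity
        linarith
      nlinarith
    push Not at hnn
    have hn3 : 3 ≤ n := hn0.trans hnn
    set x : ℝ := (n : ℝ) with hx
    have hx3 : 3 ≤ x := by rw [hx]; exact_mod_cast hn3
    have hx0 : 0 < x := by linarith
    have hx1 : 1 ≤ x := by linarith
    set u := √x with hu
    have hu0 : 0 < u := Real.sqrt_pos.mpr hx0
    have hu2 : u ^ 2 = x := Real.sq_sqrt hx0.le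
    set y := x ^ (ε / 2) with hy
    have hy1 : 1 ≤ y := Real.one_le_rpow hx1 (by linarith)
    have hy2 : y ^ 2 = x ^ ε := by
      rw [hy, ← Real.rpow_natCast, ← Real.rpow_mul hx0.le]; congr 1; push_cast; ring
    set e := √(A * (y ^ 2 + 1) / x) with he
    have he0 : 0 < e := Real.sqrt_pos.mpr (by positivity)
    have he2 : e ^ 2 = A * (y ^ 2 + 1) / x := Real.sq_sqrt (by positivity)
    have hxe : x * e ^ 2 = A * (y ^ 2 + 1) := by rw [he2]; field_simp
    have he12 : e ≤ 1 / 2 := by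
      have h1 := hn01 n hnn
      have h2 : 8 * A * y ^ 2 ≤ x := by
        calc 8 * A * y ^ 2 ≤ x ^ (1 - ε) * x ^ ε := by rw [hy2]; gcongr
          _ = x := by rw [← Real.rpow_add hx0]; simp
      have h3 : e ^ 2 ≤ (1 / 2) ^ 2 := by
        rw [he2, div_le_iff₀ hx0]
        have h3 : 1 ≤ y ^ 2 := one_le_pow₀ hy1
        linarith [mul_le_mul_of_nonneg_left h3 (by linarith : 0 ≤ A)]
      exact lsq h3 (by norm_num)
    have hnM : n ≤ M := (Nat.le_self_pow (by omega) n).trans hnl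
    have hnM' : x ≤ M := by rw [hx]; exact_mod_cast hnM
    obtain ⟨χ, hχ⟩ := coloring J (n := n) (by omega)
    set t : ℝ := 2 * M / x with ht
    have hχ' : ∀ b, (#(J.filter (fun i => χ i = b)) : ℝ) ≤ t := by
      intro b
      have h1 := hχ b
      rw [hJ] at h1
      have h2 : ((M / n : ℕ) : ℝ) ≤ M / x := Nat.cast_div_le
      have h3 : (1:ℝ) ≤ M / x := by rw [le_div_iff₀ hx0]; linarith
      calc (#(J.filter (fun i => χ i = b)) : ℝ) ≤ ((M / n + 1 : ℕ) : ℝ) := by exact_mod_cast h1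
        _ = ((M / n : ℕ) : ℝ) + 1 := by push_cast; rfl
        _ ≤ M / x + M / x := by linarith
        _ = t := by rw [ht]; ring
    have htM : t < M := by
      rw [ht, div_lt_iff₀ hx0]; nlinarith
    have ht0 : 0 ≤ t := by positivity
    have hst := hstep V a J h n χ (y ^ 2) (K * φ) (K * t ^ (1 / 2 + ε)) e (1 / x ^ (N + 1)) t (by omega) (by positivity)
      (by positivity) (by positivity) he0 he12 hxe (by positivity) hχ'
      (by
        intro b J' hb hlt
        rw [hJ] at hlt
        refine (ih _ hlt b J' rfl hb).trans ?_
        rw [hφ]; gcongr)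
      (by
        intro b J' hb hlt
        have : #J' < M := by
          have := hlt.trans_lt htM
          exact_mod_cast this
        refine (ih _ this b J' rfl hb).trans ?_
        gcongr)
    rw [hJ] at hst
    -- term 1
    have k1 : d / (1 / x ^ (N + 1)) ≤ c / 4 * (K * φ) := by
      have h1 : x ^ (N + 1) ≤ φ := by
        have h2 : (x ^ (N + 1)) ^ 2 ≤ φ ^ 2 := by
          rw [← pow_mul, mul_comm, ← hE]
          have h3 : x ^ E ≤ M := by rw [hx]; exact_mod_cast hnl
          refine h3.trans ?_
          rw [hφ, ← Real.rpow_natCast, ← Real.rpow_mul (by linarith)]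
          calc (M:ℝ) = (M:ℝ) ^ (1:ℝ) := (Real.rpow_one _).symm
            _ ≤ _ := Real.rpow_le_rpow_of_exponent_le hM1 (by push_cast; linarith)
        exact lsq h2 (by linarith)
      have h2 : 4 * d / c ≤ K := by
        rw [hK]
        have : 0 ≤ 4 * (C * 2 ^ E) / c := by positivity
        have : 0 ≤ (n0:ℝ) ^ E := by positivity
        linarith
      rw [div_div_eq_mul_div, div_one]
      calc (d:ℝ) * x ^ (N + 1) ≤ d * φ := by gcongr
        _ = c / 4 * (4 * d / c * φ) := by field_simp
        _ ≤ _ := by gcongr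
    -- tail
    have k2 : (M:ℝ) * (C / (y ^ 2) ^ (2 ^ q)) ≤ c / 4 * (K * φ) := by
      have h1 : (M:ℝ) ≤ 2 ^ E * (y ^ 2) ^ (2 ^ q) := by
        have h2 : (M:ℝ) ≤ (2 * x) ^ E := by
          have : (M:ℝ) ≤ (x + 1) ^ E := by rw [hx]; exact_mod_cast hnu.le
          refine this.trans ?_
          gcongr; linarith
        refine h2.trans ?_
        rw [mul_pow]
        gcongr
        rw [hy2, ← Real.rpow_natCast, ← Real.rpow_natCast, ← Real.rpow_mul hx0.le]
        apply Real.rpow_le_rpow_of_exponent_le hx1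
        push_cast; exact hq
      have h2 : 4 * (C * 2 ^ E) / c ≤ K := by
        rw [hK]
        have : 0 ≤ 4 * d / c := by positivity
        have : 0 ≤ (n0:ℝ) ^ E := by positivity
        linarith
      calc (M:ℝ) * (C / (y ^ 2) ^ (2 ^ q)) ≤ (2 ^ E * (y ^ 2) ^ (2 ^ q)) * (C / (y ^ 2) ^ (2 ^ q)) := by gcongr
        _ = c / 4 * (4 * (C * 2 ^ E) / c * 1) := by field_simp
        _ ≤ _ := by gcongr
    -- main term
    have k3 : (K * t ^ (1 / 2 + ε)) * (C * x * (e + 1 / x ^ (N + 1) / e ^ N)) ≤ c / 4 * (K * φ) := by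
      apply main_arith hx1 hu0 hu2 hy1 hA1 hS0 hS2 he0 hxe (by linarith) hK0.le hC _ rfl
      · have := hn02 n hnn
        rw [div_le_iff₀ hc0] at this
        linarith
      · have h1 : t ^ (1 / 2 + ε) ≤ 2 * φ / (u * y ^ 2) := by
          rw [ht, Real.div_rpow (by positivity) hx0.le, Real.mul_rpow (by norm_num) (by linarith)]
          have h2 : x ^ (1 / 2 + ε) = u * y ^ 2 := by
            rw [Real.rpow_add hx0, hy2, hu, Real.sqrt_eq_rpow]
          rw [h2]
          have h3 : (2:ℝ) ^ (1 / 2 + ε) ≤ 2 := by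
            calc (2:ℝ) ^ (1 / 2 + ε) ≤ 2 ^ (1:ℝ) := Real.rpow_le_rpow_of_exponent_le (by norm_num) (by linarith)
              _ = 2 := Real.rpow_one _
          gcongr
        gcongr
    have k4 : (1 - c) * (K * φ) = K * φ - c * (K * φ) := by ring
    have k5 : 0 ≤ c * (K * φ) := by positivity
    rw [k4] at hst
    linarith
  intro a J h
  exact main _ a J rfl h

end EdgeStat

namespace EdgeStat
set_option linter.all false

section poly
variable {V : Type} [Fintype V] [DecidableEq V]

/-- function on the cube given by a polynomial of degree at most `d` -/
def IsPoly (d : ℕ) (g : (V → Bool) → ℝ) : Prop :=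
  ∃ a : Finset V → ℝ, Deg a univ d ∧ ∀ σ, ev a (sg σ) = g σ

lemma IsPoly.mono {d d' : ℕ} {g : (V → Bool) → ℝ} (h : IsPoly d g) (hd : d ≤ d') : IsPoly d' g := by
  obtain ⟨a, ha, h⟩ := h
  exact ⟨a, ha.mono (subset_refl _) hd, h⟩

lemma IsPoly.const (c : ℝ) (d : ℕ) : IsPoly d (fun _ : V → Bool => c) := by
  refine ⟨fun I => if I = ∅ then c else 0, ?_, ?_⟩
  · intro I hI
    have : I = ∅ := by by_contra h; simp [h] at hI
    subst this; simp
  · intro σ; simp [ev, mon]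

lemma IsPoly.add {d : ℕ} {g h : (V → Bool) → ℝ} (hg : IsPoly d g) (hh : IsPoly d h) :
    IsPoly d (fun σ => g σ + h σ) := by
  obtain ⟨a, ha, hg⟩ := hg
  obtain ⟨b, hb, hh⟩ := hh
  refine ⟨fun I => a I + b I, ?_, ?_⟩
  · intro I hI
    by_cases h0 : a I = 0
    · apply hb; intro h1; apply hI; simp [h0, h1]
    · exact ha I h0
  · intro σ; dsimp only; rw [← hg, ← hh]; simp [ev, add_mul, sum_add_distrib]

lemma IsPoly.mul {d e : ℕ} {g h : (V → Bool) → ℝ} (hg : IsPoly d g) (hh : IsPoly e h) :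
    IsPoly (d + e) (fun σ => g σ * h σ) := by
  obtain ⟨a, ha, hg⟩ := hg
  obtain ⟨b, hb, hh⟩ := hh
  obtain ⟨c, hc, h⟩ := ev_mul_exists ha hb
  exact ⟨c, hc, fun σ => by rw [h, hg, hh]⟩

lemma IsPoly.coord (i : V) : IsPoly 1 (fun σ : V → Bool => bs (σ i)) := by
  refine ⟨fun I => if I = {i} then 1 else 0, ?_, ?_⟩
  · intro I hI
    have : I = {i} := by by_contra h; simp [h] at hI
    subst this; simp
  · intro σ; simp [ev, mon, sg]

lemma IsPoly.sum {ι : Type} {d : ℕ} (s : Finset ι) (g : ι → (V → Bool) → ℝ) (h : ∀ i ∈ s, IsPoly d (g i)) :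
    IsPoly d (fun σ => ∑ i ∈ s, g i σ) := by
  induction s using Finset.induction_on with
  | empty => simpa using IsPoly.const 0 d
  | insert i s hi ih =>
    simp only [sum_insert hi]
    exact (h i (mem_insert_self _ _)).add (ih fun j hj => h j (mem_insert_of_mem hj))

lemma IsPoly.junta (T : Finset V) : ∀ g : (V → Bool) → ℝ,
    (∀ σ σ' : V → Bool, (∀ i ∈ T, σ i = σ' i) → g σ = g σ') → IsPoly (#T) g := by
  induction T using Finset.induction_on with
  | empty =>
    intro g hg
    have : g = fun _ => g (fun _ => true) := by funext σ; exact hg _ _ (by simp)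
    rw [this]; exact IsPoly.const _ _
  | insert i T hi ih =>
    intro g hg
    have key : ∀ b : Bool, IsPoly (#T) (fun σ => g (Function.update σ i b)) := by
      intro b
      apply ih
      intro σ σ' h
      apply hg
      intro j hj
      by_cases hji : j = i
      · subst hji; simp
      · rw [Function.update_of_ne hji, Function.update_of_ne hji]
        exact h j (mem_of_mem_insert_of_ne hj hji)
    have e : g = fun σ => (1/2) * (g (Function.update σ i true) + g (Function.update σ i false)) +
        bs (σ i) * ((1/2) * (g (Function.update σ i true) + (-1) * g (Function.update σ i false))) := by
      funext σ
      have h1 : g σ = g (Function.update σ i (σ i)) := by rw [Function.update_eq_self]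
      cases hσ : σ i
      · rw [hσ] at h1; rw [h1]; simp [bs]; ring
      · rw [hσ] at h1; rw [h1]; simp [bs]; ring
    rw [e, card_insert_of_notMem hi]
    apply IsPoly.add
    · have := (IsPoly.const (V := V) (1/2) 0).mul ((key true).add (key false))
      exact this.mono (by omega)
    · have h2 := (IsPoly.const (V := V) (-1) 0).mul (key false)
      rw [zero_add] at h2
      have := (IsPoly.coord i).mul ((IsPoly.const (V := V) (1/2) 0).mul ((key true).add h2))
      exact this.mono (by omega)

lemma IsPoly.nonzero {d : ℕ} {g : (V → Bool) → ℝ} (h : IsPoly d g) (hne : ∃ σ, g σ ≠ 0) :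
    1 ≤ 9 ^ d * Ex (fun σ => ind (g σ ≠ 0)) := by
  obtain ⟨a, ha, hg⟩ := h
  have hs : 0 < sq a := by
    rcases eq_or_lt_of_le (sq_nonneg' a) with h0 | h0
    · obtain ⟨σ, hσ⟩ := hne
      rw [← hg, sq_eq_zero h0.symm, ev_zero] at hσ
      exact absurd rfl hσ
    · exact h0
  have := pz_zero (f := fun σ : V → Bool => ev a (sg σ)) (C := 9 ^ d) (by positivity)
    (by rw [sg2]; exact sg4 ha) (by rw [sg2]; exact hs)
  simp only [hg] at this
  rw [div_le_iff₀ (by positivity)] at this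
  linarith

/-- the sensitivity theorem in terms of functions on the cube -/
theorem sens_fun (d : ℕ) (ε : ℝ) (hε : 0 < ε) (hε1 : ε ≤ 1 / 2) : ∃ K : ℝ, 0 < K ∧
    ∀ (V : Type) [Fintype V] [DecidableEq V] (g : (V → Bool) → ℝ), IsPoly d g →
      ∑ i, Ex (fun σ => ind (g σ = 0 ∧ g (Function.update σ i (!σ i)) ≠ 0)) ≤ K * (Fintype.card V : ℝ) ^ (1 / 2 + ε) := by
  obtain ⟨K, hK, h⟩ := sens_main d ε hε hε1
  refine ⟨K, hK, ?_⟩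
  intro V _ _ g hg
  obtain ⟨a, ha, hg⟩ := hg
  refine le_trans (le_of_eq ?_) (h V a univ ha)
  unfold asn
  apply sum_congr rfl; intro i _
  apply Ex_congr; intro σ
  rw [← hg, ← hg]
  congr 1
  apply propext
  apply and_congr_right; intro h0
  have e1 : ev a (sg (Function.update σ i (!σ i))) = ev a (sg σ) - 2 * bs (σ i) * ev (D i a) (sg σ) := by
    rw [sg_update, ev_update, ev_split i a (sg σ), bs_not]
    simp only [sg]; ring
  rw [e1, h0]
  have := bs_ne (σ i)
  simp [this]

end poly

section cubes
variable {ι W : Type} [Fintype ι] [DecidableEq ι] [Fintype W]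

/-- sum of functions depending on at most `r` coordinates -/
def Jun (r : ℕ) (F : (ι → W) → ℝ) : Prop := ∃ (𝒬 : Finset (Finset ι)) (φ : Finset ι → (ι → W) → ℝ),
  (∀ Q ∈ 𝒬, #Q ≤ r) ∧ (∀ Q ∈ 𝒬, ∀ v v', (∀ i ∈ Q, v i = v' i) → φ Q v = φ Q v') ∧ ∀ v, F v = ∑ Q ∈ 𝒬, φ Q v

lemma Jun.poly {r : ℕ} {F : (ι → W) → ℝ} (h : Jun r F) {V : Type} [Fintype V] [DecidableEq V] (b : ι → V)
    (m : (V → Bool) → ι → W) (hm : ∀ σ σ' i, σ (b i) = σ' (b i) → m σ i = m σ' i) :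
    IsPoly r (fun σ => F (m σ)) := by
  obtain ⟨𝒬, φ, h1, h2, h3⟩ := h
  simp only [h3]
  apply IsPoly.sum
  intro Q hQ
  have : IsPoly (#(Q.image b)) (fun σ => φ Q (m σ)) := by
    apply IsPoly.junta
    intro σ σ' hs
    apply h2 Q hQ
    intro i hi
    exact hm _ _ _ (hs _ (mem_image_of_mem b hi))
  exact this.mono (card_image_le.trans (h1 Q hQ))

/-- probability of leaving the zero set after resampling `B` -/
noncomputable def nu (F : (ι → W) → ℝ) (B : Finset ι) : ℝ :=
  Ex (fun u : ι → W => Ex (fun w : ι → W => ind (F u = 0 ∧ F (B.piecewise w u) ≠ 0)))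

lemma Ex_swap (S : Finset ι) (f : (ι → W) → (ι → W) → ℝ) :
    Ex (fun u => Ex (fun w => f (S.piecewise u w) (S.piecewise w u))) = Ex (fun u => Ex (fun w => f u w)) := by
  rw [← Ex_prod (fun p : (ι → W) × (ι → W) => f (S.piecewise p.1 p.2) (S.piecewise p.2 p.1)),
    ← Ex_prod (fun p : (ι → W) × (ι → W) => f p.1 p.2)]
  let e : (ι → W) × (ι → W) ≃ (ι → W) × (ι → W) :=
    { toFun := fun p => (S.piecewise p.1 p.2, S.piecewise p.2 p.1)
      invFun := fun p => (S.piecewise p.1 p.2, S.piecewise p.2 p.1)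
      left_inv := by
        rintro ⟨p, q⟩
        ext i <;> by_cases hi : i ∈ S <;> simp [hi]
      right_inv := by
        rintro ⟨p, q⟩
        ext i <;> by_cases hi : i ∈ S <;> simp [hi] }
  exact Ex_equiv e (fun p => f p.1 p.2)

lemma sum_nu (r : ℕ) (ε : ℝ) (hε : 0 < ε) (hε1 : ε ≤ 1 / 2) : ∃ K : ℝ, 0 < K ∧
    ∀ (ι W : Type) [Fintype ι] [DecidableEq ι] [Fintype W] [Nonempty W] (F : (ι → W) → ℝ) (hF : Jun r F) (m : ℕ) (b : ι → Fin m),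
      ∑ c, nu F (univ.filter (fun i => b i = c)) ≤ K * (m : ℝ) ^ (1 / 2 + ε) := by
  obtain ⟨K, hK, h⟩ := sens_fun r ε hε hε1
  refine ⟨K, hK, ?_⟩
  intro ι W _ _ _ _ F hF m b
  let S : (Fin m → Bool) → Finset ι := fun y => univ.filter (fun i => y (b i) = true)
  have h1 : ∀ u w : ι → W, ∑ c, Ex (fun y : Fin m → Bool => ind (F ((S y).piecewise u w) = 0 ∧
      F ((S (Function.update y c (!y c))).piecewise u w) ≠ 0)) ≤ K * (m : ℝ) ^ (1 / 2 + ε) := by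
    intro u w
    have := h (Fin m) (fun y => F ((S y).piecewise u w)) (hF.poly b (fun y => (S y).piecewise u w) (by
      intro σ σ' i hi
      simp [Finset.piecewise, S, hi]))
    simpa using this
  have h2 : ∀ (y : Fin m → Bool) (c : Fin m) (u w : ι → W), (S (Function.update y c (!y c))).piecewise u w
      = (univ.filter (fun i => b i = c)).piecewise ((S y).piecewise w u) ((S y).piecewise u w) := by
    intro y c u w
    funext i
    by_cases hc : b i = c
    · cases hy : y c <;> simp [Finset.piecewise, S, hc, hy]
    · simp [Finset.piecewise, S, hc, Function.update_of_ne]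
  have h3 : ∀ c, nu F (univ.filter (fun i => b i = c)) = Ex (fun u : ι → W => Ex (fun w : ι → W =>
      Ex (fun y : Fin m → Bool => ind (F ((S y).piecewise u w) = 0 ∧
      F ((S (Function.update y c (!y c))).piecewise u w) ≠ 0)))) := by
    intro c
    have e1 : ∀ y : Fin m → Bool, nu F (univ.filter (fun i => b i = c)) = Ex (fun u : ι → W => Ex (fun w : ι → W =>
        ind (F ((S y).piecewise u w) = 0 ∧ F ((S (Function.update y c (!y c))).piecewise u w) ≠ 0))) := by
      intro y
      simp only [h2]
      rw [Ex_swap (S y) (fun u w => ind (F u = 0 ∧ F ((univ.filter (fun i => b i = c)).piecewise w u) ≠ 0))]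
      rfl
    calc nu F (univ.filter (fun i => b i = c)) = Ex (fun y : Fin m → Bool => nu F (univ.filter (fun i => b i = c))) := by
          rw [Ex_const]
      _ = Ex (fun y : Fin m → Bool => Ex (fun u : ι → W => Ex (fun w : ι → W =>
        ind (F ((S y).piecewise u w) = 0 ∧ F ((S (Function.update y c (!y c))).piecewise u w) ≠ 0)))) :=
          Ex_congr e1
      _ = _ := by
          rw [Ex_comm]
          apply Ex_congr; intro u
          rw [Ex_comm]
  simp only [h3]
  rw [← Ex_sum]
  apply Ex_le_const; intro u
  rw [← Ex_sum]
  apply Ex_le_const; intro w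
  exact h1 u w

/-- the cube between `u` and `w` on `B` leaves the zero set -/
def NN (F : (ι → W) → ℝ) (B : Finset ι) (u w : ι → W) : Prop := ∃ X ⊆ B, F (X.piecewise w u) ≠ 0

lemma nu_lower [Nonempty W] {r : ℕ} {F : (ι → W) → ℝ} (hF : Jun r F) (B : Finset ι) :
    Ex (fun u : ι → W => Ex (fun w : ι → W => ind (F u = 0 ∧ NN F B u w))) ≤ 2 * 9 ^ r * nu F B := by
  let q : (ι → W) → ℝ := fun p => Ex (fun u : ι → W => ind (F (B.piecewise u p) = 0))
  have hq0 : ∀ p, 0 ≤ q p := fun p => Ex_nonneg fun _ => ind_nonneg _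
  have hq1 : ∀ p, q p ≤ 1 := fun p => Ex_le_const fun _ => ind_le_one _
  have hq' : ∀ p, Ex (fun u : ι → W => ind (F (B.piecewise u p) ≠ 0)) = 1 - q p := by
    intro p
    simp only [ne_eq, ind_not]; rw [Ex_sub, Ex_const]
  have pw : ∀ u w p : ι → W, B.piecewise w (B.piecewise u p) = B.piecewise w p := by
    intro u w p; funext i; by_cases hi : i ∈ B <;> simp [hi]
  have e1 : nu F B = Ex (fun p => q p * (1 - q p)) := by
    unfold nu
    rw [← Ex_piecewise B]
    apply Ex_congr; intro p
    simp only [pw, ind_and, Ex_mul_left, hq']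
    rw [Ex_mul_right]
  rw [e1, ← Ex_mul_left, ← Ex_piecewise B (fun u => Ex (fun w : ι → W => ind (F u = 0 ∧ NN F B u w)))]
  apply Ex_mono; intro p
  have b1 : Ex (fun u : ι → W => Ex (fun w : ι → W => ind (F (B.piecewise u p) = 0 ∧ NN F B (B.piecewise u p) w))) ≤ q p := by
    apply Ex_mono; intro u
    apply Ex_le_const; intro w
    exact ind_mono And.left
  have b2 : Ex (fun u : ι → W => Ex (fun w : ι → W => ind (F (B.piecewise u p) = 0 ∧ NN F B (B.piecewise u p) w)))
      ≤ 9 ^ r * (1 - q p) := by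
    have c1 : ∀ u w : ι → W, ind (F (B.piecewise u p) = 0 ∧ NN F B (B.piecewise u p) w)
        ≤ 9 ^ r * Ex (fun y : ι → Bool => ind (F (B.piecewise ((univ.filter (fun i => y i = true)).piecewise w u) p) ≠ 0)) := by
      intro u w
      apply ind_le_of
      · have : 0 ≤ Ex (fun y : ι → Bool => ind (F (B.piecewise ((univ.filter (fun i => y i = true)).piecewise w u) p) ≠ 0)) :=
          Ex_nonneg fun _ => ind_nonneg _
        positivity
      · rintro ⟨-, X, hX, hne⟩
        apply IsPoly.nonzero (hF.poly (id : ι → ι) (fun y => B.piecewise ((univ.filter (fun i => y i = true)).piecewise w u) p) (by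
          intro σ σ' i hi
          simp only [id] at hi
          by_cases hB : i ∈ B <;> simp [Finset.piecewise, hi]))
        refine ⟨fun i => decide (i ∈ X), ?_⟩
        have : B.piecewise ((univ.filter (fun i => decide (i ∈ X) = true)).piecewise w u) p = X.piecewise w (B.piecewise u p) := by
          funext i
          by_cases hi : i ∈ X
          · simp [hi, hX hi, Finset.piecewise]
          · by_cases hB : i ∈ B <;> simp [hi, hB, Finset.piecewise]
        rw [this]; exact hne
    calc _ ≤ Ex (fun u : ι → W => Ex (fun w : ι → W => 9 ^ r * Ex (fun y : ι → Bool =>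
            ind (F (B.piecewise ((univ.filter (fun i => y i = true)).piecewise w u) p) ≠ 0)))) :=
          Ex_mono fun u => Ex_mono fun w => c1 u w
      _ = 9 ^ r * Ex (fun y : ι → Bool => Ex (fun u : ι → W => Ex (fun w : ι → W =>
            ind (F (B.piecewise ((univ.filter (fun i => y i = true)).piecewise w u) p) ≠ 0)))) := by
          simp only [Ex_mul_left]
          congr 1
          rw [Ex_comm (fun (y : ι → Bool) (u : ι → W) => Ex (fun w : ι → W =>
            ind (F (B.piecewise ((univ.filter (fun i => y i = true)).piecewise w u) p) ≠ 0)))]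
          apply Ex_congr; intro u
          rw [Ex_comm]
      _ = 9 ^ r * Ex (fun y : ι → Bool => 1 - q p) := by
          congr 1
          apply Ex_congr; intro y
          rw [Ex_piecewise _ (fun v => ind (F (B.piecewise v p) ≠ 0)), hq']
      _ = _ := by rw [Ex_const]
  have h9 : (1:ℝ) ≤ 9 ^ r := one_le_pow₀ (by norm_num)
  have := hq0 p
  have := hq1 p
  rcases le_total (q p) (1/2) with hc | hc
  · refine b1.trans ?_
    have h3 : q p ≤ 2 * (q p * (1 - q p)) := by nlinarith
    have h4 : 0 ≤ q p * (1 - q p) := mul_nonneg (hq0 p) (by linarith)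
    nlinarith
  · refine b2.trans ?_
    have : (1 - q p) ≤ 2 * (q p * (1 - q p)) := by nlinarith
    nlinarith

end cubes
end EdgeStat

namespace EdgeStat
set_option linter.all false

section perms
variable {ι : Type} [Fintype ι] [DecidableEq ι]

lemma perm_ext {A : Type} (f g : A → ι) (hf : Function.Injective f) (hg : Function.Injective g) :
    ∃ π : Equiv.Perm ι, ∀ a, π (f a) = g a := by
  let e : {x // x ∈ Set.range f} ≃ {x // x ∈ Set.range g} :=
    (Equiv.ofInjective f hf).symm.trans (Equiv.ofInjective g hg)
  refine ⟨e.extendSubtype, fun a => ?_⟩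
  rw [Equiv.extendSubtype_apply_of_mem e (f a) ⟨a, rfl⟩]
  have : (⟨f a, ⟨a, rfl⟩⟩ : {x // x ∈ Set.range f}) = Equiv.ofInjective f hf a := rfl
  simp only [e, Equiv.trans_apply, this, Equiv.symm_apply_apply]
  rfl

lemma perm_pair {J L J' L' : Finset ι} (h : Disjoint J L) (h' : Disjoint J' L') (hJ : #J = #J') (hL : #L = #L') :
    ∃ π : Equiv.Perm ι, J.image π = J' ∧ L.image π = L' := by
  let eJ : J ≃ J' := Finset.equivOfCardEq hJ
  let eL : L ≃ L' := Finset.equivOfCardEq hL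
  obtain ⟨π, hπ⟩ := perm_ext (A := J ⊕ L) (Sum.elim (fun x => (x : ι)) (fun x => (x : ι)))
    (Sum.elim (fun x => (eJ x : ι)) (fun x => (eL x : ι)))
    (by
      apply Function.Injective.sumElim Subtype.val_injective Subtype.val_injective
      intro a b hab
      exact (Finset.disjoint_left.mp h a.2) (hab ▸ b.2))
    (by
      apply Function.Injective.sumElim (Subtype.val_injective.comp eJ.injective) (Subtype.val_injective.comp eL.injective)
      intro a b hab
      have hab' : (eJ a : ι) = (eL b : ι) := hab
      exact (Finset.disjoint_left.mp h' (eJ a).2) (by rw [hab']; exact (eL b).2))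
  refine ⟨π, ?_, ?_⟩
  · apply eq_of_subset_of_card_le
    · intro x hx
      obtain ⟨y, hy, rfl⟩ := mem_image.mp hx
      have := hπ (Sum.inl ⟨y, hy⟩)
      simp only [Sum.elim_inl] at this
      rw [this]; exact (eJ _).2
    · rw [card_image_of_injective _ π.injective, hJ]
  · apply eq_of_subset_of_card_le
    · intro x hx
      obtain ⟨y, hy, rfl⟩ := mem_image.mp hx
      have := hπ (Sum.inr ⟨y, hy⟩)
      simp only [Sum.elim_inr] at this
      rw [this]; exact (eL _).2
    · rw [card_image_of_injective _ π.injective, hL]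

lemma Ex_perm_right (τ : Equiv.Perm ι) (f : Equiv.Perm ι → ℝ) : Ex (fun π => f (π * τ)) = Ex f :=
  Ex_equiv (Equiv.mulRight τ) f
lemma Ex_perm_left (τ : Equiv.Perm ι) (f : Equiv.Perm ι → ℝ) : Ex (fun π => f (τ * π)) = Ex f :=
  Ex_equiv (Equiv.mulLeft τ) f

lemma image_mul (π τ : Equiv.Perm ι) (J : Finset ι) : J.image (π * τ) = (J.image τ).image π := by
  rw [image_image]; rfl

/-- average over all positions -/
noncomputable def av (h : Finset ι → ℝ) (J : Finset ι) : ℝ := Ex (fun π : Equiv.Perm ι => h (J.image π))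

lemma av_eq (h : Finset ι → ℝ) {J J' : Finset ι} (hJ : #J = #J') : av h J = av h J' := by
  obtain ⟨τ, h1, -⟩ := perm_pair (disjoint_empty_right J) (disjoint_empty_right J') hJ rfl
  unfold av
  rw [← h1]
  simp only [← image_mul]
  exact (Ex_perm_right τ (fun π => h (J.image π))).symm

lemma perm_point (i l : ι) : Ex (fun τ : Equiv.Perm ι => ind (τ l = i)) = 1 / (Fintype.card ι : ℝ) := by
  have h1 : ∀ j, Ex (fun τ : Equiv.Perm ι => ind (τ l = j)) = Ex (fun τ : Equiv.Perm ι => ind (τ l = i)) := by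
    intro j
    rw [← Ex_perm_left (Equiv.swap i j)]
    apply Ex_congr; intro τ
    congr 1; apply propext
    rw [Equiv.Perm.mul_apply]
    constructor
    · intro h; have := congrArg (Equiv.swap i j) h; simpa using this
    · intro h; rw [h]; simp
  have h2 : ∑ j, Ex (fun τ : Equiv.Perm ι => ind (τ l = j)) = 1 := by
    rw [← Ex_sum]
    have : ∀ τ : Equiv.Perm ι, ∑ j, ind (τ l = j) = 1 := by
      intro τ
      rw [Finset.sum_eq_single (τ l), ind_true rfl]
      · intro j _ hj; exact ind_false (Ne.symm hj)
      · intro h; exact absurd (mem_univ _) h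
    simp only [this, Ex_const]
  simp only [h1] at h2
  rw [sum_const, nsmul_eq_mul, card_univ] at h2
  have : (Fintype.card ι : ℝ) ≠ 0 := by intro h; rw [h] at h2; simp at h2
  field_simp; linarith

lemma perm_disj {J L : Finset ι} {j : ℕ} (hJ : #J = j) (hL : #L = j) (hk : 2 * j ^ 2 ≤ Fintype.card ι) :
    1 / 2 ≤ Ex (fun τ : Equiv.Perm ι => ind (Disjoint J (L.image τ))) := by
  have h1 : ∀ τ : Equiv.Perm ι, 1 - ∑ i ∈ J, ∑ l ∈ L, ind (τ l = i) ≤ ind (Disjoint J (L.image τ)) := by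
    intro τ
    have h0 : ∀ i l, 0 ≤ ind (τ l = i) := fun i l => ind_nonneg _
    by_cases hd : Disjoint J (L.image τ)
    · rw [ind_true hd]
      have : 0 ≤ ∑ i ∈ J, ∑ l ∈ L, ind (τ l = i) := sum_nonneg fun i _ => sum_nonneg fun l _ => h0 i l
      linarith
    · rw [ind_false hd]
      obtain ⟨i, hi, hi'⟩ := Finset.not_disjoint_iff.mp hd
      obtain ⟨l, hl, rfl⟩ := mem_image.mp hi'
      have a1 : ind (τ l = τ l) ≤ ∑ l' ∈ L, ind (τ l' = τ l) := single_le_sum (f := fun l' => ind (τ l' = τ l)) (fun l' _ => h0 _ l') hl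
      have a2 : ∑ l' ∈ L, ind (τ l' = τ l) ≤ ∑ i ∈ J, ∑ l ∈ L, ind (τ l = i) :=
        single_le_sum (f := fun i => ∑ l ∈ L, ind (τ l = i)) (fun i _ => sum_nonneg fun l _ => h0 i l) hi
      rw [ind_true rfl] at a1
      linarith
  have h2 := Ex_mono h1
  rw [Ex_sub, Ex_const, Ex_sum] at h2
  simp only [Ex_sum, perm_point, sum_const, hJ, hL, nsmul_eq_mul] at h2
  refine le_trans ?_ h2
  rcases Nat.eq_zero_or_pos (Fintype.card ι) with h0 | h0
  · rw [h0]; simp; norm_num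
  · have h0' : (0:ℝ) < Fintype.card ι := by exact_mod_cast h0
    have hk' : 2 * (j:ℝ) ^ 2 ≤ Fintype.card ι := by exact_mod_cast hk
    have : (j:ℝ) * (j * (1 / Fintype.card ι)) ≤ 1 / 2 := by
      rw [show (j:ℝ) * (j * (1 / Fintype.card ι)) = j ^ 2 / Fintype.card ι by ring, div_le_iff₀ h0']
      linarith
    linarith

lemma pair_av {h : Finset ι → ℝ} (h0 : ∀ J, 0 ≤ h J) {J L : Finset ι} {j : ℕ} (hJ : #J = j) (hL : #L = j)
    (hd : Disjoint J L) (hk : 2 * j ^ 2 ≤ Fintype.card ι) :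
    Ex (fun π : Equiv.Perm ι => h (J.image π) * h (L.image π)) ≤ 2 * (av h J * av h L) := by
  set κ := Ex (fun π : Equiv.Perm ι => h (J.image π) * h (L.image π)) with hκ
  have hκ0 : 0 ≤ κ := Ex_nonneg fun π => mul_nonneg (h0 _) (h0 _)
  have e1 : av h J * av h L = Ex (fun τ : Equiv.Perm ι => Ex (fun π : Equiv.Perm ι => h (J.image π) * h ((L.image τ).image π))) := by
    rw [Ex_comm]
    unfold av
    rw [← Ex_mul_right]
    apply Ex_congr; intro π
    rw [Ex_mul_left]
    congr 1
    simp only [← image_mul]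
    exact (Ex_perm_left π (fun τ => h (L.image τ))).symm
  have e2 : ∀ τ : Equiv.Perm ι, ind (Disjoint J (L.image τ)) * κ
      ≤ Ex (fun π : Equiv.Perm ι => h (J.image π) * h ((L.image τ).image π)) := by
    intro τ
    by_cases hdis : Disjoint J (L.image τ)
    · rw [ind_true hdis, one_mul]
      obtain ⟨θ, h1, h2⟩ := perm_pair hd hdis rfl (card_image_of_injective _ τ.injective).symm
      apply le_of_eq
      rw [hκ, ← Ex_perm_right θ]
      simp only [image_mul, h1, h2]
    · rw [ind_false hdis, zero_mul]
      exact Ex_nonneg fun π => mul_nonneg (h0 _) (h0 _)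
  have e3 := Ex_mono e2
  rw [← e1, Ex_mul_right] at e3
  have e4 := perm_disj hJ hL hk
  nlinarith

end perms

section hyper
variable {ι W : Type} [Fintype ι] [DecidableEq ι] [Fintype W] [DecidableEq W]

/-- edge indicator at the index set `Q` -/
def ph (E : Finset (Finset W)) (v : ι → W) (Q : Finset ι) : ℤ := if Q.image v ∈ E then 1 else 0
/-- number of index sets spanning an edge -/
def fe (E : Finset (Finset W)) (r : ℕ) (v : ι → W) : ℤ := ∑ Q ∈ powersetCard r univ, ph E v Q
/-- alternating sum over the cube spanned by `J` -/
def Oc (E : Finset (Finset W)) (J Q : Finset ι) (u w : ι → W) : ℤ :=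
  ∑ X ∈ J.powerset, (-1) ^ #X * ph E (X.piecewise w u) Q
/-- alternating sum of the edge count -/
def sm (E : Finset (Finset W)) (r : ℕ) (J : Finset ι) (u w : ι → W) : ℤ :=
  ∑ X ∈ J.powerset, (-1) ^ #X * fe E r (X.piecewise w u)

lemma ph_congr (E : Finset (Finset W)) {v v' : ι → W} {Q : Finset ι} (h : ∀ i ∈ Q, v i = v' i) : ph E v Q = ph E v' Q := by
  unfold ph; rw [image_congr (fun i hi => h i hi)]

lemma ph_perm (E : Finset (Finset W)) (v : ι → W) (π : Equiv.Perm ι) (Q : Finset ι) :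
    ph E (v ∘ π) Q = ph E v (Q.image π) := by
  unfold ph; rw [image_image]

lemma fe_perm (E : Finset (Finset W)) (r : ℕ) (v : ι → W) (π : Equiv.Perm ι) : fe E r (v ∘ π) = fe E r v := by
  unfold fe
  simp only [ph_perm]
  have hinj : Function.Injective (fun Q : Finset ι => Q.image π) := image_injective π.injective
  rw [← sum_image (f := fun Q => ph E v Q) (s := powersetCard r univ) (g := fun Q : Finset ι => Q.image π) (fun a _ b _ h => hinj h)]
  congr 1
  apply eq_of_subset_of_card_le
  · intro Q hQ
    obtain ⟨Q', hQ', rfl⟩ := mem_image.mp hQ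
    rw [mem_powersetCard] at hQ' ⊢
    exact ⟨subset_univ _, by rw [card_image_of_injective _ π.injective, hQ'.2]⟩
  · rw [card_image_of_injective _ hinj]

lemma pw_comp (X : Finset ι) (u w : ι → W) (π : Equiv.Perm ι) :
    X.piecewise (w ∘ π) (u ∘ π) = (X.image π).piecewise w u ∘ π := by
  funext i
  by_cases hi : i ∈ X
  · simp [Finset.piecewise, hi]
  · simp [Finset.piecewise, hi]

lemma sm_perm (E : Finset (Finset W)) (r : ℕ) (J : Finset ι) (u w : ι → W) (π : Equiv.Perm ι) :
    sm E r J (u ∘ π) (w ∘ π) = sm E r (J.image π) u w := by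
  unfold sm
  have hinj : Function.Injective (fun Q : Finset ι => Q.image π) := image_injective π.injective
  rw [powerset_image, sum_image (fun a _ b _ h => hinj h)]
  apply sum_congr rfl; intro X _
  rw [pw_comp, fe_perm, card_image_of_injective _ π.injective]

lemma sm_eq (E : Finset (Finset W)) (r : ℕ) (J : Finset ι) (u w : ι → W) :
    sm E r J u w = ∑ Q ∈ powersetCard r univ, Oc E J Q u w := by
  unfold sm fe Oc
  simp only [mul_sum]
  rw [sum_comm]

lemma Oc_insert (E : Finset (Finset W)) {J : Finset ι} {i : ι} (hi : i ∉ J) (Q : Finset ι) (u w : ι → W) :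
    Oc E (insert i J) Q u w = Oc E J Q u w - Oc E J Q (Function.update u i (w i)) w := by
  unfold Oc
  rw [sum_powerset_insert hi, sub_eq_add_neg, ← sum_neg_distrib]
  congr 1
  apply sum_congr rfl; intro X hX
  have hiX : i ∉ X := fun h => hi (mem_powerset.mp hX h)
  rw [card_insert_of_notMem hiX, pow_succ]
  have : (insert i X).piecewise w u = X.piecewise w (Function.update u i (w i)) := by
    funext j
    by_cases hj : j = i
    · subst hj; simp [Finset.piecewise, hiX]
    · by_cases hjX : j ∈ X <;> simp [Finset.piecewise, hj, hjX]
  rw [this]; ring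

lemma Oc_congr (E : Finset (Finset W)) {J Q : Finset ι} {u u' w w' : ι → W} (hu : ∀ i ∈ Q, u i = u' i)
    (hw : ∀ i ∈ J, w i = w' i) : Oc E J Q u w = Oc E J Q u' w' := by
  unfold Oc
  apply sum_congr rfl; intro X hX
  congr 1
  apply ph_congr
  intro i hi
  by_cases hiX : i ∈ X
  · simp [Finset.piecewise, hiX, hw i (mem_powerset.mp hX hiX)]
  · simp [Finset.piecewise, hiX, hu i hi]

lemma Oc_zero (E : Finset (Finset W)) {J Q : Finset ι} (h : ¬ J ⊆ Q) (u w : ι → W) : Oc E J Q u w = 0 := by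
  obtain ⟨i, hi, hiQ⟩ := not_subset.mp h
  rw [← insert_erase hi, Oc_insert E (notMem_erase i J)]
  rw [Oc_congr E (u := Function.update u i (w i)) (u' := u) (w' := w)]
  · ring
  · intro j hj
    rw [Function.update_of_ne]; rintro rfl; exact hiQ hj
  · intro j _; rfl

lemma Oc_abs (E : Finset (Finset W)) (J Q : Finset ι) (u w : ι → W) : |Oc E J Q u w| ≤ 2 ^ #J := by
  unfold Oc
  refine (abs_sum_le_sum_abs _ _).trans ?_
  calc ∑ X ∈ J.powerset, |(-1) ^ #X * ph E (X.piecewise w u) Q| ≤ ∑ X ∈ J.powerset, (1:ℤ) := by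
        apply sum_le_sum; intro X _
        rw [abs_mul, abs_pow, abs_neg, abs_one, one_pow, one_mul]
        unfold ph; split_ifs <;> simp
    _ = 2 ^ #J := by rw [sum_const, card_powerset]; simp

lemma sm_congr (E : Finset (Finset W)) (r : ℕ) {J : Finset ι} (u : ι → W) {w w' : ι → W} (hw : ∀ i ∈ J, w i = w' i) :
    sm E r J u w = sm E r J u w' := by
  rw [sm_eq, sm_eq]
  exact sum_congr rfl fun Q _ => Oc_congr E (fun _ _ => rfl) hw

lemma Ex_indep_set [Nonempty W] (J : Finset ι) (f g : (ι → W) → ℝ) (hf : ∀ w w', (∀ i ∈ J, w i = w' i) → f w = f w')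
    (hg : ∀ w w', (∀ i ∉ J, w i = w' i) → g w = g w') : Ex (fun w => f w * g w) = Ex f * Ex g := by
  rw [← Ex_piecewise J]
  have h1 : ∀ p q : ι → W, f (J.piecewise q p) = f q := fun p q => hf _ _ (fun i hi => by simp [hi])
  have h2 : ∀ p q : ι → W, g (J.piecewise q p) = g p := fun p q => hg _ _ (fun i hi => by simp [hi])
  simp only [h1, h2, Ex_mul_right, Ex_mul_left]

/-- probability that the cube on `J` is non-flat -/
noncomputable def hh (E : Finset (Finset W)) (r : ℕ) (u : ι → W) (J : Finset ι) : ℝ :=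
  Ex (fun w : ι → W => ind (sm E r J u w ≠ 0))

lemma hh_nonneg (E : Finset (Finset W)) (r : ℕ) (u : ι → W) (J : Finset ι) : 0 ≤ hh E r u J :=
  Ex_nonneg fun _ => ind_nonneg _

lemma Ex_comp_perm (π : Equiv.Perm ι) (f : (ι → W) → ℝ) : Ex (fun w => f (w ∘ π)) = Ex f :=
  Ex_equiv (Equiv.arrowCongr π.symm (Equiv.refl W)) f

lemma hh_perm (E : Finset (Finset W)) (r : ℕ) (u : ι → W) (J : Finset ι) (π : Equiv.Perm ι) :
    hh E r (u ∘ π) J = hh E r u (J.image π) := by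
  unfold hh
  rw [← Ex_comp_perm π]
  simp only [sm_perm]

lemma sm_NN (E : Finset (Finset W)) (r : ℕ) {J B : Finset ι} (hJB : J ⊆ B) (hJ : J.Nonempty) (ℓ : ℤ) {u w : ι → W}
    (h : sm E r J u w ≠ 0) : NN (fun v => ((fe E r v - ℓ : ℤ) : ℝ)) B u w := by
  by_contra hN
  unfold NN at hN
  push Not at hN
  apply h
  unfold sm
  have h1 : ∀ X ∈ J.powerset, (-1) ^ #X * fe E r (X.piecewise w u) = (-1) ^ #X * ℓ := by
    intro X hX
    have := hN X ((mem_powerset.mp hX).trans hJB)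
    have h2 : fe E r (X.piecewise w u) - ℓ = 0 := by exact_mod_cast this
    rw [show fe E r (X.piecewise w u) = ℓ by linarith]
  rw [sum_congr rfl h1, ← sum_mul, sum_powerset_neg_one_pow_card_of_nonempty hJ, zero_mul]

set_option maxHeartbeats 800000 in
/-- second moment argument -/
lemma second_moment [Nonempty W] (E : Finset (Finset W)) (r : ℕ) (u : ι → W) {M j : ℕ} (J : Fin M → Finset ι) (B : Finset ι)
    (hJB : ∀ c, J c ⊆ B) (hJ : ∀ c, #(J c) = j) (hj : 0 < j) (hdis : ∀ c c', c ≠ c' → Disjoint (J c) (J c'))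
    (hk : 2 * j ^ 2 ≤ Fintype.card ι) (ℓ : ℤ) (ρ : ℝ) (hρ : ∀ c, av (hh E r u) (J c) = ρ) (hM : 1 ≤ M * ρ) :
    1 / 12 ≤ Ex (fun π : Equiv.Perm ι => Ex (fun w : ι → W => ind (NN (fun v => ((fe E r v - ℓ : ℤ) : ℝ)) (B.image π) u w))) := by
  set I : Fin M → Equiv.Perm ι × (ι → W) → ℝ := fun c p => ind (sm E r ((J c).image p.1) u p.2 ≠ 0) with hI
  set Y : Equiv.Perm ι × (ι → W) → ℝ := fun p => ∑ c, I c p with hY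
  have hI0 : ∀ c p, 0 ≤ I c p := fun c p => ind_nonneg _
  have hEI : ∀ c, Ex (I c) = ρ := by
    intro c; rw [← hρ c, Ex_prod]; rfl
  have hEY : Ex Y = M * ρ := by
    rw [hY, Ex_sum, sum_congr rfl (fun c _ => hEI c)]; simp
  have hEII : ∀ c c', Ex (fun p => I c p * I c' p) ≤ 2 * ρ ^ 2 + (if c = c' then ρ else 0) := by
    intro c c'
    by_cases hc : c = c'
    · subst hc
      have : ∀ p, I c p * I c p = I c p := by
        intro p; simp only [hI]; unfold ind; split_ifs <;> norm_num
      simp only [this, hEI, if_true]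
      nlinarith
    · rw [if_neg hc, add_zero, Ex_prod]
      have h1 : ∀ π : Equiv.Perm ι, Ex (fun w : ι → W => I c (π, w) * I c' (π, w))
          = hh E r u ((J c).image π) * hh E r u ((J c').image π) := by
        intro π
        apply Ex_indep_set ((J c).image π)
        · intro w w' hw
          simp only [hI]; rw [sm_congr E r u hw]
        · intro w w' hw
          simp only [hI]
          rw [sm_congr E r u]
          intro i hi
          apply hw
          have := (Finset.disjoint_image π.injective).mpr (hdis c c' hc)
          exact Finset.disjoint_right.mp this hi
      simp only [h1]
      refine (pair_av (hh_nonneg E r u) (hJ c) (hJ c') (hdis c c' hc) hk).trans ?_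
      rw [hρ, hρ]; apply le_of_eq; ring
  have hEY2 : Ex (fun p => Y p ^ 2) ≤ 3 * (Ex Y) ^ 2 := by
    have e1 : ∀ p, Y p ^ 2 = ∑ c, ∑ c', I c p * I c' p := by
      intro p; rw [pow_two, hY, sum_mul_sum]
    simp only [e1, Ex_sum]
    refine (sum_le_sum fun c _ => sum_le_sum fun c' _ => hEII c c').trans ?_
    simp only [sum_add_distrib, sum_const, sum_ite_eq, mem_univ, if_true, card_univ, Fintype.card_fin, nsmul_eq_mul]
    rw [hEY]
    nlinarith
  have hpos : 0 < Ex Y := by rw [hEY]; linarith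
  have := pz (fun p => sum_nonneg fun c _ => hI0 c p) (by norm_num : (0:ℝ) < 3) hEY2 hpos
  refine le_trans (le_trans (by norm_num) this) ?_
  rw [Ex_prod]
  apply Ex_mono; intro π
  apply Ex_mono; intro w
  apply ind_mono
  intro h
  have hYpos : 0 < Y (π, w) := by linarith
  obtain ⟨c, -, hc⟩ := exists_ne_zero_of_sum_ne_zero hYpos.ne'
  have hs : sm E r ((J c).image π) u w ≠ 0 := by
    intro h0; apply hc; simp only [hI]; exact ind_false (by simpa using h0)
  apply sm_NN E r (image_subset_image (hJB c)) _ ℓ hs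
  apply Nonempty.image
  rw [← card_pos, hJ c]; exact hj

end hyper
end EdgeStat

namespace EdgeStat
set_option linter.all false

section claim
variable {ι W : Type} [Fintype ι] [DecidableEq ι] [Fintype W] [DecidableEq W]

/-- weighted probability of an event -/
noncomputable def PP (om : (ι → W) → ℝ) (ev : (ι → W) → (ι → W) → Prop) : ℝ :=
  Ex (fun u => om u * Ex (fun w => ind (ev u w)))

lemma PP_mono {om : (ι → W) → ℝ} (h0 : ∀ u, 0 ≤ om u) {ev ev' : (ι → W) → (ι → W) → Prop}
    (h : ∀ u w, ev u w → ev' u w) : PP om ev ≤ PP om ev' := by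
  apply Ex_mono; intro u
  exact mul_le_mul_of_nonneg_left (Ex_mono fun w => ind_mono (h u w)) (h0 u)

lemma PP_nonneg {om : (ι → W) → ℝ} (h0 : ∀ u, 0 ≤ om u) (ev : (ι → W) → (ι → W) → Prop) : 0 ≤ PP om ev :=
  Ex_nonneg fun u => mul_nonneg (h0 u) (Ex_nonneg fun _ => ind_nonneg _)

lemma PP_or {om : (ι → W) → ℝ} (h0 : ∀ u, 0 ≤ om u) {ev ev₁ ev₂ : (ι → W) → (ι → W) → Prop}
    (h : ∀ u w, ev u w → ev₁ u w ∨ ev₂ u w) : PP om ev ≤ PP om ev₁ + PP om ev₂ := by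
  unfold PP
  rw [← Ex_add]
  apply Ex_mono; intro u
  rw [← mul_add, ← Ex_add]
  apply mul_le_mul_of_nonneg_left _ (h0 u)
  apply Ex_mono; intro w
  apply ind_le_of (add_nonneg (ind_nonneg _) (ind_nonneg _))
  intro hev
  rcases h u w hev with h1 | h1
  · rw [ind_true h1]; linarith [ind_nonneg (ev₂ u w)]
  · rw [ind_true h1]; linarith [ind_nonneg (ev₁ u w)]

lemma PP_false {om : (ι → W) → ℝ} {ev : (ι → W) → (ι → W) → Prop} (h : ∀ u w, ¬ ev u w) : PP om ev = 0 := by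
  unfold PP
  have : ∀ u w, ind (ev u w) = 0 := fun u w => ind_false (h u w)
  simp only [this, Ex_zero, mul_zero]

lemma Oc_swap (E : Finset (Finset W)) {J R : Finset ι} {a a' : ι} (hJ : J ⊆ R) (ha : a ∉ R) (ha' : a' ∉ R)
    (u w : ι → W) (x : W) :
    Oc E J (insert a' R) (Function.update u a' x) w = Oc E J (insert a R) (Function.update u a x) w := by
  unfold Oc
  apply sum_congr rfl; intro X hX
  have hXR : X ⊆ R := (mem_powerset.mp hX).trans hJ
  congr 1
  unfold ph
  have h1 : (insert a' R).image (X.piecewise w (Function.update u a' x))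
      = (insert a R).image (X.piecewise w (Function.update u a x)) := by
    rw [image_insert, image_insert]
    have b1 : X.piecewise w (Function.update u a' x) a' = x := by
      simp [Finset.piecewise, show a' ∉ X from fun h => ha' (hXR h)]
    have b2 : X.piecewise w (Function.update u a x) a = x := by
      simp [Finset.piecewise, show a ∉ X from fun h => ha (hXR h)]
    rw [b1, b2]
    congr 1
    apply image_congr
    intro i hi
    have c1 : i ≠ a := fun h => ha (h ▸ hi)
    have c2 : i ≠ a' := fun h => ha' (h ▸ hi)
    simp [Finset.piecewise, Function.update_of_ne c1, Function.update_of_ne c2]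
  rw [h1]

lemma step_lemma (E : Finset (Finset W)) {om : (ι → W) → ℝ} (h0 : ∀ u, 0 ≤ om u) {r j : ℕ} {β : ℝ}
    (hβ : ∀ J Q : Finset ι, #J = j + 1 → #Q = r → PP om (fun u w => Oc E J Q u w ≠ 0) ≤ β)
    {J R : Finset ι} {a a' : ι} (hjJ : #J = j) (hR : #R + 1 = r) (hJ : J ⊆ R) (ha : a ∉ R) (ha' : a' ∉ R) :
    PP om (fun u w => Oc E J (insert a R) u w ≠ Oc E J (insert a' R) u w) ≤ 2 * β := by
  have haJ : a ∉ J := fun h => ha (hJ h)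
  have haJ' : a' ∉ J := fun h => ha' (hJ h)
  have k1 := hβ (insert a J) (insert a R) (by rw [card_insert_of_notMem haJ, hjJ]) (by rw [card_insert_of_notMem ha, hR])
  have k2 := hβ (insert a' J) (insert a' R) (by rw [card_insert_of_notMem haJ', hjJ]) (by rw [card_insert_of_notMem ha', hR])
  have k3 : PP om (fun u w => Oc E (insert a' J) (insert a' R) u w ≠ 0)
      = PP om (fun u w => Oc E J (insert a' R) u w ≠ Oc E J (insert a R) (Function.update u a (w a)) w) := by
    unfold PP
    apply Ex_congr; intro u
    congr 1
    rw [← Ex_comp_perm (Equiv.swap a a')]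
    apply Ex_congr; intro w
    dsimp only
    rw [Oc_insert E haJ']
    have hw : ∀ i ∈ J, (w ∘ Equiv.swap a a') i = w i := by
      intro i hi
      have c1 : i ≠ a := fun h => haJ (h ▸ hi)
      have c2 : i ≠ a' := fun h => haJ' (h ▸ hi)
      simp [Equiv.swap_apply_of_ne_of_ne c1 c2]
    rw [Oc_congr E (fun _ _ => rfl) hw, Oc_congr E (fun _ _ => rfl) hw]
    have : (w ∘ Equiv.swap a a') a' = w a := by simp
    rw [this, Oc_swap E hJ ha ha', sub_ne_zero]
  rw [k3] at k2
  have k4 : PP om (fun u w => Oc E J (insert a R) u w ≠ Oc E J (insert a' R) u w) ≤ _ :=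
    PP_or h0 (ev₁ := fun u w => Oc E (insert a J) (insert a R) u w ≠ 0)
      (ev₂ := fun u w => Oc E J (insert a' R) u w ≠ Oc E J (insert a R) (Function.update u a (w a)) w) (by
      intro u w h
      by_contra hc
      push Not at hc
      obtain ⟨c1, c2⟩ := hc
      rw [Oc_insert E haJ] at c1
      apply h
      rw [c2]; linarith)
  linarith

lemma chain_lemma (E : Finset (Finset W)) {om : (ι → W) → ℝ} (h0 : ∀ u, 0 ≤ om u) {r j : ℕ} {β : ℝ}
    (hβ : ∀ J Q : Finset ι, #J = j + 1 → #Q = r → PP om (fun u w => Oc E J Q u w ≠ 0) ≤ β)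
    {J : Finset ι} (hjJ : #J = j) (n : ℕ) : ∀ Q Q' : Finset ι, #Q = r → #Q' = r → J ⊆ Q → J ⊆ Q' → #(Q \ Q') = n →
    PP om (fun u w => Oc E J Q u w ≠ Oc E J Q' u w) ≤ 2 * n * β := by
  induction n with
  | zero =>
    intro Q Q' hQ hQ' hJ hJ' hn
    rw [card_eq_zero, sdiff_eq_empty_iff_subset] at hn
    have := eq_of_subset_of_card_le hn (by rw [hQ, hQ'])
    subst this
    rw [PP_false (by simp)]; simp
  | succ n ih =>
    intro Q Q' hQ hQ' hJ hJ' hn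
    obtain ⟨a, ha⟩ : (Q \ Q').Nonempty := by rw [← card_pos, hn]; omega
    have hn' : #(Q' \ Q) = n + 1 := by
      have h1 := card_sdiff_add_card_inter Q Q'
      have h2 := card_sdiff_add_card_inter Q' Q
      rw [inter_comm] at h2; omega
    obtain ⟨a', ha'⟩ : (Q' \ Q).Nonempty := by rw [← card_pos, hn']; omega
    rw [mem_sdiff] at ha ha'
    set R := Q.erase a with hRdef
    have hQR : insert a R = Q := insert_erase ha.1
    have haR : a ∉ R := notMem_erase a Q
    have haR' : a' ∉ R := fun h => ha'.2 (mem_of_mem_erase h)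
    have hRc : #R + 1 = r := by rw [← hQ, ← hQR, card_insert_of_notMem haR]
    have hJR : J ⊆ R := by
      intro i hi
      rw [hRdef, mem_erase]
      exact ⟨fun h => ha.2 (hJ' (h ▸ hi)), hJ hi⟩
    have s1 := step_lemma E h0 hβ hjJ hRc hJR haR haR'
    have s2 := ih (insert a' R) Q' (by rw [card_insert_of_notMem haR', hRc]) hQ' (hJR.trans (subset_insert _ _)) hJ' (by
      have : insert a' R \ Q' = (Q \ Q').erase a := by
        ext i
        simp only [hRdef, mem_sdiff, mem_insert, mem_erase]
        constructor
        · rintro ⟨rfl | h, h'⟩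
          · exact absurd ha'.1 h'
          · exact ⟨h.1, h.2, h'⟩
        · rintro ⟨h1, h2, h3⟩; exact ⟨Or.inr ⟨h1, h2⟩, h3⟩
      rw [this, card_erase_of_mem (mem_sdiff.mpr ha), hn]; rfl)
    rw [hQR] at s1
    have s3 : PP om (fun u w => Oc E J Q u w ≠ Oc E J Q' u w) ≤ _ :=
      PP_or h0 (ev₁ := fun u w => Oc E J Q u w ≠ Oc E J (insert a' R) u w)
        (ev₂ := fun u w => Oc E J (insert a' R) u w ≠ Oc E J Q' u w) (by
        intro u w h
        by_contra hc
        push Not at hc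
        exact h (hc.1.trans hc.2))
    push_cast
    linarith

lemma chain_r (E : Finset (Finset W)) {om : (ι → W) → ℝ} (h0 : ∀ u, 0 ≤ om u) {r j : ℕ} {β : ℝ} (hβ0 : 0 ≤ β)
    (hβ : ∀ J Q : Finset ι, #J = j + 1 → #Q = r → PP om (fun u w => Oc E J Q u w ≠ 0) ≤ β)
    {J : Finset ι} (hjJ : #J = j) (Q Q' : Finset ι) (hQ : #Q = r) (hQ' : #Q' = r) (hJ : J ⊆ Q) (hJ' : J ⊆ Q') :
    PP om (fun u w => Oc E J Q u w ≠ Oc E J Q' u w) ≤ 2 * r * β := by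
  refine (chain_lemma E h0 hβ hjJ _ Q Q' hQ hQ' hJ hJ' rfl).trans ?_
  have : ((#(Q \ Q') : ℕ) : ℝ) ≤ r := by
    exact_mod_cast (card_le_card sdiff_subset).trans hQ.le
  have := mul_le_mul_of_nonneg_right this hβ0
  linarith

lemma top_to_Oc (E : Finset (Finset W)) (r : ℕ) {J Q₀ : Finset ι} (hQ₀ : #Q₀ = r) (hJ : J ⊆ Q₀) (u w : ι → W) :
    ind (Oc E J Q₀ u w ≠ 0) ≤ ind (sm E r J u w ≠ 0)
      + (∑ Q ∈ (powersetCard r univ).filter (fun Q => J ⊆ Q), 2 ^ (r + 1) * ind (Oc E J Q u w ≠ Oc E J Q₀ u w))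
        / #((powersetCard r (univ : Finset ι)).filter (fun Q => J ⊆ Q)) := by
  set S := (powersetCard r (univ : Finset ι)).filter (fun Q => J ⊆ Q) with hS
  have hQS : Q₀ ∈ S := by rw [hS, mem_filter, mem_powersetCard]; exact ⟨⟨subset_univ _, hQ₀⟩, hJ⟩
  have hSpos : (0:ℝ) < #S := by exact_mod_cast card_pos.mpr ⟨_, hQS⟩
  have hnn : 0 ≤ (∑ Q ∈ S, 2 ^ (r + 1) * ind (Oc E J Q u w ≠ Oc E J Q₀ u w)) / #S :=
    div_nonneg (sum_nonneg fun Q _ => mul_nonneg (by positivity) (ind_nonneg _)) hSpos.le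
  apply ind_le_of (add_nonneg (ind_nonneg _) hnn)
  intro hne
  by_cases hs : sm E r J u w = 0
  swap
  · rw [ind_true hs]; linarith
  rw [ind_false (by simpa using hs), zero_add, le_div_iff₀ hSpos, one_mul]
  have e1 : ∑ Q ∈ S, Oc E J Q u w = 0 := by
    rw [← hs, sm_eq, hS, sum_filter]
    apply sum_congr rfl; intro Q _
    split_ifs with h
    · rfl
    · exact (Oc_zero E h u w).symm
  have hjr : #J ≤ r := hQ₀ ▸ card_le_card hJ
  have e2 : ∀ Q ∈ S, ((|Oc E J Q₀ u w - Oc E J Q u w| : ℤ) : ℝ) ≤ 2 ^ (r + 1) * ind (Oc E J Q u w ≠ Oc E J Q₀ u w) := by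
    intro Q _
    by_cases h : Oc E J Q u w = Oc E J Q₀ u w
    · rw [h, ind_false (by simp)]; simp
    · rw [ind_true h, mul_one]
      have a1 := Oc_abs E J Q₀ u w
      have a2 := Oc_abs E J Q u w
      have a3 : (2:ℤ) ^ #J ≤ 2 ^ r := pow_le_pow_right₀ (by norm_num) hjr
      have a4 := abs_sub (Oc E J Q₀ u w) (Oc E J Q u w)
      have : |Oc E J Q₀ u w - Oc E J Q u w| ≤ 2 ^ (r + 1) := by rw [pow_succ]; linarith
      exact_mod_cast this
  refine le_trans ?_ (sum_le_sum e2)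
  have e3 : (#S : ℤ) ≤ ∑ Q ∈ S, |Oc E J Q₀ u w - Oc E J Q u w| := by
    refine le_trans ?_ (abs_sum_le_sum_abs _ _)
    rw [sum_sub_distrib, e1, sub_zero, sum_const, nsmul_eq_mul, abs_mul]
    have : 1 ≤ |Oc E J Q₀ u w| := Int.one_le_abs hne
    have h2 : |((#S : ℕ) : ℤ)| = #S := by simp
    rw [h2]; nlinarith
  exact_mod_cast e3

lemma beta_lemma (E : Finset (Finset W)) {om : (ι → W) → ℝ} (h0 : ∀ u, 0 ≤ om u) {r : ℕ} {γ : ℝ} (hγ : 0 ≤ γ)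
    (hs : ∀ J : Finset ι, 0 < #J → #J ≤ r → PP om (fun u w => sm E r J u w ≠ 0) ≤ γ) (t : ℕ) :
    t < r → ∀ J Q : Finset ι, #J + t = r → #Q = r →
      PP om (fun u w => Oc E J Q u w ≠ 0) ≤ γ * (1 + 2 ^ (r + 1) * (2 * r)) ^ t := by
  have hc : (0:ℝ) ≤ 2 ^ (r + 1) * (2 * r) := by positivity
  induction t with
  | zero =>
    intro ht J Q hJ hQ
    by_cases hJQ : J ⊆ Q
    swap
    · rw [PP_false (fun u w => by simpa using Oc_zero E hJQ u w)]; positivity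
    have := eq_of_subset_of_card_le hJQ (by omega)
    subst this
    rw [pow_zero, mul_one]
    refine le_trans (PP_mono h0 ?_) (hs J (by omega) (by omega))
    intro u w h
    rw [sm_eq, sum_eq_single J]
    · exact h
    · intro Q hQ' hne
      apply Oc_zero
      intro hsub
      exact hne (eq_of_subset_of_card_le hsub (by rw [(mem_powersetCard.mp hQ').2, hQ])).symm
    · intro h'; exact absurd (mem_powersetCard.mpr ⟨subset_univ _, hQ⟩) h'
  | succ t ih =>
    intro ht J Q₀ hJ hQ₀
    by_cases hJQ : J ⊆ Q₀
    swap
    · rw [PP_false (fun u w => by simpa using Oc_zero E hJQ u w)]; positivity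
    set β := γ * (1 + 2 ^ (r + 1) * (2 * (r:ℝ))) ^ t with hβdef
    have hβ0 : 0 ≤ β := by positivity
    have hch := fun Q Q' => chain_r E h0 (j := #J) hβ0 (fun J' Q hJ' hQ => ih (by omega) J' Q (by omega) hQ) (J := J) rfl Q Q'
    set S := (powersetCard r (univ : Finset ι)).filter (fun Q => J ⊆ Q) with hS
    have hQS : Q₀ ∈ S := by rw [hS, mem_filter, mem_powersetCard]; exact ⟨⟨subset_univ _, hQ₀⟩, hJQ⟩
    have hSpos : (0:ℝ) < #S := by exact_mod_cast card_pos.mpr ⟨_, hQS⟩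
    have m1 : PP om (fun u w => Oc E J Q₀ u w ≠ 0) ≤ PP om (fun u w => sm E r J u w ≠ 0)
        + (∑ Q ∈ S, 2 ^ (r + 1) * PP om (fun u w => Oc E J Q u w ≠ Oc E J Q₀ u w)) / #S := by
      have : PP om (fun u w => sm E r J u w ≠ 0)
        + (∑ Q ∈ S, 2 ^ (r + 1) * PP om (fun u w => Oc E J Q u w ≠ Oc E J Q₀ u w)) / #S
        = Ex (fun u => om u * Ex (fun w => ind (sm E r J u w ≠ 0)
          + (∑ Q ∈ S, 2 ^ (r + 1) * ind (Oc E J Q u w ≠ Oc E J Q₀ u w)) / #S)) := by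
        simp only [Ex_add, Ex_div, Ex_sum, Ex_mul_left, mul_add, PP]
        congr 1
        rw [show (fun u => om u * ((∑ Q ∈ S, 2 ^ (r + 1) * Ex (fun w => ind (Oc E J Q u w ≠ Oc E J Q₀ u w))) / #S))
          = (fun u => (∑ Q ∈ S, 2 ^ (r + 1) * (om u * Ex (fun w => ind (Oc E J Q u w ≠ Oc E J Q₀ u w)))) / #S) by
            funext u
            rw [← mul_div_assoc, mul_sum]
            congr 1
            apply sum_congr rfl; intro Q _; ring]
        rw [Ex_div, Ex_sum]
        simp only [Ex_mul_left]
      rw [this]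
      apply Ex_mono; intro u
      apply mul_le_mul_of_nonneg_left _ (h0 u)
      apply Ex_mono; intro w
      exact top_to_Oc E r hQ₀ hJQ u w
    have m2 : (∑ Q ∈ S, 2 ^ (r + 1) * PP om (fun u w => Oc E J Q u w ≠ Oc E J Q₀ u w)) / #S ≤ 2 ^ (r + 1) * (2 * r * β) := by
      rw [div_le_iff₀ hSpos]
      refine (sum_le_sum (g := fun _ => 2 ^ (r + 1) * (2 * r * β)) ?_).trans ?_
      · intro Q hQ
        rw [hS, mem_filter, mem_powersetCard] at hQ
        exact mul_le_mul_of_nonneg_left (hch Q Q₀ hQ.1.2 hQ₀ hQ.2 hJQ) (by positivity)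
      · rw [sum_const, nsmul_eq_mul]; linarith
    have m3 := hs J (by omega) (by omega)
    have m4 : γ ≤ β := by
      rw [hβdef]
      exact le_mul_of_one_le_right hγ (one_le_pow₀ (by linarith))
    rw [pow_succ, ← mul_assoc, ← hβdef]
    linarith

lemma claim2 (E : Finset (Finset W)) {om : (ι → W) → ℝ} (h0 : ∀ u, 0 ≤ om u) {r : ℕ} (hr : 0 < r)
    (hk : r ≤ Fintype.card ι) {M : ℝ} {α : ℝ} (hα : 0 < α) (hα1 : α ≤ 1 / 2)
    (hs : ∀ J : Finset ι, 0 < #J → #J ≤ r → PP om (fun u w => sm E r J u w ≠ 0) ≤ Ex om / M)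
    (hM : 2 * r * (1 + 2 ^ (r + 1) * (2 * r)) ^ r / α < M) (ℓ : ℤ)
    (hom : ∀ u, om u ≠ 0 → fe E r u = ℓ)
    (hl1 : α * ((Fintype.card ι).choose r : ℝ) ≤ ℓ) (hl2 : (ℓ:ℝ) ≤ (1 - α) * ((Fintype.card ι).choose r : ℝ)) :
    Ex om = 0 := by
  rcases isEmpty_or_nonempty (ι → W) with hE | hE
  · unfold Ex; simp
  have hp0 : 0 ≤ Ex om := Ex_nonneg h0
  set D : ℝ := (1 + 2 ^ (r + 1) * (2 * r)) ^ (r - 1) with hD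
  have hD1 : (0:ℝ) ≤ D := by positivity
  have hDle : D ≤ (1 + 2 ^ (r + 1) * (2 * r)) ^ r := by
    apply pow_le_pow_right₀ _ (by omega)
    have : (0:ℝ) ≤ 2 ^ (r + 1) * (2 * r) := by positivity
    linarith
  have hMpos : 0 < M := lt_of_le_of_lt (by positivity) hM
  have hγ : 0 ≤ Ex om / M := div_nonneg hp0 hMpos.le
  have hb := beta_lemma E h0 hγ hs (r - 1) (by omega)
  have hch := fun Q Q' => chain_r E h0 (j := 0) (β := Ex om / M * D) (by positivity)
    (fun J' Q hJ' hQ => hb J' Q (by omega) hQ) (J := ∅) rfl Q Q'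
  have hOc : ∀ Q (u w : ι → W), Oc E ∅ Q u w = ph E u Q := by
    intro Q u w; unfold Oc; simp
  simp only [hOc] at hch
  set P := powersetCard r (univ : Finset ι) with hP
  have hPc : #P = (Fintype.card ι).choose r := by rw [hP, card_powersetCard, card_univ]
  set N : ℝ := ((Fintype.card ι).choose r : ℝ) with hN
  have hNpos : 0 < N := by rw [hN]; exact_mod_cast Nat.choose_pos hk
  have hsum : ∀ u : ι → W, om u * (α * N ^ 2) ≤ om u * (∑ Q ∈ P, ∑ Q' ∈ P, ind (ph E u Q ≠ ph E u Q')) := by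
    intro u
    by_cases hu : om u = 0
    · simp [hu]
    apply mul_le_mul_of_nonneg_left _ (h0 u)
    have hf := hom u hu
    have e1 : ∀ Q Q', ind (ph E u Q ≠ ph E u Q') = (ph E u Q : ℝ) + ph E u Q' - 2 * ph E u Q * ph E u Q' := by
      intro Q Q'
      unfold ph
      split_ifs <;> simp [ind] <;> norm_num
    have hf' : ∑ Q ∈ P, (ph E u Q : ℝ) = ℓ := by
      rw [← hf]; unfold fe; push_cast; rfl
    have e2 : ∑ Q ∈ P, ∑ Q' ∈ P, ind (ph E u Q ≠ ph E u Q') = 2 * N * ℓ - 2 * (ℓ:ℝ) ^ 2 := by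
      simp only [e1, sum_sub_distrib, sum_add_distrib, sum_const, nsmul_eq_mul, ← mul_sum, ← sum_mul, hf', hPc]
      rw [← hN]; ring
    rw [e2]
    have h3 : 0 ≤ ((ℓ:ℝ) - α * N) * ((1 - α) * N - ℓ) := mul_nonneg (by linarith) (by linarith)
    have h4 : 0 ≤ α * (1 - 2 * α) * N ^ 2 := mul_nonneg (mul_nonneg hα.le (by linarith)) (by positivity)
    nlinarith
  have h1 := Ex_mono hsum
  rw [Ex_mul_right] at h1
  have h2 : Ex (fun u => om u * (∑ Q ∈ P, ∑ Q' ∈ P, ind (ph E u Q ≠ ph E u Q'))) ≤ N ^ 2 * (2 * r * (Ex om / M * D)) := by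
    simp only [mul_sum, Ex_sum]
    calc _ ≤ ∑ Q ∈ P, ∑ Q' ∈ P, 2 * r * (Ex om / M * D) := by
          apply sum_le_sum; intro Q hQ
          apply sum_le_sum; intro Q' hQ'
          have := hch Q Q' (mem_powersetCard.mp hQ).2 (mem_powersetCard.mp hQ').2 (empty_subset _) (empty_subset _)
          unfold PP at this
          simpa only [Ex_const] using this
      _ = _ := by simp only [sum_const, nsmul_eq_mul, hPc]; rw [← hN]; ring
  have h3 : Ex om * α ≤ 2 * r * (Ex om / M * D) := by
    have := h1.trans h2
    have hN2 : 0 < N ^ 2 := by positivity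
    rw [show Ex om * (α * N ^ 2) = N ^ 2 * (Ex om * α) by ring] at this
    exact le_of_mul_le_mul_left this hN2
  by_contra hne
  have hpp : 0 < Ex om := lt_of_le_of_ne hp0 (Ne.symm hne)
  rw [div_lt_iff₀ hα] at hM
  have h4 : 2 * (r:ℝ) * D < M * α := lt_of_le_of_lt (mul_le_mul_of_nonneg_left hDle (by positivity)) hM
  have h5 : Ex om * α * M ≤ 2 * r * D * Ex om := by
    have := mul_le_mul_of_nonneg_right h3 hMpos.le
    have e : 2 * (r:ℝ) * (Ex om / M * D) * M = 2 * r * D * Ex om := by field_simp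
    linarith
  have h6 := mul_lt_mul_of_pos_right h4 hpp
  linarith

end claim
end EdgeStat

namespace EdgeStat
set_option linter.all false

section blocks
variable {ι W : Type} [Fintype ι] [DecidableEq ι] [Fintype W] [DecidableEq W]

lemma av_perm (E : Finset (Finset W)) (r : ℕ) (u : ι → W) (π : Equiv.Perm ι) (J : Finset ι) :
    av (hh E r (u ∘ π)) J = av (hh E r u) J := by
  unfold av
  simp only [hh_perm, ← image_mul]
  exact Ex_perm_left π (fun τ => hh E r u (J.image τ))

lemma NN_perm (E : Finset (Finset W)) (r : ℕ) (ℓ : ℤ) (u w : ι → W) (π : Equiv.Perm ι) (B : Finset ι) :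
    NN (fun v : ι → W => ((fe E r v - ℓ : ℤ) : ℝ)) B (u ∘ π) (w ∘ π) ↔ NN (fun v => ((fe E r v - ℓ : ℤ) : ℝ)) (B.image π) u w := by
  unfold NN
  constructor
  · rintro ⟨X, hX, h⟩
    rw [pw_comp] at h
    simp only [fe_perm] at h
    exact ⟨X.image π, image_subset_image hX, h⟩
  · rintro ⟨X, hX, h⟩
    rw [subset_image_iff] at hX
    obtain ⟨Y, hY, rfl⟩ := hX
    refine ⟨Y, hY, ?_⟩
    rw [pw_comp]
    simp only [fe_perm]
    exact h

/-- the good weights -/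
def Aset (E : Finset (Finset W)) (r M : ℕ) (ℓ : ℤ) (u : ι → W) : Prop :=
  fe E r u = ℓ ∧ ∀ J : Finset ι, 0 < #J → #J ≤ r → M * av (hh E r u) J < 1

lemma Aset_perm (E : Finset (Finset W)) (r M : ℕ) (ℓ : ℤ) (u : ι → W) (π : Equiv.Perm ι) :
    Aset E r M ℓ (u ∘ π) ↔ Aset E r M ℓ u := by
  unfold Aset; simp only [fe_perm, av_perm]

lemma Aset_sm (E : Finset (Finset W)) (r M : ℕ) (ℓ : ℤ) (hM : 0 < M) (J : Finset ι) (h1 : 0 < #J) (h2 : #J ≤ r) :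
    PP (fun u : ι → W => ind (Aset E r M ℓ u)) (fun u w => sm E r J u w ≠ 0) ≤ Ex (fun u : ι → W => ind (Aset E r M ℓ u)) / M := by
  have hM' : (0:ℝ) < M := by exact_mod_cast hM
  have e1 : ∀ π : Equiv.Perm ι, PP (fun u : ι → W => ind (Aset E r M ℓ u)) (fun u w => sm E r J u w ≠ 0)
      = Ex (fun u : ι → W => ind (Aset E r M ℓ u) * hh E r u (J.image π)) := by
    intro π
    unfold PP
    rw [← Ex_comp_perm π]
    apply Ex_congr; intro u
    dsimp only
    rw [← hh_perm, propext (Aset_perm E r M ℓ u π)]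
    rfl
  have e2 : PP (fun u : ι → W => ind (Aset E r M ℓ u)) (fun u w => sm E r J u w ≠ 0)
      = Ex (fun u : ι → W => ind (Aset E r M ℓ u) * av (hh E r u) J) := by
    rw [← Ex_const (Ω := Equiv.Perm ι) (PP _ _)]
    rw [Ex_congr e1, Ex_comm]
    apply Ex_congr; intro u
    rw [Ex_mul_left]; rfl
  rw [e2, ← Ex_div]
  apply Ex_mono; intro u
  by_cases hA : Aset E r M ℓ u
  · rw [ind_true hA, one_mul, le_div_iff₀ hM']
    linarith [hA.2 J h1 h2]
  · rw [ind_false hA]; simp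

lemma family (B : Finset ι) {M r j : ℕ} (hB : M * r ≤ #B) (hj : j ≤ r) : ∃ J : Fin M → Finset ι,
    (∀ c, J c ⊆ B) ∧ (∀ c, #(J c) = j) ∧ ∀ c c', c ≠ c' → Disjoint (J c) (J c') := by
  obtain ⟨f⟩ : Nonempty (Fin M × Fin r ↪ B) := by
    rw [Function.Embedding.nonempty_iff_card_le]; simpa using hB
  have hinj : Function.Injective (fun p : Fin M × Fin r => ((f p : B) : ι)) := Subtype.val_injective.comp f.injective
  refine ⟨fun c => (univ : Finset (Fin j)).image (fun i => ((f (c, Fin.castLE hj i) : B) : ι)), ?_, ?_, ?_⟩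
  · intro c x hx
    obtain ⟨i, -, rfl⟩ := mem_image.mp hx
    exact (f _).2
  · intro c
    rw [card_image_of_injective, card_univ, Fintype.card_fin]
    intro a b hab
    have := hinj hab
    simpa using this
  · intro c c' hc
    rw [disjoint_left]
    intro x hx hx'
    obtain ⟨i, -, rfl⟩ := mem_image.mp hx
    obtain ⟨i', -, h⟩ := mem_image.mp hx'
    have := hinj h
    simp at this
    exact hc this.1.symm

lemma block_lower [Nonempty W] (E : Finset (Finset W)) {r : ℕ} (hr : 0 < r) {M : ℕ} (B : Finset ι) (hB : M * r ≤ #B)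
    (hk : 2 * r ^ 2 ≤ Fintype.card ι) {α : ℝ} (hα : 0 < α) (hα1 : α ≤ 1 / 2)
    (hM : 2 * r * (1 + 2 ^ (r + 1) * (2 * r)) ^ r / α < (M:ℝ)) (ℓ : ℤ)
    (hl1 : α * ((Fintype.card ι).choose r : ℝ) ≤ ℓ) (hl2 : (ℓ:ℝ) ≤ (1 - α) * ((Fintype.card ι).choose r : ℝ)) :
    Ex (fun u : ι → W => ind (((fe E r u - ℓ : ℤ) : ℝ) = 0)) ≤
      12 * Ex (fun u : ι → W => Ex (fun w : ι → W => ind (((fe E r u - ℓ : ℤ) : ℝ) = 0 ∧ NN (fun v => ((fe E r v - ℓ : ℤ) : ℝ)) B u w))) := by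
  have hMpos : (0:ℝ) < M := lt_of_le_of_lt (by positivity) hM
  have hMpos' : 0 < M := by exact_mod_cast hMpos
  have hrk : r ≤ Fintype.card ι := by nlinarith
  have hz := claim2 E (om := fun u : ι → W => ind (Aset E r M ℓ u)) (fun u => ind_nonneg _) hr hrk hα hα1
    (Aset_sm E r M ℓ hMpos') hM ℓ (by
      intro u hu
      by_contra hne
      exact hu (ind_false fun h => hne h.1)) hl1 hl2
  have hz' := Ex_eq_zero (fun u => ind_nonneg _) hz
  have key : ∀ u : ι → W, ind (((fe E r u - ℓ : ℤ) : ℝ) = 0) ≤ 12 * Ex (fun π : Equiv.Perm ι => Ex (fun w : ι → W =>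
      ind (((fe E r u - ℓ : ℤ) : ℝ) = 0 ∧ NN (fun v => ((fe E r v - ℓ : ℤ) : ℝ)) (B.image π) u w))) := by
    intro u
    apply ind_le_of
    · exact mul_nonneg (by norm_num) (Ex_nonneg fun π => Ex_nonneg fun w => ind_nonneg _)
    intro hu
    have hu' : fe E r u = ℓ := by
      have : fe E r u - ℓ = 0 := by exact_mod_cast hu
      linarith
    have hnA : ¬ Aset E r M ℓ u := by
      intro h; have := hz' u; rw [ind_true h] at this; norm_num at this
    unfold Aset at hnA
    push Not at hnA
    obtain ⟨J, hJ1, hJ2, hJ3⟩ := hnA hu'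
    obtain ⟨Jf, f1, f2, f3⟩ := family B hB hJ2
    have := second_moment E r u Jf B f1 f2 hJ1 f3 (le_trans (Nat.mul_le_mul_left 2 (Nat.pow_le_pow_left hJ2 2)) hk) ℓ (av (hh E r u) J)
      (fun c => av_eq _ (f2 c)) hJ3
    have e : ∀ π : Equiv.Perm ι, ∀ w : ι → W, (((fe E r u - ℓ : ℤ) : ℝ) = 0 ∧ NN (fun v => ((fe E r v - ℓ : ℤ) : ℝ)) (B.image π) u w)
      = NN (fun v => ((fe E r v - ℓ : ℤ) : ℝ)) (B.image π) u w := by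
      intro π w; apply propext; exact ⟨fun h => h.2, fun h => ⟨hu, h⟩⟩
    simp only [e]
    linarith
  refine (Ex_mono key).trans ?_
  rw [Ex_mul_left, Ex_comm]
  apply mul_le_mul_of_nonneg_left _ (by norm_num)
  apply Ex_le_const
  intro π
  apply le_of_eq
  rw [← Ex_comp_perm π (fun u : ι → W => Ex (fun w : ι → W => ind (((fe E r u - ℓ : ℤ) : ℝ) = 0 ∧ NN (fun v => ((fe E r v - ℓ : ℤ) : ℝ)) B u w)))]
  apply Ex_congr; intro u
  rw [← Ex_comp_perm π (fun w : ι → W => ind (((fe E r (u ∘ π) - ℓ : ℤ) : ℝ) = 0 ∧ NN (fun v => ((fe E r v - ℓ : ℤ) : ℝ)) B (u ∘ π) w))]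
  apply Ex_congr; intro w
  rw [propext (NN_perm E r ℓ u w π B), fe_perm]

lemma fe_Jun (E : Finset (Finset W)) {r : ℕ} (hr : 0 < r) (ℓ : ℤ) : Jun r (fun v : ι → W => ((fe E r v - ℓ : ℤ) : ℝ)) := by
  refine ⟨insert ∅ (powersetCard r univ), fun Q v => if Q = ∅ then -(ℓ:ℝ) else (ph E v Q : ℝ), ?_, ?_, ?_⟩
  · intro Q hQ
    rcases mem_insert.mp hQ with rfl | h
    · simp
    · exact (mem_powersetCard.mp h).2.le
  · intro Q hQ v v' h
    dsimp only
    split_ifs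
    · rfl
    · rw [ph_congr E h]
  · intro v
    have hn : (∅ : Finset ι) ∉ powersetCard r univ := by
      rw [mem_powersetCard]; simp; omega
    rw [sum_insert hn]
    dsimp only
    rw [if_pos rfl]
    have : ∀ Q ∈ powersetCard r (univ : Finset ι), (if Q = ∅ then -(ℓ:ℝ) else (ph E v Q : ℝ)) = (ph E v Q : ℝ) := by
      intro Q hQ
      rw [if_neg]; rintro rfl; exact hn hQ
    rw [sum_congr rfl this]
    unfold fe
    push_cast
    ring

lemma fiber_card {k s m : ℕ} (hm : 0 < m) (hk : s * m ≤ k) (c : Fin m) :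
    s ≤ #((univ : Finset (Fin k)).filter (fun i => (⟨i.1 % m, Nat.mod_lt _ hm⟩ : Fin m) = c)) := by
  have hlt : ∀ t : Fin s, c.1 + t.1 * m < k := by
    intro t
    have h1 : (t.1 + 1) * m ≤ s * m := Nat.mul_le_mul_right m t.2
    have h2 := c.2
    rw [add_mul] at h1
    omega
  have : #((univ : Finset (Fin s)).image (fun t => (⟨c.1 + t.1 * m, hlt t⟩ : Fin k))) = s := by
    rw [card_image_of_injective, card_univ, Fintype.card_fin]
    intro a b hab
    simp only [Fin.mk.injEq, add_right_inj] at hab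
    exact Fin.ext (Nat.eq_of_mul_eq_mul_right hm hab)
  conv_lhs => rw [← this]
  apply card_le_card
  intro x hx
  obtain ⟨t, -, rfl⟩ := mem_image.mp hx
  rw [mem_filter]
  refine ⟨mem_univ _, Fin.ext ?_⟩
  simp [Nat.add_mul_mod_self_right, Nat.mod_eq_of_lt c.2]

set_option maxHeartbeats 800000 in
lemma prob_bound (r : ℕ) (hr : 0 < r) (ε : ℝ) (hε : 0 < ε) (hε1 : ε ≤ 1 / 2) : ∃ C : ℝ, 0 < C ∧ ∃ K₀ : ℝ, ∀ (k : ℕ) (ℓ : ℤ) (α : ℝ) (W : Type)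
    [Fintype W] [DecidableEq W] [Nonempty W] (E : Finset (Finset W)), 0 < α → α ≤ 1 / 2 → K₀ ≤ α * k →
    α * (k.choose r : ℝ) ≤ ℓ → (ℓ:ℝ) ≤ (1 - α) * (k.choose r : ℝ) →
    Ex (fun v : Fin k → W => ind (fe E r v = ℓ)) ≤ C * (α * k) ^ (-(1 / 2 - ε) : ℝ) := by
  obtain ⟨K, hK, hsum⟩ := sum_nu r ε hε hε1
  set D : ℝ := 2 * r * (1 + 2 ^ (r + 1) * (2 * r)) ^ r with hD
  have hD0 : 0 ≤ D := by positivity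
  have hr' : (1:ℝ) ≤ r := by exact_mod_cast hr
  set Z : ℝ := 2 * r * (D + 1) with hZ
  have hZpos : 0 < Z := by positivity
  refine ⟨24 * 9 ^ r * K * (1 / Z) ^ (-(1 / 2 - ε) : ℝ), by positivity, 2 * Z + 2 * r ^ 2, ?_⟩
  intro k ℓ α W _ _ _ E hα hα1 hk hl1 hl2
  have hk1 : Z ≤ α * k := by nlinarith
  have hkα : α * k ≤ k := by nlinarith [(Nat.cast_nonneg k : (0:ℝ) ≤ k)]
  have hk2 : 2 * r ^ 2 ≤ k := by
    have : 2 * (r:ℝ) ^ 2 ≤ k := by linarith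
    exact_mod_cast this
  set M : ℕ := ⌊D / α⌋₊ + 1 with hM
  have hM1 : D / α < M := by rw [hM]; push_cast; exact Nat.lt_floor_add_one _
  have hM2 : (M:ℝ) ≤ (D + 1) / α := by
    rw [hM, add_div]; push_cast
    have h1 := Nat.floor_le (div_nonneg hD0 hα.le)
    have h2 : 1 ≤ 1 / α := by rw [le_div_iff₀ hα]; linarith
    linarith
  set s := M * r with hs
  have hspos : 0 < s := Nat.mul_pos (Nat.succ_pos _) hr
  have hs2 : (s:ℝ) * (2 * α) ≤ Z := by
    rw [hs, hZ]; push_cast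
    rw [le_div_iff₀ hα] at hM2
    nlinarith
  set m := k / s with hm
  have hmk : s * m ≤ k := by rw [hm]; exact Nat.mul_div_le k s
  have hm1 : (k:ℝ) < s * (m + 1) := by
    have := Nat.lt_mul_div_succ k hspos
    rw [← hm] at this
    exact_mod_cast this
  have hspos' : (0:ℝ) < s := by exact_mod_cast hspos
  have hm2 : 2 * (α * k) ≤ Z * (m + 1) := by
    have : (k:ℝ) * (2 * α) ≤ s * (m + 1) * (2 * α) := mul_le_mul_of_nonneg_right hm1.le (by linarith)
    have h2 : s * (2 * α) * ((m:ℝ) + 1) ≤ Z * (m + 1) := mul_le_mul_of_nonneg_right hs2 (by positivity)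
    linarith
  have hm3 : α * k * (1 / Z) ≤ m := by
    rw [mul_one_div, div_le_iff₀ hZpos]
    linarith
  have hmpos' : (0:ℝ) < m := lt_of_lt_of_le (by positivity) (le_trans (by
    rw [mul_one_div, le_div_iff₀ hZpos, one_mul]; exact hk1 : (1:ℝ) ≤ α * k * (1 / Z)) hm3)
  have hmpos : 0 < m := by exact_mod_cast hmpos'
  set p := Ex (fun v : Fin k → W => ind (fe E r v = ℓ)) with hp
  have hp' : p = Ex (fun v : Fin k → W => ind (((fe E r v - ℓ : ℤ) : ℝ) = 0)) := by
    rw [hp]; apply Ex_congr; intro v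
    congr 1; apply propext
    rw [Int.cast_eq_zero, sub_eq_zero]
  have hJ := fe_Jun (ι := Fin k) E hr ℓ
  have h1 := hsum (Fin k) W _ hJ m (fun i => ⟨i.1 % m, Nat.mod_lt _ hmpos⟩)
  have h2 : ∀ c : Fin m, p ≤ 24 * 9 ^ r * nu (fun v : Fin k → W => ((fe E r v - ℓ : ℤ) : ℝ))
      (univ.filter (fun i : Fin k => (⟨i.1 % m, Nat.mod_lt _ hmpos⟩ : Fin m) = c)) := by
    intro c
    have a1 := block_lower (ι := Fin k) (W := W) E hr _ (fiber_card hmpos hmk c) (by simpa using hk2) hα hα1 hM1 ℓ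
      (by simpa using hl1) (by simpa using hl2)
    have a2 := nu_lower hJ (univ.filter (fun i : Fin k => (⟨i.1 % m, Nat.mod_lt _ hmpos⟩ : Fin m) = c))
    rw [← hp'] at a1
    linarith
  have h3 : (m:ℝ) * p ≤ 24 * 9 ^ r * (K * (m:ℝ) ^ (1 / 2 + ε)) := by
    have := sum_le_sum (fun c (_ : c ∈ (univ : Finset (Fin m))) => h2 c)
    rw [sum_const, card_univ, Fintype.card_fin, nsmul_eq_mul, ← mul_sum] at this
    refine this.trans ?_
    exact mul_le_mul_of_nonneg_left h1 (by positivity)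
  have h4 : p ≤ 24 * 9 ^ r * K * (m:ℝ) ^ (-(1 / 2 - ε) : ℝ) := by
    have e : (m:ℝ) ^ (1 / 2 + ε) = m * (m:ℝ) ^ (-(1 / 2 - ε) : ℝ) := by
      rw [show (1 / 2 + ε : ℝ) = 1 + -(1 / 2 - ε) by ring, Real.rpow_add hmpos', Real.rpow_one]
    rw [e] at h3
    apply le_of_mul_le_mul_left _ hmpos'
    linarith
  refine h4.trans ?_
  have hαk : 0 < α * k := lt_of_lt_of_le hZpos hk1
  have h5 : (m:ℝ) ^ (-(1 / 2 - ε) : ℝ) ≤ (α * k * (1 / Z)) ^ (-(1 / 2 - ε) : ℝ) :=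
    Real.rpow_le_rpow_of_nonpos (by positivity) hm3 (by linarith)
  rw [Real.mul_rpow hαk.le (by positivity)] at h5
  have h6 := mul_le_mul_of_nonneg_left h5 (by positivity : 0 ≤ 24 * 9 ^ r * K)
  linarith

lemma prob_final (r : ℕ) (hr : 0 < r) (ε : ℝ) (hε : 0 < ε) : ∃ K₀ : ℝ, ∀ (k : ℕ) (ℓ : ℤ) (α : ℝ) (W : Type)
    [Fintype W] [DecidableEq W] [Nonempty W] (E : Finset (Finset W)), 0 < α → α ≤ 1 / 2 → K₀ ≤ α * k →
    α * (k.choose r : ℝ) ≤ ℓ → (ℓ:ℝ) ≤ (1 - α) * (k.choose r : ℝ) →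
    Ex (fun v : Fin k → W => ind (fe E r v = ℓ)) ≤ (α * k) ^ (-(1 / 2 - ε) : ℝ) := by
  set δ := min ε (1 / 2) / 2 with hδ
  have hδ0 : 0 < δ := by positivity
  have hδ1 : δ ≤ 1 / 2 := by have := min_le_right ε (1/2); linarith
  have hδ2 : 2 * δ ≤ ε := by have := min_le_left ε (1/2); linarith
  obtain ⟨C, hC, K₀, h⟩ := prob_bound r hr δ hδ0 hδ1
  refine ⟨max K₀ (max 1 (C ^ (1 / δ))), ?_⟩
  intro k ℓ α W _ _ _ E hα hα1 hk hl1 hl2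
  have k1 : K₀ ≤ α * k := (le_max_left _ _).trans hk
  have k2 : 1 ≤ α * k := (le_max_left _ _).trans ((le_max_right _ _).trans hk)
  have k3 : C ^ (1 / δ) ≤ α * k := (le_max_right _ _).trans ((le_max_right _ _).trans hk)
  refine (h k ℓ α W E hα hα1 k1 hl1 hl2).trans ?_
  have hpos : 0 < α * k := by linarith
  have c1 : C ≤ (α * k) ^ δ := by
    have := Real.rpow_le_rpow (by positivity) k3 hδ0.le
    rwa [← Real.rpow_mul hC.le, one_div_mul_cancel hδ0.ne', Real.rpow_one] at this
  calc C * (α * k) ^ (-(1 / 2 - δ) : ℝ) ≤ (α * k) ^ δ * (α * k) ^ (-(1 / 2 - δ) : ℝ) := by gcongr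
    _ = (α * k) ^ (δ + -(1 / 2 - δ) : ℝ) := (Real.rpow_add hpos _ _).symm
    _ ≤ _ := Real.rpow_le_rpow_of_exponent_le k2 (by linarith)

end blocks
end EdgeStat

namespace EdgeStat
set_option linter.all false

lemma fe_count {n k : ℕ} (r : ℕ) (E : Finset (Finset (Fin n))) (hE : ∀ e ∈ E, e.card = r) (v : Fin k → Fin n)
    (hv : Function.Injective v) (U : Finset (Fin n)) (hU : univ.image v = U) :
    fe E r v = ((E.filter (fun e => e ⊆ U)).card : ℤ) := by
  have h1 : fe E r v = ((((powersetCard r (univ : Finset (Fin k))).filter (fun Q => Q.image v ∈ E)).card : ℕ) : ℤ) := by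
    unfold fe ph
    rw [card_filter]; push_cast
    rfl
  rw [h1]
  congr 1
  apply card_bij (fun Q _ => Q.image v)
  · intro Q hQ
    rw [mem_filter] at hQ ⊢
    refine ⟨hQ.2, ?_⟩
    rw [← hU]; exact image_subset_image (subset_univ _)
  · intro Q _ Q' _ h
    exact image_injective hv h
  · intro e he
    rw [mem_filter] at he
    obtain ⟨Q, -, hQ⟩ := subset_image_iff.mp (hU ▸ he.2 : e ⊆ univ.image v)
    refine ⟨Q, ?_, hQ⟩
    rw [mem_filter, mem_powersetCard]
    refine ⟨⟨subset_univ _, ?_⟩, hQ ▸ he.1⟩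
    rw [← hE e he.1, ← hQ, card_image_of_injective _ hv]

lemma count_le {n k : ℕ} (hn : 0 < n) (r ℓ : ℕ) (E : Finset (Finset (Fin n))) (hE : ∀ e ∈ E, e.card = r) :
    (((((Finset.univ : Finset (Fin n)).powersetCard k).filter (fun U => (E.filter (fun e => e ⊆ U)).card = ℓ)).card : ℕ) : ℝ) * k.factorial
      ≤ (n:ℝ) ^ k * Ex (fun v : Fin k → Fin n => ind (fe E r v = (ℓ:ℤ))) := by
  haveI : Nonempty (Fin n) := ⟨⟨0, hn⟩⟩
  have hg : ∀ U : Finset (Fin n), ∃ g : Fin k → Fin n, U.card = k → Function.Injective g ∧ univ.image g = U := by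
    intro U
    by_cases h : U.card = k
    · refine ⟨U.orderEmbOfFin h, fun _ => ⟨(U.orderEmbOfFin h).injective, ?_⟩⟩
      exact image_orderEmbOfFin_univ U h
    · exact ⟨fun _ => Classical.arbitrary _, fun h' => absurd h' h⟩
  choose g hg using hg
  set A := ((Finset.univ : Finset (Fin n)).powersetCard k).filter (fun U => (E.filter (fun e => e ⊆ U)).card = ℓ) with hA
  set S := (univ : Finset (Fin k → Fin n)).filter (fun v => fe E r v = (ℓ:ℤ)) with hS
  have hAm : ∀ U ∈ A, U.card = k ∧ (E.filter (fun e => e ⊆ U)).card = ℓ := by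
    intro U hU
    rw [hA, mem_filter, mem_powersetCard] at hU
    exact ⟨hU.1.2, hU.2⟩
  have himg : ∀ (U : Finset (Fin n)) (σ : Equiv.Perm (Fin k)), U.card = k → univ.image (g U ∘ σ) = U := by
    intro U σ hU
    rw [← image_image, image_univ_equiv]
    exact (hg U hU).2
  have hc : (A ×ˢ (univ : Finset (Equiv.Perm (Fin k)))).card ≤ S.card := by
    apply card_le_card_of_injOn (fun p => g p.1 ∘ p.2)
    · intro p hp
      have hp1 := (mem_product.mp hp).1
      have h := hAm p.1 hp1
      rw [mem_coe, hS, mem_filter]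
      refine ⟨mem_univ _, ?_⟩
      rw [fe_count r E hE (g p.1 ∘ p.2) ((hg p.1 h.1).1.comp p.2.injective) p.1 (himg p.1 p.2 h.1), h.2]
    · intro p hp q hq hpq
      have hp1 := hAm p.1 (mem_product.mp hp).1
      have hq1 := hAm q.1 (mem_product.mp hq).1
      simp only at hpq
      have e : p.1 = q.1 := by rw [← himg p.1 p.2 hp1.1, hpq, himg q.1 q.2 hq1.1]
      apply Prod.ext e
      rw [e] at hpq
      apply Equiv.ext; intro i
      exact (hg q.1 hq1.1).1 (congrFun hpq i)
  rw [card_product, card_univ, Fintype.card_perm, Fintype.card_fin] at hc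
  have e1 : (n:ℝ) ^ k * Ex (fun v : Fin k → Fin n => ind (fe E r v = (ℓ:ℤ))) = S.card := by
    unfold Ex ind
    rw [Fintype.card_fun, Fintype.card_fin, Fintype.card_fin]
    push_cast
    rw [mul_div_cancel₀ _ (by positivity), hS, card_filter]
    push_cast
    apply sum_congr rfl; intro v _
    congr 1
  rw [e1]
  exact_mod_cast hc

lemma Nmax_le {n k : ℕ} (hn : 0 < n) (r ℓ : ℕ) (b : ℝ)
    (hb : ∀ E : Finset (Finset (Fin n)), Ex (fun v : Fin k → Fin n => ind (fe E r v = (ℓ:ℤ))) ≤ b) :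
    (Nmax r k ℓ n : ℝ) * k.factorial ≤ (n:ℝ) ^ k * b := by
  have hmem : Nmax r k ℓ n ∈ {c : ℕ | ∃ E : Finset (Finset (Fin n)), (∀ e ∈ E, e.card = r) ∧
      c = (((Finset.univ : Finset (Fin n)).powersetCard k).filter (fun U => (E.filter (fun e => e ⊆ U)).card = ℓ)).card} := by
    unfold Nmax
    apply Nat.sSup_mem
    · exact ⟨_, ∅, by simp, rfl⟩
    · refine ⟨((Finset.univ : Finset (Fin n)).powersetCard k).card, ?_⟩
      rintro c ⟨E, -, rfl⟩
      exact card_filter_le _ _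
  obtain ⟨E, hE, hc⟩ := hmem
  rw [hc]
  exact (count_le hn r ℓ E hE).trans (mul_le_mul_of_nonneg_left (hb E) (by positivity))

end EdgeStat

theorem stmt_16 (r : ℕ) (hr : 0 < r) (ε : ℝ) (hε : 0 < ε) :
    ∃ K : ℝ, ∀ (k ℓ : ℕ) (α : ℝ), 0 < α → α ≤ 1 / 2 → r ≤ k → K ≤ α * k →
      α * (k.choose r : ℝ) ≤ (ℓ : ℝ) → (ℓ : ℝ) ≤ (1 - α) * (k.choose r : ℝ) →
      ∀ L : ℝ,
        Filter.Tendsto (fun n : ℕ => (Nmax r k ℓ n : ℝ) / (n.choose k : ℝ))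
          Filter.atTop (nhds L) →
        L ≤ (α * k) ^ (-(1 / 2 - ε) : ℝ) := by
  obtain ⟨K₀, h⟩ := EdgeStat.prob_final r hr ε hε
  refine ⟨K₀, ?_⟩
  intro k ℓ α hα hα1 hrk hk hl1 hl2 L hL
  set b : ℝ := (α * k) ^ (-(1 / 2 - ε) : ℝ) with hb
  have hlim : Filter.Tendsto (fun n : ℕ => ((n:ℝ) ^ k / (n.descFactorial k : ℝ)) * b) Filter.atTop (nhds b) := by
    have h1 := Asymptotics.IsEquivalent.symm (isEquivalent_descFactorial k)
    have h2 := (Asymptotics.isEquivalent_iff_tendsto_one (by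
      filter_upwards [Filter.eventually_ge_atTop k] with n hn
      have : 0 < n.descFactorial k := Nat.descFactorial_pos.mpr hn
      positivity)).mp h1
    have h3 := h2.mul_const b
    rw [one_mul] at h3
    exact h3
  refine le_of_tendsto_of_tendsto hL hlim ?_
  filter_upwards [Filter.eventually_ge_atTop (k + 1)] with n hn
  have : Nonempty (Fin n) := ⟨⟨0, by omega⟩⟩
  have hN := EdgeStat.Nmax_le (n := n) (k := k) (by omega) r ℓ b
    (fun E => h k ℓ α (Fin n) E hα hα1 hk (by simpa using hl1) (by simpa using hl2))
  have hd : 0 < n.descFactorial k := Nat.descFactorial_pos.mpr (by omega)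
  have hc : 0 < n.choose k := Nat.choose_pos (by omega)
  have hd' : (0:ℝ) < n.descFactorial k := by exact_mod_cast hd
  have hc' : (0:ℝ) < n.choose k := by exact_mod_cast hc
  have he : (n.descFactorial k : ℝ) = k.factorial * n.choose k := by
    exact_mod_cast Nat.descFactorial_eq_factorial_mul_choose n k
  rw [div_le_iff₀ hc', div_mul_eq_mul_div, div_mul_eq_mul_div, le_div_iff₀ hd', he]
  have := mul_le_mul_of_nonneg_right hN hc'.le
  linarith
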